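/- Let Σ ⊆ ℝ² be a planar domain with infinitely many ends. Then Σ admits a compact exhaustion Σ₁ ⊆ Σ₂ ⊆ ⋯, where each Σ_n is a compact 2-dimensional topological submanifold-with-boundary of Σ, Σ_n is contained in the interior of Σ_{n+1}, and ∪_n Σ_n = Σ, satisfying: (1) Σ₁ is homeomorphic to a compact annulus; (2) each connected component of Σ_{n+1} ∖ int(Σ_n) has exactly one boundary component contained in ∂Σ_n and at least one boundary component contained in ∂Σ_{n+1}; (3) exactly one connected component of Σ_{n+1} ∖ int(Σ_n) is not homeomorphic to a compact annulus, and that component is a pair of pants. -/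

import Mathlib

noncomputable section

open Filter Set Topology

/-- An end of a subset `S` of a topological space: a choice, for every compact
`K ⊆ S`, of a connected component of `S ∖ K` with non-compact closure (closure taken
in `S`), compatible with inclusions. -/
structure SetEnd {X : Type*} [TopologicalSpace X] (S : Set X) where
  sel : Set X → Set X
  isCC : ∀ K : Set X, IsCompact K → K ⊆ S →
    ∃ x ∈ S \ K, sel K = connectedComponentIn (S \ K) x
  noncpt : ∀ K : Set X, IsCompact K → K ⊆ S → ¬ IsCompact (closure (sel K) ∩ S)
  mono : ∀ K K' : Set X, IsCompact K → IsCompact K' → K ⊆ S → K' ⊆ S → K ⊆ K' →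
    sel K' ⊆ sel K

/-- The closed upper half-plane, local model of surfaces with boundary. -/
def HalfPlane : Set (ℝ × ℝ) := {y : ℝ × ℝ | 0 ≤ y.2}

/-- A compact `2`-dimensional topological submanifold-with-boundary of the plane:
a compact set each of whose points has a neighborhood (in the set) homeomorphic to a
relatively open subset of the closed half-plane. -/
def IsCompactSurfaceWithBoundary (A : Set (ℝ × ℝ)) : Prop :=
  IsCompact A ∧ ∀ x ∈ A, ∃ U : Set (ℝ × ℝ), x ∈ U ∧ IsOpen U ∧
    ∃ W : Set (ℝ × ℝ), W ⊆ HalfPlane ∧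
      IsOpen (Subtype.val ⁻¹' W : Set ↥HalfPlane) ∧
      Nonempty (↥(U ∩ A) ≃ₜ ↥W)

/-- The model compact annulus `S¹ × [0,1]`. -/
abbrev AnnulusModel : Type := ↥(Metric.sphere (0 : ℝ × ℝ) 1) × ↥(Icc (0:ℝ) 1)

/-- A compact annulus. -/
def IsAnnulus (A : Set (ℝ × ℝ)) : Prop := Nonempty (↥A ≃ₜ AnnulusModel)

/-- A model pair of pants: a closed disk with two disjoint open subdisks (with disjoint
closures contained in the open disk) removed. -/
def PantsModel : Set (ℝ × ℝ) :=
  Metric.closedBall (0 : ℝ × ℝ) 4 \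
    (Metric.ball (((2:ℝ), (0:ℝ)) : ℝ × ℝ) 1 ∪ Metric.ball (((-2:ℝ), (0:ℝ)) : ℝ × ℝ) 1)

/-- A pair of pants. -/
def IsPairOfPants (A : Set (ℝ × ℝ)) : Prop := Nonempty (↥A ≃ₜ ↥PantsModel)

/-- The plane with the sup norm. -/
abbrev Plane : Type := ℝ × ℝ

/-- `h` is a homothety in a neighborhood of `c`. -/
def LH (h : Plane → Plane) (c : Plane) : Prop :=
  ∃ t > 0, ∃ μ : ℝ, 0 < μ ∧ ∀ x : Plane, ‖x‖ < t → h (c + x) = h c + μ • x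

lemma LH.comp {h k : Plane → Plane} {c : Plane} (hk : LH k (h c)) (hh : LH h c) :
    LH (fun x => k (h x)) c := by
  obtain ⟨t, ht, μ, hμ, H⟩ := hh
  obtain ⟨s, hs, ν, hν, K⟩ := hk
  refine ⟨min t (s / μ), by positivity, ν * μ, by positivity, fun x hx => ?_⟩
  have h1 : ‖x‖ < t := hx.trans_le (min_le_left _ _)
  have h2 : ‖x‖ < s / μ := hx.trans_le (min_le_right _ _)
  have h3 : ‖μ • x‖ < s := by
    rw [norm_smul, Real.norm_of_nonneg hμ.le]
    rwa [lt_div_iff₀' hμ] at h2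
  simp only [H x h1, K _ h3, smul_smul]

lemma LH.symm {h : Plane ≃ₜ Plane} {c : Plane} (hh : LH h c) : LH h.symm (h c) := by
  obtain ⟨t, ht, μ, hμ, H⟩ := hh
  refine ⟨t * μ, by positivity, μ⁻¹, by positivity, fun x hx => ?_⟩
  have h3 : ‖μ⁻¹ • x‖ < t := by
    rw [norm_smul, Real.norm_of_nonneg (by positivity), inv_mul_lt_iff₀ hμ]
    linarith
  rw [Homeomorph.symm_apply_eq, Homeomorph.symm_apply_apply, H _ h3, smul_smul,
    mul_inv_cancel₀ hμ.ne', one_smul]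

lemma LH.of_eventuallyEq {h k : Plane → Plane} {c : Plane} (hh : LH h c)
    (e : h =ᶠ[𝓝 c] k) : LH k c := by
  obtain ⟨t, ht, μ, hμ, H⟩ := hh
  obtain ⟨s, hs, K⟩ := Metric.eventually_nhds_iff_ball.1 e
  refine ⟨min t s, by positivity, μ, hμ, fun x hx => ?_⟩
  rw [← K (c + x), ← K c, H x (hx.trans_le (min_le_left _ _))]
  · exact Metric.mem_ball_self hs
  · simpa using hx.trans_le (min_le_right _ _)

lemma lh_id (c : Plane) : LH (fun x => x) c :=
  ⟨1, one_pos, 1, one_pos, fun x _ => by simp⟩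

lemma lh_homothety (a : Plane) {r : ℝ} (hr : 0 < r) (c : Plane) :
    LH (fun x => a + r • x) c :=
  ⟨1, one_pos, r, hr, fun x _ => by simp only [smul_add, add_assoc]⟩

/-- The homothety `x ↦ a + r x`. -/
def homothetyHomeo (a : Plane) (r : ℝ) (hr : 0 < r) : Plane ≃ₜ Plane :=
  (Homeomorph.smulOfNeZero r hr.ne').trans (Homeomorph.addLeft a)

@[simp] lemma homothetyHomeo_apply (a : Plane) (r : ℝ) (hr : 0 < r) (x : Plane) :
    homothetyHomeo a r hr x = a + r • x := rfl

lemma homothetyHomeo_lh (a : Plane) {r : ℝ} (hr : 0 < r) (c : Plane) :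
    LH (homothetyHomeo a r hr) c := lh_homothety a hr c

lemma homothetyHomeo_closedBall (a : Plane) {r : ℝ} (hr : 0 < r) :
    homothetyHomeo a r hr '' Metric.closedBall 0 1 = Metric.closedBall a r := by
  ext y
  simp only [mem_image, homothetyHomeo_apply, Metric.mem_closedBall, dist_eq_norm, sub_zero]
  constructor
  · rintro ⟨x, hx, rfl⟩
    rw [add_sub_cancel_left, norm_smul, Real.norm_of_nonneg hr.le]
    nlinarith
  · intro h
    refine ⟨r⁻¹ • (y - a), ?_, ?_⟩
    · rw [norm_smul, Real.norm_of_nonneg (by positivity), inv_mul_le_iff₀ hr]; linarith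
    · rw [smul_smul, mul_inv_cancel₀ hr.ne', one_smul]; abel

lemma homothetyHomeo_ball (a : Plane) {r : ℝ} (hr : 0 < r) :
    homothetyHomeo a r hr '' Metric.ball 0 1 = Metric.ball a r := by
  rw [← interior_closedBall _ one_ne_zero, Homeomorph.image_interior, homothetyHomeo_closedBall,
    interior_closedBall _ hr.ne']

/-- A closed disc parametrized by a homeomorphism of the plane which is a homothety near `0`. -/
def Tame (D : Set Plane) : Prop :=
  ∃ g : Plane ≃ₜ Plane, LH g 0 ∧ g '' Metric.closedBall 0 1 = D

lemma tame_closedBall (a : Plane) {r : ℝ} (hr : 0 < r) : Tame (Metric.closedBall a r) :=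
  ⟨_, homothetyHomeo_lh a hr 0, homothetyHomeo_closedBall a hr⟩

/-- A continuous proper bijection of the plane is a homeomorphism. -/
def homeoOfProper (f : Plane → Plane) (hc : Continuous f) (hb : Function.Bijective f)
    (hp : Tendsto f (cocompact Plane) (cocompact Plane)) : Plane ≃ₜ Plane :=
  (Equiv.ofBijective f hb).toHomeomorphOfContinuousClosed hc
    (isProperMap_iff_tendsto_cocompact.2 ⟨hc, hp⟩).isClosedMap

lemma tendsto_cocompact_of_norm_le {f : Plane → Plane} {δ C : ℝ} (hδ : 0 < δ)
    (h : ∀ x, δ * ‖x‖ - C ≤ ‖f x‖) : Tendsto f (cocompact Plane) (cocompact Plane) := by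
  rw [← Metric.cobounded_eq_cocompact, ← tendsto_norm_atTop_iff_cobounded]
  refine tendsto_atTop_mono h ?_
  exact tendsto_atTop_add_const_right _ _
    (tendsto_norm_cobounded_atTop.const_mul_atTop hδ)

/-- Radially expanding maps are homeomorphisms. -/
lemma exists_radial_homeo (m : Plane → ℝ) (hm : Continuous m) {δ : ℝ} (hδ : 0 < δ)
    (hmδ : ∀ x, δ ≤ m x) (hmono : ∀ (x : Plane) (s : ℝ), 0 ≤ s → s ≤ 1 → m (s • x) ≤ m x) :
    ∃ h : Plane ≃ₜ Plane, ∀ x, h x = m x • x := by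
  have hpos : ∀ x, 0 < m x := fun x => hδ.trans_le (hmδ x)
  have hcont : Continuous fun x : Plane => m x • x := by fun_prop
  have key : ∀ x y : Plane, m x ≤ m y → m x • x = m y • y → x = y := by
    intro x y hle h
    have hy : y = (m x / m y) • x := by
      rw [div_eq_inv_mul, mul_smul, h, smul_smul, inv_mul_cancel₀ (hpos y).ne', one_smul]
    have h1 : m y ≤ m x := by
      have := hmono x (m x / m y) (by have := hpos x; have := hpos y; positivity)
        ((div_le_one (hpos y)).2 hle)
      rwa [← hy] at this
    rw [hy, le_antisymm hle h1, div_self (hpos y).ne', one_smul]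
  have hb : Function.Bijective fun x : Plane => m x • x := by
    constructor
    · intro x y h
      rcases le_total (m x) (m y) with hle | hle
      · exact key x y hle h
      · exact (key y x hle h.symm).symm
    · intro y
      have hc : ContinuousOn (fun t : ℝ => t * m (t • y)) (Icc 0 δ⁻¹) := by fun_prop
      have h1 : (1 : ℝ) ∈ Icc (0 * m ((0:ℝ) • y)) (δ⁻¹ * m (δ⁻¹ • y)) := by
        constructor
        · simp
        · have := hmδ (δ⁻¹ • y)
          rw [inv_mul_eq_div, le_div_iff₀ hδ]; linarith
      obtain ⟨t, -, ht⟩ := intermediate_value_Icc (by positivity) hc h1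
      refine ⟨t • y, ?_⟩
      simp only [smul_smul]
      simp only at ht
      rw [mul_comm, ht, one_smul]
  have hp : Tendsto (fun x : Plane => m x • x) (cocompact Plane) (cocompact Plane) := by
    refine tendsto_cocompact_of_norm_le (C := 0) hδ fun x => ?_
    rw [norm_smul, Real.norm_of_nonneg (hpos x).le, sub_zero]
    exact mul_le_mul_of_nonneg_right (hmδ x) (norm_nonneg _)
  exact ⟨homeoOfProper _ hcont hb hp, fun x => rfl⟩

/-- A monotone vertical shear is a homeomorphism. -/
lemma exists_shear_homeo (ψ : Plane → ℝ) (hψ : Continuous ψ)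
    (hmono : ∀ x, StrictMono fun y => ψ (x, y)) {C : ℝ} (hC : ∀ p : Plane, |ψ p - p.2| ≤ C) :
    ∃ h : Plane ≃ₜ Plane, ∀ p : Plane, h p = (p.1, ψ p) := by
  have hcont : Continuous fun p : Plane => (p.1, ψ p) := by fun_prop
  have hb : Function.Bijective fun p : Plane => (p.1, ψ p) := by
    constructor
    · rintro ⟨x, y⟩ ⟨x', y'⟩ h
      simp only [Prod.mk.injEq] at h
      obtain ⟨rfl, h⟩ := h
      exact Prod.ext rfl ((hmono x).injective h)
    · rintro ⟨x, y⟩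
      have hc : ContinuousOn (fun t : ℝ => ψ (x, t)) (Icc (y - C) (y + C)) := by fun_prop
      have hC0 : 0 ≤ C := (abs_nonneg _).trans (hC 0)
      have h1 : y ∈ Icc (ψ (x, y - C)) (ψ (x, y + C)) := by
        have := abs_le.1 (hC (x, y - C))
        have := abs_le.1 (hC (x, y + C))
        simp only at *
        constructor <;> linarith
      obtain ⟨t, -, ht⟩ := intermediate_value_Icc (by linarith) hc h1
      exact ⟨(x, t), Prod.ext rfl ht⟩
  have hp : Tendsto (fun p : Plane => (p.1, ψ p)) (cocompact Plane) (cocompact Plane) := by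
    refine tendsto_cocompact_of_norm_le (C := C) one_pos fun p => ?_
    have h1 := abs_le.1 (hC p)
    have hC0 : 0 ≤ C := (abs_nonneg _).trans (hC 0)
    rw [Prod.norm_def, Prod.norm_def, Real.norm_eq_abs, Real.norm_eq_abs, Real.norm_eq_abs,
      one_mul, sub_le_iff_le_add, max_le_iff]
    constructor
    · exact (le_max_left _ _).trans (by linarith)
    · have : |p.2| ≤ |ψ p| + C := by
        have := abs_sub_abs_le_abs_sub (p.2) (ψ p)
        rw [abs_sub_comm] at this
        linarith [hC p]
      exact this.trans (by gcongr; exact le_max_right _ _)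
  exact ⟨homeoOfProper _ hcont hb hp, fun x => rfl⟩

/-- `h` is the identity outside a compact subset of `O`. -/
def SuppIn (h : Plane ≃ₜ Plane) (O : Set Plane) : Prop :=
  ∃ K, IsCompact K ∧ K ⊆ O ∧ ∀ x ∉ K, h x = x

lemma suppIn_refl (O : Set Plane) : SuppIn (Homeomorph.refl _) O :=
  ⟨∅, isCompact_empty, empty_subset _, fun _ _ => rfl⟩

lemma SuppIn.trans {h k : Plane ≃ₜ Plane} {O : Set Plane} (hh : SuppIn h O) (hk : SuppIn k O) :
    SuppIn (h.trans k) O := by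
  obtain ⟨K, hK, hKO, H⟩ := hh
  obtain ⟨L, hL, hLO, H'⟩ := hk
  refine ⟨K ∪ L, hK.union hL, union_subset hKO hLO, fun x hx => ?_⟩
  simp only [mem_union, not_or] at hx
  simp [H x hx.1, H' x hx.2]

lemma SuppIn.symm {h : Plane ≃ₜ Plane} {O : Set Plane} (hh : SuppIn h O) :
    SuppIn h.symm O := by
  obtain ⟨K, hK, hKO, H⟩ := hh
  refine ⟨K, hK, hKO, fun x hx => ?_⟩
  rw [Homeomorph.symm_apply_eq, H x hx]

lemma SuppIn.conj {h g : Plane ≃ₜ Plane} {O : Set Plane} (hh : SuppIn h (g ⁻¹' O)) :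
    SuppIn (g.symm.trans (h.trans g)) O := by
  obtain ⟨K, hK, hKO, H⟩ := hh
  refine ⟨g '' K, hK.image g.continuous, image_subset_iff.2 hKO, fun x hx => ?_⟩
  have : g.symm x ∉ K := fun h' => hx ⟨_, h', g.apply_symm_apply x⟩
  simp [H _ this]

lemma SuppIn.apply_eq {h : Plane ≃ₜ Plane} {O : Set Plane} (hh : SuppIn h O) {x : Plane}
    (hx : x ∉ O) : h x = x := by
  obtain ⟨K, hK, hKO, H⟩ := hh
  exact H x fun h => hx (hKO h)

lemma SuppIn.image_subset {h : Plane ≃ₜ Plane} {O S : Set Plane} (hh : SuppIn h O) (hS : O ⊆ S) :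
    h '' S ⊆ S := by
  rintro _ ⟨x, hx, rfl⟩
  by_contra hn
  have h1 : h.symm (h x) = h x := hh.symm.apply_eq fun h' => hn (hS h')
  rw [Homeomorph.symm_apply_apply] at h1
  rw [← h1] at hn
  exact hn hx

lemma SuppIn.image_eq {h : Plane ≃ₜ Plane} {O S : Set Plane} (hh : SuppIn h O) (hS : O ⊆ S) :
    h '' S = S := by
  refine (hh.image_subset hS).antisymm fun x hx => ?_
  exact ⟨h.symm x, hh.symm.image_subset hS ⟨x, hx, rfl⟩, h.apply_symm_apply x⟩

lemma SuppIn.image_eq_of_disjoint {h : Plane ≃ₜ Plane} {O S : Set Plane} (hh : SuppIn h O)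
    (hS : Disjoint O S) : h '' S = S := by
  refine (image_congr fun x hx => ?_).trans (image_id S)
  exact hh.apply_eq fun hO => disjoint_left.1 hS hO hx

lemma SuppIn.eventually_eq {h : Plane ≃ₜ Plane} {O : Set Plane} (hh : SuppIn h O) {x : Plane}
    (hx : x ∉ O) : (fun y => y) =ᶠ[𝓝 x] h := by
  obtain ⟨K, hK, hKO, H⟩ := hh
  filter_upwards [hK.isClosed.isOpen_compl.mem_nhds fun h => hx (hKO h)] with y hy
  exact (H y hy).symm

lemma SuppIn.lh {h : Plane ≃ₜ Plane} {O : Set Plane} (hh : SuppIn h O) {x : Plane}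
    (hx : x ∉ O) : LH h x :=
  (lh_id x).of_eventuallyEq (hh.eventually_eq hx)

lemma Tame.image {D : Set Plane} {g : Plane ≃ₜ Plane} (hg : LH g 0)
    (hD : g '' Metric.closedBall 0 1 = D) {h : Plane ≃ₜ Plane} (hh : LH h (g 0)) :
    Tame (h '' D) :=
  ⟨g.trans h, hh.comp hg, by rw [← hD, ← image_comp]; rfl⟩

/-- Near every point of an open set, small translations extend to homeomorphisms supported in the
open set. -/
lemma exists_local_push {O : Set Plane} (hO : IsOpen O) {c : Plane} (hc : c ∈ O) :
    ∃ ε > 0, ∀ v : Plane, ‖v‖ < ε → ∃ h : Plane ≃ₜ Plane, SuppIn h O ∧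
      ∃ t > 0, ∀ x : Plane, ‖x‖ < t → h (c + x) = c + v + x := by
  obtain ⟨R, hR, hRO⟩ := Metric.nhds_basis_closedBall.mem_iff.1 (hO.mem_nhds hc)
  refine ⟨R / 2, by positivity, fun v hv => ?_⟩
  let η : Plane → ℝ := fun x => max 0 (min 1 (2 - 2 / R * ‖x - c‖))
  have hη : LipschitzWith (Real.toNNReal (2 / R)) η := by
    refine LipschitzWith.const_max (LipschitzWith.const_min ?_ 1) 0
    refine LipschitzWith.of_dist_le_mul fun x y => ?_
    rw [Real.coe_toNNReal _ (by positivity), Real.dist_eq, dist_eq_norm]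
    have : 2 - 2 / R * ‖x - c‖ - (2 - 2 / R * ‖y - c‖) = 2 / R * (‖y - c‖ - ‖x - c‖) := by ring
    rw [this, abs_mul, abs_of_pos (by positivity)]
    gcongr
    have := abs_norm_sub_norm_le (y - c) (x - c)
    rwa [sub_sub_sub_cancel_right, norm_sub_rev y x] at this
  have happ : ApproximatesLinearOn (fun x => x + η x • v)
      ((ContinuousLinearEquiv.refl ℝ Plane : Plane ≃L[ℝ] Plane) : Plane →L[ℝ] Plane) univ
      (Real.toNNReal (2 / R * ‖v‖)) := by
    intro x _ y _
    have h1 : (x + η x • v) - (y + η y • v) -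
        ((ContinuousLinearEquiv.refl ℝ Plane : Plane ≃L[ℝ] Plane) : Plane →L[ℝ] Plane) (x - y)
        = (η x - η y) • v := by
      simp [sub_smul]; abel
    rw [h1, norm_smul, Real.coe_toNNReal _ (by positivity)]
    have := hη.dist_le_mul x y
    rw [Real.coe_toNNReal _ (by positivity), dist_eq_norm, dist_eq_norm] at this
    calc ‖η x - η y‖ * ‖v‖ ≤ 2 / R * ‖x - y‖ * ‖v‖ := by gcongr
      _ = _ := by ring
  have hlt : Subsingleton Plane ∨ (Real.toNNReal (2 / R * ‖v‖)) <
      ‖((ContinuousLinearEquiv.refl ℝ Plane).symm : Plane →L[ℝ] Plane)‖₊⁻¹ := by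
    right
    have : ‖((ContinuousLinearEquiv.refl ℝ Plane).symm : Plane →L[ℝ] Plane)‖₊ = 1 := by
      have := ContinuousLinearMap.nnnorm_id (𝕜 := ℝ) (E := Plane)
      exact this
    rw [this, inv_one, Real.toNNReal_lt_one, div_mul_eq_mul_div, div_lt_one hR]
    linarith
  refine ⟨happ.toHomeomorph _ hlt, ⟨Metric.closedBall c R, isCompact_closedBall _ _, hRO,
    fun x hx => ?_⟩, R / 2, by positivity, fun x hx => ?_⟩
  · change x + η x • v = x
    have hx' : R < ‖x - c‖ := by
      rw [← dist_eq_norm]; simpa using hx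
    have : 2 - 2 / R * ‖x - c‖ ≤ 0 := by
      rw [div_mul_eq_mul_div, sub_nonpos, le_div_iff₀ hR]; linarith
    have : η x = 0 := max_eq_left ((min_le_right _ _).trans this)
    rw [this, zero_smul, add_zero]
  · change c + x + η (c + x) • v = _
    have : 1 ≤ 2 - 2 / R * ‖c + x - c‖ := by
      rw [add_sub_cancel_left, div_mul_eq_mul_div, le_sub_comm, div_le_iff₀ hR]; linarith
    have : η (c + x) = 1 := by
      simp only [η]; rw [min_eq_left this]; norm_num
    rw [this, one_smul]; abel

lemma exists_push {O : Set Plane} (hO : IsOpen O) (hOc : IsPreconnected O) {c c' : Plane}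
    (hc : c ∈ O) (hc' : c' ∈ O) :
    ∃ h : Plane ≃ₜ Plane, SuppIn h O ∧
      ∃ t > 0, ∀ x : Plane, ‖x‖ < t → h (c + x) = c' + x := by
  let S : Set Plane := {a | a ∈ O ∧ ∃ h : Plane ≃ₜ Plane, SuppIn h O ∧
      ∃ t > 0, ∀ x : Plane, ‖x‖ < t → h (c + x) = a + x}
  have trans : ∀ (a b : Plane) (h k : Plane ≃ₜ Plane),
      SuppIn h O → (∃ t > 0, ∀ x : Plane, ‖x‖ < t → h (c + x) = a + x) →
      SuppIn k O → (∃ t > 0, ∀ x : Plane, ‖x‖ < t → k (a + x) = b + x) →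
      ∃ h : Plane ≃ₜ Plane, SuppIn h O ∧
        ∃ t > 0, ∀ x : Plane, ‖x‖ < t → h (c + x) = b + x := by
    rintro a b h k hh ⟨t, ht, H⟩ hk ⟨s, hs, K⟩
    refine ⟨h.trans k, hh.trans hk, min t s, by positivity, fun x hx => ?_⟩
    rw [Homeomorph.trans_apply, H x (hx.trans_le (min_le_left _ _)),
      K x (hx.trans_le (min_le_right _ _))]
  have hcS : c ∈ S := ⟨hc, Homeomorph.refl _, suppIn_refl _, 1, one_pos, fun x _ => rfl⟩
  have hSo : IsOpen S := by
    rw [Metric.isOpen_iff]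
    rintro a ⟨haO, h, hh, ha⟩
    obtain ⟨ε, hε, H⟩ := exists_local_push hO haO
    obtain ⟨δ, hδ, hδO⟩ := Metric.isOpen_iff.1 hO a haO
    refine ⟨min ε δ, by positivity, fun b hb => ?_⟩
    refine ⟨hδO (Metric.ball_subset_ball (min_le_right _ _) hb), ?_⟩
    obtain ⟨k, hk, t, ht, K⟩ := H (b - a) (by
      rw [← dist_eq_norm]; exact (Metric.mem_ball.1 hb).trans_le (min_le_left _ _))
    exact trans a b h k hh ha hk ⟨t, ht, fun x hx => by rw [K x hx]; abel⟩
  have hcl : closure S ∩ O ⊆ S := by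
    rintro b ⟨hb, hbO⟩
    obtain ⟨ε, hε, H⟩ := exists_local_push hO hbO
    obtain ⟨a, ⟨haO, h, hh, ha⟩, hab⟩ := Metric.mem_closure_iff.1 hb ε hε
    obtain ⟨k, hk, t, ht, K⟩ := H (a - b) (by rwa [← dist_eq_norm, dist_comm])
    refine ⟨hbO, trans a b h k.symm hh ha hk.symm ⟨t, ht, fun x hx => ?_⟩⟩
    rw [Homeomorph.symm_apply_eq, K x hx]; abel
  exact (hOc.subset_of_closure_inter_subset hSo ⟨c, hc, hcS⟩ hcl hc').2

lemma image_closedBall_interior (g : Plane ≃ₜ Plane) :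
    interior (g '' Metric.closedBall 0 1) = g '' Metric.ball 0 1 := by
  rw [← Homeomorph.image_interior, interior_closedBall _ one_ne_zero]

lemma image_closedBall_frontier (g : Plane ≃ₜ Plane) :
    frontier (g '' Metric.closedBall 0 1) = g '' Metric.sphere 0 1 := by
  rw [← Homeomorph.image_frontier, frontier_closedBall _ one_ne_zero]

lemma rank_plane : 1 < Module.rank ℝ Plane := by
  rw [rank_prod', Module.rank_self]; norm_num

lemma Tame.isCompact {D : Set Plane} (h : Tame D) : IsCompact D := by
  obtain ⟨g, -, rfl⟩ := h
  exact (isCompact_closedBall _ _).image g.continuous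

lemma Tame.isClosed {D : Set Plane} (h : Tame D) : IsClosed D := h.isCompact.isClosed

lemma Tame.isConnected {D : Set Plane} (h : Tame D) : IsConnected D := by
  obtain ⟨g, -, rfl⟩ := h
  exact (Metric.isConnected_closedBall zero_le_one).image _ g.continuous.continuousOn

lemma Tame.isConnected_interior {D : Set Plane} (h : Tame D) : IsConnected (interior D) := by
  obtain ⟨g, -, rfl⟩ := h
  rw [image_closedBall_interior]
  exact (Metric.isConnected_ball one_pos).image _ g.continuous.continuousOn

lemma Tame.closure_interior {D : Set Plane} (h : Tame D) : closure (interior D) = D := by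
  obtain ⟨g, -, rfl⟩ := h
  rw [image_closedBall_interior, ← Homeomorph.image_closure, closure_ball _ one_ne_zero]

lemma Tame.isConnected_frontier {D : Set Plane} (h : Tame D) : IsConnected (frontier D) := by
  obtain ⟨g, -, rfl⟩ := h
  rw [image_closedBall_frontier]
  exact (isConnected_sphere rank_plane _ zero_le_one).image _ g.continuous.continuousOn

lemma isPreconnected_diff_of_collar {X : Type*} [TopologicalSpace X] {O B N : Set X}
    (hO : IsPreconnected O) (hB : IsClosed B) (hN : IsOpen N) (hBN : B ⊆ N)
    (hNB : IsPreconnected (N \ B)) (hNO : N ⊆ O) (hne : (N \ B).Nonempty) :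
    IsPreconnected (O \ B) := by
  have main : ∀ u v : Set X, IsOpen u → IsOpen v → O \ B ⊆ u ∪ v → (O \ B) ∩ (u ∩ v) = ∅ →
      N \ B ⊆ u → O \ B ⊆ u ∨ O \ B ⊆ v := by
    intro u v hu hv huv hd hNu
    have hdis : ∀ x, x ∈ O → x ∉ B → x ∈ u → x ∉ v := fun x hx hxB hxu hxv => by
      have : x ∈ (O \ B) ∩ (u ∩ v) := ⟨⟨hx, hxB⟩, hxu, hxv⟩
      rw [hd] at this; exact this
    left
    have h1 : O ⊆ (u \ B ∪ N) ∪ (v \ B) := fun x hx => by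
      by_cases hxB : x ∈ B
      · exact Or.inl (Or.inr (hBN hxB))
      · rcases huv ⟨hx, hxB⟩ with h | h
        · exact Or.inl (Or.inl ⟨h, hxB⟩)
        · exact Or.inr ⟨h, hxB⟩
    have h2 : O ∩ ((u \ B ∪ N) ∩ (v \ B)) = ∅ := by
      ext x
      simp only [mem_inter_iff, mem_union, Set.mem_sdiff, mem_empty_iff_false, iff_false]
      rintro ⟨hx, h | h, hv, hB⟩
      · exact hdis x hx hB h.1 hv
      · exact hdis x hx hB (hNu ⟨h, hB⟩) hv
    rcases isPreconnected_iff_subset_of_disjoint.1 hO _ _ ((hu.sdiff hB).union hN)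
      (hv.sdiff hB) h1 h2 with h | h
    · rintro x ⟨hx, hxB⟩
      rcases h hx with h | h
      · exact h.1
      · exact hNu ⟨h, hxB⟩
    · obtain ⟨y, hy⟩ := hne
      exact absurd (h (hNO hy.1)).1 (hdis y (hNO hy.1) hy.2 (hNu hy))
  rw [isPreconnected_iff_subset_of_disjoint]
  intro u v hu hv huv hd
  have hNO' : N \ B ⊆ O \ B := sdiff_subset_sdiff_left hNO
  rcases isPreconnected_iff_subset_of_disjoint.1 hNB u v hu hv (hNO'.trans huv)
    (subset_empty_iff.1 ((inter_subset_inter_left _ hNO').trans hd.subset)) with h | h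
  · exact main u v hu hv huv hd h
  · exact (main v u hv hu (by rwa [union_comm]) (by rwa [inter_comm v u]) h).symm

lemma isConnected_ring {r R : ℝ} (hr : 0 ≤ r) (hR : r < R) :
    IsConnected (Metric.ball (0 : Plane) R \ Metric.closedBall 0 r) := by
  have : Metric.ball (0 : Plane) R \ Metric.closedBall 0 r =
      (fun p : ℝ × Plane => p.1 • p.2) '' (Ioo r R ×ˢ Metric.sphere 0 1) := by
    ext x
    simp only [Set.mem_sdiff, Metric.mem_ball, dist_zero_right, Metric.mem_closedBall, not_le,
      mem_image, mem_prod, mem_Ioo, mem_sphere_iff_norm, sub_zero]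
    constructor
    · rintro ⟨h1, h2⟩
      have h0 : ‖x‖ ≠ 0 := by linarith
      refine ⟨(‖x‖, ‖x‖⁻¹ • x), ⟨⟨h2, h1⟩, ?_⟩, ?_⟩
      · rw [norm_smul, norm_inv, norm_norm, inv_mul_cancel₀ h0]
      · rw [smul_smul, mul_inv_cancel₀ h0, one_smul]
    · rintro ⟨⟨a, y⟩, ⟨⟨h1, h2⟩, h3⟩, rfl⟩
      simp only at h1 h2 h3 ⊢
      rw [norm_smul, h3, Real.norm_of_nonneg (by linarith)]
      constructor <;> linarith
  rw [this]
  exact ((isConnected_Ioo hR).prod (isConnected_sphere rank_plane _ zero_le_one)).image _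
    (by fun_prop)

lemma exists_collar {O : Set Plane} (hO : IsOpen O) (h : Metric.closedBall (0 : Plane) 1 ⊆ O) :
    ∃ R > 1, Metric.closedBall (0 : Plane) R ⊆ O := by
  obtain ⟨δ, hδ, H⟩ := (isCompact_closedBall (0 : Plane) 1).exists_cthickening_subset_open hO h
  refine ⟨1 + δ, by linarith, ?_⟩
  rwa [cthickening_closedBall hδ.le zero_le_one, add_comm] at H

lemma Tame.isConnected_diff {O E : Set Plane} (hE : Tame E) (hO : IsOpen O)
    (hOc : IsPreconnected O) (hEO : E ⊆ O) : IsConnected (O \ E) := by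
  obtain ⟨g, -, rfl⟩ := hE
  have h1 : Metric.closedBall 0 1 ⊆ g ⁻¹' O := image_subset_iff.1 hEO
  obtain ⟨R, hR, hRO⟩ := exists_collar (hO.preimage g.continuous) h1
  have hOc' : IsPreconnected (g ⁻¹' O) := by
    rw [← g.image_symm]; exact hOc.image _ g.symm.continuous.continuousOn
  have hr := isConnected_ring zero_le_one hR
  have hsub : Metric.ball 0 R ⊆ g ⁻¹' O := Metric.ball_subset_closedBall.trans hRO
  have h2 : IsConnected (g ⁻¹' O \ Metric.closedBall 0 1) :=
    ⟨hr.1.mono (sdiff_subset_sdiff_left hsub),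
      isPreconnected_diff_of_collar hOc' Metric.isClosed_closedBall Metric.isOpen_ball
        (Metric.closedBall_subset_ball hR) hr.2 hsub hr.1⟩
  have h3 : O \ g '' Metric.closedBall 0 1 = g '' (g ⁻¹' O \ Metric.closedBall 0 1) := by
    rw [image_sdiff g.injective, image_preimage_eq _ g.surjective]
  rw [h3]
  exact h2.image _ g.continuous.continuousOn

lemma isConnected_diff_biUnion {ι : Type*} {O : Set Plane} (hO : IsOpen O)
    (hOc : IsConnected O) (s : Finset ι) (E : ι → Set Plane) (hE : ∀ i ∈ s, Tame (E i))
    (hEO : ∀ i ∈ s, E i ⊆ O) (hd : (s : Set ι).PairwiseDisjoint E) :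
    IsOpen (O \ ⋃ i ∈ s, E i) ∧ IsConnected (O \ ⋃ i ∈ s, E i) := by
  classical
  induction s using Finset.induction_on with
  | empty => simpa using ⟨hO, hOc⟩
  | insert a s ha ih =>
    have ih' := ih (fun i hi => hE i (Finset.mem_insert_of_mem hi))
      (fun i hi => hEO i (Finset.mem_insert_of_mem hi))
      (hd.subset (by simp [Finset.coe_insert, subset_insert]))
    have heq : O \ ⋃ i ∈ insert a s, E i = (O \ ⋃ i ∈ s, E i) \ E a := by
      rw [Finset.set_biUnion_insert, union_comm, sdiff_sdiff]
    have hTa := hE a (Finset.mem_insert_self _ _)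
    rw [heq]
    refine ⟨ih'.1.sdiff hTa.isClosed, hTa.isConnected_diff ih'.1 ih'.2.isPreconnected ?_⟩
    intro x hx
    refine ⟨hEO a (Finset.mem_insert_self _ _) hx, ?_⟩
    simp only [mem_iUnion, not_exists]
    intro i hi hxi
    have hne : a ≠ i := by rintro rfl; exact ha hi
    exact disjoint_left.1 (hd (by simp) (by simp [hi]) hne) hx hxi

lemma exists_radial_interp {a b R₁ R₂ : ℝ} (ha : 0 < a) (hab : a ≤ b) (hR : R₁ < R₂) :
    ∃ h : Plane ≃ₜ Plane, (∀ x, ‖x‖ ≤ R₁ → h x = a • x) ∧ (∀ x, R₂ ≤ ‖x‖ → h x = b • x) ∧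
      (∀ x, ‖h x‖ ≤ b * ‖x‖) ∧ ∀ x, a * ‖x‖ ≤ ‖h x‖ := by
  let η : Plane → ℝ := fun x => max 0 (min 1 ((‖x‖ - R₁) / (R₂ - R₁)))
  have hη0 : ∀ x, 0 ≤ η x := fun x => le_max_left _ _
  have hη1 : ∀ x, η x ≤ 1 := fun x => max_le zero_le_one (min_le_left _ _)
  have hR' : 0 < R₂ - R₁ := sub_pos.2 hR
  have hηm : ∀ (x : Plane) (s : ℝ), 0 ≤ s → s ≤ 1 → η (s • x) ≤ η x := fun x s h0 h1 => by
    simp only [η]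
    gcongr
    rw [norm_smul, Real.norm_of_nonneg h0]
    exact mul_le_of_le_one_left (norm_nonneg _) h1
  obtain ⟨h, H⟩ := exists_radial_homeo (fun x => a + (b - a) * η x) (by fun_prop) ha
    (fun x => by nlinarith [hη0 x]) (fun x s h0 h1 => by
      have := hηm x s h0 h1
      have : (b - a) * η (s • x) ≤ (b - a) * η x := by gcongr
      linarith)
  refine ⟨h, fun x hx => ?_, fun x hx => ?_, fun x => ?_, fun x => ?_⟩
  · have : η x = 0 := max_eq_left ((min_le_right _ _).trans
      (div_nonpos_of_nonpos_of_nonneg (by linarith) hR'.le))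
    rw [H, this]; simp
  · have : η x = 1 := by
      simp only [η]
      rw [min_eq_left ((one_le_div hR').2 (by linarith))]; norm_num
    rw [H, this]; simp
  · rw [H, norm_smul, Real.norm_of_nonneg (by nlinarith [hη0 x])]
    have := hη1 x
    gcongr
    nlinarith
  · rw [H, norm_smul, Real.norm_of_nonneg (by nlinarith [hη0 x])]
    have := hη0 x
    gcongr
    nlinarith

lemma exists_squeeze {O : Set Plane} (hO : IsOpen O) (h : Metric.closedBall (0 : Plane) 1 ⊆ O)
    {ρ : ℝ} (hρ : 0 < ρ) (hρ1 : ρ ≤ 1) :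
    ∃ σ : Plane ≃ₜ Plane, SuppIn σ O ∧ ∀ x ∈ Metric.closedBall (0 : Plane) 1, σ x = ρ • x := by
  obtain ⟨R, hR, hRO⟩ := exists_collar hO h
  obtain ⟨σ, h1, h2, -, -⟩ := exists_radial_interp hρ hρ1 hR
  refine ⟨σ, ⟨Metric.closedBall 0 R, isCompact_closedBall _ _, hRO, fun x hx => ?_⟩,
    fun x hx => h1 x (by simpa using hx)⟩
  rw [h2 x (by simp at hx; exact hx.le), one_smul]

/-- Two parametrized discs in a connected open set are ambient isotopic with compact support. -/
lemma exists_move {O : Set Plane} (hO : IsOpen O) (hOc : IsPreconnected O) {g g' : Plane ≃ₜ Plane}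
    (hg : LH g 0) (hg' : LH g' 0) (hgO : g '' Metric.closedBall 0 1 ⊆ O)
    (hgO' : g' '' Metric.closedBall 0 1 ⊆ O) :
    ∃ h : Plane ≃ₜ Plane, SuppIn h O ∧ ∀ x ∈ Metric.closedBall (0 : Plane) 1, h (g x) = g' x := by
  have m0 : (0 : Plane) ∈ Metric.closedBall (0 : Plane) 1 := by simp
  obtain ⟨p, hp, s, hs, P⟩ := exists_push hO hOc (hgO ⟨0, m0, rfl⟩) (hgO' ⟨0, m0, rfl⟩)
  obtain ⟨t, ht, μ, hμ, G⟩ := hg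
  obtain ⟨t', ht', μ', hμ', G'⟩ := hg'
  obtain ⟨r, hr, hr'⟩ : ∃ r > 0, r < s ∧ r < t * μ ∧ r < t' * μ' ∧ r < μ ∧ r < μ' := by
    have hm : 0 < min s (min (t * μ) (min (t' * μ') (min μ μ'))) := by positivity
    refine ⟨_, half_pos hm, ?_⟩
    have := half_lt_self hm
    simpa only [lt_min_iff] using this
  obtain ⟨r1, r2, r3, r4, r5⟩ := hr'
  obtain ⟨σ, hσ, S⟩ := exists_squeeze (hO.preimage g.continuous) (image_subset_iff.1 hgO)
    (ρ := r / μ) (by positivity) ((div_le_one hμ).2 r4.le)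
  obtain ⟨σ', hσ', S'⟩ := exists_squeeze (hO.preimage g'.continuous) (image_subset_iff.1 hgO')
    (ρ := r / μ') (by positivity) ((div_le_one hμ').2 r5.le)
  refine ⟨((g.symm.trans (σ.trans g)).trans p).trans (g'.symm.trans (σ'.trans g')).symm,
    (hσ.conj.trans hp).trans hσ'.conj.symm, fun x hx => ?_⟩
  have hx1 : ‖x‖ ≤ 1 := by simpa using hx
  have e1 : g (σ x) = g 0 + r • x := by
    have : ‖(r / μ) • x‖ < t := by
      rw [norm_smul, Real.norm_of_nonneg (by positivity)]
      have : r / μ < t := by rwa [div_lt_iff₀ hμ]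
      have : 0 < r / μ := by positivity
      nlinarith
    have := G _ this
    rw [zero_add] at this
    rw [S x hx, this, smul_smul, mul_div_cancel₀ _ hμ.ne']
  have e2 : g' (σ' x) = g' 0 + r • x := by
    have : ‖(r / μ') • x‖ < t' := by
      rw [norm_smul, Real.norm_of_nonneg (by positivity)]
      have : r / μ' < t' := by rwa [div_lt_iff₀ hμ']
      have : 0 < r / μ' := by positivity
      nlinarith
    have := G' _ this
    rw [zero_add] at this
    rw [S' x hx, this, smul_smul, mul_div_cancel₀ _ hμ'.ne']
  have e3 : p (g 0 + r • x) = g' 0 + r • x := P _ (by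
    rw [norm_smul, Real.norm_of_nonneg hr.le]; nlinarith)
  rw [Homeomorph.trans_apply, Homeomorph.symm_apply_eq]
  simp [e1, e2, e3]

lemma image_ball_mem {g : Plane ≃ₜ Plane} : g 0 ∈ g '' Metric.ball 0 1 := ⟨0, by simp, rfl⟩

/-- The center of the parametrization of a tame disc can be chosen freely. -/
lemma Tame.exists_param {D : Set Plane} (hD : Tame D) {c : Plane} (hc : c ∈ interior D) :
    ∃ g : Plane ≃ₜ Plane, LH g 0 ∧ g '' Metric.closedBall 0 1 = D ∧ g 0 = c := by
  have hi := hD.isConnected_interior.isPreconnected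
  obtain ⟨g, hg, rfl⟩ := hD
  have h0 : g 0 ∈ interior (g '' Metric.closedBall 0 1) := by
    rw [image_closedBall_interior]; exact image_ball_mem
  obtain ⟨p, hp, t, ht, P⟩ := exists_push isOpen_interior hi h0 hc
  have hpl : LH p (g 0) := ⟨t, ht, 1, one_pos, fun x hx => by
    have := P 0 (by simpa using ht)
    rw [add_zero, add_zero] at this
    rw [P x hx, this, one_smul]⟩
  refine ⟨g.trans p, hpl.comp hg, ?_, ?_⟩
  · have := hp.image_eq interior_subset
    rw [← image_comp] at this
    exact this
  · simpa using P 0 (by simpa using ht)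

lemma IsAnnulus.image {A : Set Plane} (hA : IsAnnulus A) (h : Plane ≃ₜ Plane) :
    IsAnnulus (h '' A) :=
  hA.map fun e => (h.image A).symm.trans e

lemma IsPairOfPants.image {A : Set Plane} (hA : IsPairOfPants A) (h : Plane ≃ₜ Plane) :
    IsPairOfPants (h '' A) :=
  hA.map fun e => (h.image A).symm.trans e

lemma isAnnulus_round {r : ℝ} (hr : 0 < r) (hr1 : r < 1) :
    IsAnnulus (Metric.closedBall (0 : Plane) 1 \ Metric.ball 0 r) := by
  have hmem : ∀ x : ↥(Metric.closedBall (0 : Plane) 1 \ Metric.ball 0 r),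
      ‖(x : Plane)‖ ≤ 1 ∧ r ≤ ‖(x : Plane)‖ := fun x => by
    have := x.2
    rw [Set.mem_sdiff, mem_closedBall_zero_iff, mem_ball_zero_iff, not_lt] at this
    exact this
  have h0 : ∀ x : ↥(Metric.closedBall (0 : Plane) 1 \ Metric.ball 0 r),
      ‖(x : Plane)‖ ≠ 0 := fun x => (hr.trans_le (hmem x).2).ne'
  have hr' : 0 < 1 - r := sub_pos.2 hr1
  have hpos : ∀ t : ↥(Icc (0:ℝ) 1), 0 < r + (1 - r) * (t : ℝ) := fun t => by
    have := t.2.1; positivity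
  have hs : ∀ u : ↥(Metric.sphere (0 : Plane) 1), ‖(u : Plane)‖ = 1 := fun u => by
    simp
  refine ⟨⟨⟨fun x => (⟨‖(x : Plane)‖⁻¹ • (x : Plane), ?_⟩, ⟨(‖(x : Plane)‖ - r) / (1 - r), ?_⟩),
    fun p => ⟨(r + (1 - r) * (p.2 : ℝ)) • (p.1 : Plane), ?_⟩, ?_, ?_⟩, ?_, ?_⟩⟩
  · rw [mem_sphere_zero_iff_norm, norm_smul, norm_inv, norm_norm, inv_mul_cancel₀ (h0 x)]
  · obtain ⟨h1, h2⟩ := hmem x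
    exact ⟨div_nonneg (by linarith) hr'.le, (div_le_one hr').2 (by linarith)⟩
  · rw [Set.mem_sdiff, mem_closedBall_zero_iff, mem_ball_zero_iff, not_lt, norm_smul, hs, mul_one,
      Real.norm_of_nonneg (hpos p.2).le]
    have h1 := p.2.2.1
    have h2 := p.2.2.2
    constructor <;> nlinarith
  · intro x
    ext1
    simp only
    rw [mul_div_cancel₀ _ hr'.ne', smul_smul, add_sub_cancel, mul_inv_cancel₀ (h0 x), one_smul]
  · intro p
    have : ‖(r + (1 - r) * (p.2 : ℝ)) • (p.1 : Plane)‖ = r + (1 - r) * (p.2 : ℝ) := by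
      rw [norm_smul, hs, mul_one, Real.norm_of_nonneg (hpos p.2).le]
    ext1
    · ext1
      simp only [this]
      rw [smul_smul, inv_mul_cancel₀ (hpos p.2).ne', one_smul]
    · ext1
      simp only [this]
      field_simp
      ring
  · refine Continuous.prodMk (Continuous.subtype_mk ?_ _) (Continuous.subtype_mk ?_ _)
    · exact Continuous.smul (Continuous.inv₀ (by fun_prop) h0) (by fun_prop)
    · fun_prop
  · exact Continuous.subtype_mk (by fun_prop) _

/-- The two-dimensional annulus theorem for tame discs. -/
lemma isAnnulus_diff {D E : Set Plane} (hD : Tame D) (hE : Tame E) (hED : E ⊆ interior D) :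
    IsAnnulus (D \ interior E) := by
  have hc := hD.isConnected_interior.isPreconnected
  obtain ⟨g, hg, rfl⟩ := hD
  obtain ⟨k, hk, rfl⟩ := hE
  have hh : (0:ℝ) < 1 / 2 := by norm_num
  let g' := (homothetyHomeo 0 (1/2) hh).trans g
  have e1 : ∀ S : Set Plane, g' '' S = g '' (homothetyHomeo 0 (1/2) hh '' S) := fun S => by
    rw [← image_comp]; rfl
  have hg' : LH g' 0 := by
    refine LH.comp (k := g) ?_ (homothetyHomeo_lh 0 hh 0)
    simpa using hg
  obtain ⟨h, hs, H⟩ := exists_move isOpen_interior hc hk hg' hED (by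
    rw [e1, homothetyHomeo_closedBall, image_closedBall_interior]
    exact image_mono (Metric.closedBall_subset_ball (by norm_num)))
  have e2 : h '' (g '' Metric.closedBall 0 1 \ interior (k '' Metric.closedBall 0 1)) =
      g '' (Metric.closedBall 0 1 \ Metric.ball 0 (1/2)) := by
    have : h '' (k '' Metric.ball 0 1) = g' '' Metric.ball 0 1 := by
      rw [← image_comp]
      exact image_congr fun x hx => H x (Metric.ball_subset_closedBall hx)
    rw [image_sdiff h.injective, hs.image_eq interior_subset, image_closedBall_interior, this,
      e1, homothetyHomeo_ball, image_sdiff g.injective]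
  have := ((isAnnulus_round hh (by norm_num)).image g).image h.symm
  rw [← e2, ← image_comp] at this
  simpa using this

lemma LH.exists_nhds {g : Plane → Plane} (hg : LH g 0) :
    ∃ t > 0, ∀ a : Plane, ‖a‖ < t → LH g a := by
  obtain ⟨t, ht, μ, hμ, G⟩ := hg
  simp only [zero_add] at G
  refine ⟨t, ht, fun a ha => ⟨t - ‖a‖, sub_pos.2 ha, μ, hμ, fun x hx => ?_⟩⟩
  rw [G a ha, G (a + x) ((norm_add_le _ _).trans_lt (by linarith)), smul_add, add_assoc]

lemma isPairOfPants_round {ρ : ℝ} (hρ : 0 < ρ) (hρ1 : ρ < 1 / 4) :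
    IsPairOfPants (Metric.closedBall (0 : Plane) 1 \
      (Metric.ball (2 * ρ, 0) ρ ∪ Metric.ball (-(2 * ρ), 0) ρ)) := by
  obtain ⟨h, h1, h2, h3, -⟩ := exists_radial_interp hρ hρ1.le (show (3:ℝ) < 4 by norm_num)
  have e1 : h '' Metric.closedBall 0 4 = Metric.closedBall 0 1 := by
    ext y
    simp only [mem_image, mem_closedBall_zero_iff]
    constructor
    · rintro ⟨x, hx, rfl⟩
      exact (h3 x).trans (by linarith)
    · intro hy
      refine ⟨h.symm y, ?_, h.apply_symm_apply y⟩
      by_contra! hn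
      have := h2 _ hn.le
      rw [h.apply_symm_apply] at this
      rw [this, norm_smul, Real.norm_of_nonneg (by norm_num)] at hy
      linarith
  have e2 : ∀ a : Plane, ‖a‖ ≤ 2 → h '' Metric.ball a 1 = Metric.ball (ρ • a) ρ := by
    intro a ha
    have : h '' Metric.ball a 1 = (fun x => ρ • x) '' Metric.ball a 1 := by
      refine image_congr fun x hx => h1 x ?_
      have := norm_sub_norm_le x a
      rw [mem_ball_iff_norm] at hx
      linarith
    rw [this, image_smul, smul_ball hρ.ne', Real.norm_of_nonneg hρ.le, mul_one]
  have e3 : h '' PantsModel = Metric.closedBall (0 : Plane) 1 \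
      (Metric.ball (2 * ρ, 0) ρ ∪ Metric.ball (-(2 * ρ), 0) ρ) := by
    rw [PantsModel, image_sdiff h.injective, image_union, e1, e2, e2]
    · simp [mul_comm]
    · simp [Prod.norm_def]
    · simp [Prod.norm_def]
  rw [← e3]
  exact IsPairOfPants.image ⟨Homeomorph.refl _⟩ h

lemma lh_of_eq {g g' h : Plane ≃ₜ Plane} (hg : LH g 0) (hg' : LH g' 0)
    (H : ∀ x ∈ Metric.closedBall (0 : Plane) 1, h (g x) = g' x) : LH h (g 0) := by
  have h1 : LH (fun y => g' (g.symm y)) (g 0) := by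
    refine LH.comp (h := g.symm) ?_ hg.symm
    simpa using hg'
  refine h1.of_eventuallyEq ?_
  have : g '' Metric.ball 0 1 ∈ 𝓝 (g 0) :=
    (g.isOpenMap _ Metric.isOpen_ball).mem_nhds image_ball_mem
  filter_upwards [this]
  rintro _ ⟨x, hx, rfl⟩
  rw [H x (Metric.ball_subset_closedBall hx), g.symm_apply_apply]

lemma isPairOfPants_diff {D E₁ E₂ : Set Plane} (hD : Tame D) (h₁ : Tame E₁) (h₂ : Tame E₂)
    (h₁D : E₁ ⊆ interior D) (h₂D : E₂ ⊆ interior D) (hd : Disjoint E₁ E₂) :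
    IsPairOfPants (D \ (interior E₁ ∪ interior E₂)) := by
  have hDi := hD.isConnected_interior
  have hD2 := h₂.isConnected_diff isOpen_interior hDi.isPreconnected h₂D
  have hO2 : IsOpen (interior D \ E₂) := isOpen_interior.sdiff h₂.isClosed
  have h₁D' : E₁ ⊆ interior D \ E₂ := subset_sdiff.2 ⟨h₁D, hd⟩
  obtain ⟨c, ⟨hc, hc2⟩, hc1⟩ := (h₁.isConnected_diff hO2 hD2.isPreconnected h₁D').1
  obtain ⟨g, hg, rfl, rfl⟩ := hD.exists_param hc
  obtain ⟨t, ht, hgt⟩ := hg.exists_nhds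
  have hU : g ⁻¹' ((interior (g '' Metric.closedBall 0 1) \ E₂) \ E₁) ∈ 𝓝 (0 : Plane) :=
    g.continuous.continuousAt.preimage_mem_nhds ((hO2.sdiff h₁.isClosed).mem_nhds ⟨⟨hc, hc2⟩, hc1⟩)
  obtain ⟨s, hs, hsU⟩ := Metric.nhds_basis_ball.mem_iff.1 hU
  obtain ⟨ρ, hρ, ρ1, ρ2, ρ3⟩ : ∃ ρ > 0, ρ < 1 / 4 ∧ 4 * ρ ≤ t ∧ 4 * ρ ≤ s := by
    refine ⟨min (1 / 8) (min (t / 4) (s / 4)), by positivity, ?_, ?_, ?_⟩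
    · exact (min_le_left _ _).trans_lt (by norm_num)
    · have := (min_le_right (1 / 8) (min (t / 4) (s / 4))).trans (min_le_left _ _); linarith
    · have := (min_le_right (1 / 8) (min (t / 4) (s / 4))).trans (min_le_right _ _); linarith
  have hsub : ∀ a : Plane, ‖a‖ ≤ 2 * ρ → Metric.closedBall a ρ ⊆ Metric.ball 0 s := by
    intro a ha x hx
    rw [mem_ball_zero_iff]
    rw [mem_closedBall_iff_norm] at hx
    have := norm_sub_norm_le x a
    linarith
  let T : Plane → Plane ≃ₜ Plane := fun a => (homothetyHomeo a ρ hρ).trans g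
  have hT : ∀ a : Plane, ‖a‖ ≤ 2 * ρ → LH (T a) 0 := fun a ha => by
    refine LH.comp (k := g) ?_ (homothetyHomeo_lh a hρ 0)
    simpa using hgt a (by linarith)
  have eT : ∀ a, T a '' Metric.closedBall 0 1 = g '' Metric.closedBall a ρ := fun a => by
    rw [← homothetyHomeo_closedBall a hρ, ← image_comp]; rfl
  have eT' : ∀ a, T a '' Metric.ball 0 1 = g '' Metric.ball a ρ := fun a => by
    rw [← homothetyHomeo_ball a hρ, ← image_comp]; rfl
  have hTs : ∀ a : Plane, ‖a‖ ≤ 2 * ρ → T a '' Metric.closedBall 0 1 ⊆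
      (interior (g '' Metric.closedBall 0 1) \ E₂) \ E₁ := fun a ha => by
    rw [eT, image_subset_iff]
    exact (hsub a ha).trans hsU
  set a₁ : Plane := (2 * ρ, 0) with ha₁
  set a₂ : Plane := (-(2 * ρ), 0) with ha₂
  have n₁ : ‖a₁‖ ≤ 2 * ρ := by simp [ha₁, Prod.norm_def, abs_of_pos hρ, hρ.le]
  have n₂ : ‖a₂‖ ≤ 2 * ρ := by simp [ha₂, Prod.norm_def, abs_of_pos hρ, hρ.le]
  obtain ⟨g₁, hg₁, rfl⟩ := id h₁
  obtain ⟨g₂, hg₂, rfl⟩ := id h₂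
  obtain ⟨k₁, hk₁, K₁⟩ := exists_move hO2 hD2.isPreconnected hg₁ (hT a₁ n₁) h₁D'
    ((hTs a₁ n₁).trans sdiff_subset)
  have tT₁ : Tame (T a₁ '' Metric.closedBall 0 1) := ⟨_, hT a₁ n₁, rfl⟩
  have hdT : Disjoint (T a₁ '' Metric.closedBall 0 1) (T a₂ '' Metric.closedBall 0 1) := by
    rw [eT, eT, disjoint_image_iff g.injective, disjoint_left]
    rintro ⟨x, y⟩ h1 h2
    simp only [ha₁, ha₂, Metric.mem_closedBall, Prod.dist_eq, max_le_iff, Real.dist_eq,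
      abs_le] at h1 h2
    linarith [h1.1.1, h2.1.2]
  have hT₁D : T a₁ '' Metric.closedBall 0 1 ⊆ interior (g '' Metric.closedBall 0 1) :=
    fun x hx => (hTs a₁ n₁ hx).1.1
  obtain ⟨k₂, hk₂, K₂⟩ := exists_move (isOpen_interior.sdiff tT₁.isClosed)
    (tT₁.isConnected_diff isOpen_interior hDi.isPreconnected hT₁D).isPreconnected hg₂ (hT a₂ n₂)
    (subset_sdiff.2 ⟨h₂D, (disjoint_left.2 fun x hx => (hTs a₁ n₁ hx).1.2).symm⟩)
    (subset_sdiff.2 ⟨fun x hx => (hTs a₂ n₂ hx).1.1, hdT.symm⟩)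
  have i₁ : k₂ '' (k₁ '' (g₁ '' Metric.ball 0 1)) = g '' Metric.ball a₁ ρ := by
    have : k₁ '' (g₁ '' Metric.ball 0 1) = T a₁ '' Metric.ball 0 1 := by
      rw [← image_comp]
      exact image_congr fun x hx => K₁ x (Metric.ball_subset_closedBall hx)
    rw [this, hk₂.image_eq_of_disjoint, eT']
    exact disjoint_sdiff_left.mono_right (image_mono Metric.ball_subset_closedBall)
  have i₂ : k₂ '' (k₁ '' (g₂ '' Metric.ball 0 1)) = g '' Metric.ball a₂ ρ := by
    have : k₁ '' (g₂ '' Metric.ball 0 1) = g₂ '' Metric.ball 0 1 :=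
      hk₁.image_eq_of_disjoint
        (disjoint_sdiff_left.mono_right (image_mono Metric.ball_subset_closedBall))
    rw [this, ← eT', ← image_comp]
    exact image_congr fun x hx => K₂ x (Metric.ball_subset_closedBall hx)
  have e : k₂ '' (k₁ '' (g '' Metric.closedBall 0 1 \ (interior (g₁ '' Metric.closedBall 0 1) ∪
      interior (g₂ '' Metric.closedBall 0 1)))) =
      g '' (Metric.closedBall 0 1 \ (Metric.ball a₁ ρ ∪ Metric.ball a₂ ρ)) := by
    rw [image_sdiff k₁.injective, image_sdiff k₂.injective, image_union, image_union,
      image_closedBall_interior, image_closedBall_interior, i₁, i₂,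
      hk₁.image_eq (sdiff_subset.trans interior_subset),
      hk₂.image_eq (sdiff_subset.trans interior_subset), image_sdiff g.injective, image_union]
  have := (((isPairOfPants_round hρ ρ1).image g).image k₂.symm).image k₁.symm
  rw [← e] at this
  simpa [image_image] using this

/-- Separate one tame disc from finitely many others inside a tame disc. -/
lemma Tame.exists_split {D : Set Plane} (hD : Tame D) {ι : Type*} (s : Finset ι)
    (hs : s.Nonempty) (E : ι → Set Plane) (hE : ∀ i ∈ s, Tame (E i))
    (hED : ∀ i ∈ s, E i ⊆ interior D) (hd : (s : Set ι).PairwiseDisjoint E) {E₀ : Set Plane}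
    (hE₀ : Tame E₀) (hE₀D : E₀ ⊆ interior D) (hd₀ : ∀ i ∈ s, Disjoint E₀ (E i)) :
    ∃ D' D'' : Set Plane, Tame D' ∧ Tame D'' ∧ D' ⊆ interior D ∧ D'' ⊆ interior D ∧
      Disjoint D' D'' ∧ E₀ ⊆ interior D' ∧ ∀ i ∈ s, E i ⊆ interior D'' := by
  have hDi := hD.isConnected_interior
  obtain ⟨i₀, hi₀⟩ := hs
  obtain ⟨c, hc⟩ := (hE i₀ hi₀).isConnected_interior.nonempty
  obtain ⟨g, hg, rfl, rfl⟩ := hD.exists_param (hED i₀ hi₀ (interior_subset hc))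
  set O' := interior (g '' Metric.closedBall 0 1) \ ⋃ i ∈ s, E i with hO'
  obtain ⟨hOo, hOc⟩ := isConnected_diff_biUnion isOpen_interior hDi s E hE hED hd
  have hK : IsClosed (g ⁻¹' ⋃ i ∈ s, E i) :=
    (s.finite_toSet.isClosed_biUnion fun i hi => (hE i hi).isClosed).preimage g.continuous
  have hKb : (g ⁻¹' ⋃ i ∈ s, E i) ⊆ Metric.ball 0 1 := by
    have : ⋃ i ∈ s, E i ⊆ g '' Metric.ball 0 1 := by
      rw [← image_closedBall_interior]; exact iUnion₂_subset hED
    intro x hx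
    obtain ⟨y, hy, hyx⟩ := this hx
    exact g.injective hyx ▸ hy
  obtain ⟨r, ⟨hr0, hr1⟩, hKr⟩ := exists_pos_lt_subset_ball one_pos hK hKb
  have hVo : IsOpen (g '' (Metric.ball 0 1 \ Metric.closedBall 0 r)) :=
    g.isOpenMap _ (Metric.isOpen_ball.sdiff Metric.isClosed_closedBall)
  obtain ⟨a, ha⟩ : (g '' (Metric.ball 0 1 \ Metric.closedBall 0 r)).Nonempty := by
    obtain ⟨q, hq, hq'⟩ := exists_between hr1
    refine ⟨_, ⟨(q, 0), ?_, rfl⟩⟩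
    simp [Prod.norm_def, abs_of_pos (hr0.trans hq), hq', hq, hr0.trans hq |>.le]
  obtain ⟨R, hR, hRV⟩ := Metric.nhds_basis_closedBall.mem_iff.1 (hVo.mem_nhds ha)
  have hVO : g '' (Metric.ball 0 1 \ Metric.closedBall 0 r) ⊆ O' := by
    rintro _ ⟨x, hx, rfl⟩
    refine ⟨by rw [image_closedBall_interior]; exact ⟨x, hx.1, rfl⟩, fun h => hx.2 ?_⟩
    exact Metric.ball_subset_closedBall (hKr h)
  obtain ⟨g₀, hg₀, rfl⟩ := hE₀
  have hR2 : 0 < R / 2 := half_pos hR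
  obtain ⟨h, hh, H⟩ := exists_move hOo hOc.isPreconnected hg₀ (homothetyHomeo_lh a hR2 0)
    (subset_sdiff.2 ⟨hE₀D, by
      rw [disjoint_iUnion₂_right]; exact hd₀⟩)
    (by rw [homothetyHomeo_closedBall]
        exact ((Metric.closedBall_subset_closedBall (by linarith)).trans hRV).trans hVO)
  have hha : h (g₀ 0) = a := by simpa using H 0 (by simp)
  have hlh : LH h.symm a := by
    have := (lh_of_eq hg₀ (homothetyHomeo_lh a hR2 0) H).symm
    rwa [hha] at this
  have hsym : SuppIn h.symm O' := hh.symm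
  have hDint : h.symm '' interior (g '' Metric.closedBall 0 1) =
      interior (g '' Metric.closedBall 0 1) := hsym.image_eq sdiff_subset
  have tr : Tame (g '' Metric.closedBall 0 r) := by
    rw [← homothetyHomeo_closedBall 0 hr0]
    refine Tame.image (homothetyHomeo_lh 0 hr0 0) rfl ?_
    simpa using hg
  obtain ⟨gr, hgr, hgrr, hgr0⟩ := tr.exists_param (c := g 0) (by
    rw [← Homeomorph.image_interior, interior_closedBall _ hr0.ne']
    exact ⟨0, by simpa using hr0, rfl⟩)
  have hc' : g 0 ∉ O' := fun h' => h'.2 (mem_biUnion hi₀ (interior_subset hc))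
  refine ⟨h.symm '' Metric.closedBall a R, h.symm '' (g '' Metric.closedBall 0 r), ?_, ?_, ?_, ?_,
    ?_, ?_, ?_⟩
  · refine Tame.image (homothetyHomeo_lh a hR 0) (homothetyHomeo_closedBall a hR) ?_
    simpa using hlh
  · exact Tame.image hgr hgrr (hgr0 ▸ hsym.lh hc')
  · rw [← hDint]
    exact image_mono (hRV.trans (hVO.trans sdiff_subset))
  · rw [← hDint]
    refine image_mono ?_
    rw [image_closedBall_interior]
    exact image_mono (Metric.closedBall_subset_ball hr1)
  · rw [disjoint_image_iff h.symm.injective, disjoint_left]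
    intro x hx hx'
    obtain ⟨y, hy, rfl⟩ := hRV hx
    obtain ⟨z, hz, hzy⟩ := hx'
    exact hy.2 (g.injective hzy ▸ hz)
  · rw [← Homeomorph.image_interior, interior_closedBall _ hR.ne']
    rintro _ ⟨x, hx, rfl⟩
    refine ⟨h (g₀ x), ?_, h.symm_apply_apply _⟩
    rw [H x hx]
    have : homothetyHomeo a (R / 2) hR2 x ∈ Metric.closedBall a (R / 2) := by
      rw [← homothetyHomeo_closedBall a hR2]; exact ⟨x, hx, rfl⟩
    exact Metric.closedBall_subset_ball (by linarith) this
  · intro i hi x hx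
    rw [← Homeomorph.image_interior, ← Homeomorph.image_interior, interior_closedBall _ hr0.ne']
    have hxO : x ∉ O' := fun h' => h'.2 (mem_biUnion hi hx)
    refine ⟨x, ⟨g.symm x, hKr ?_, g.apply_symm_apply x⟩, hsym.apply_eq hxO⟩
    simp only [mem_preimage, Homeomorph.apply_symm_apply]
    exact mem_biUnion hi hx

/-- Cells of the hexagonal grid in axial coordinates. -/
abbrev Cell : Type := ℤ × ℤ

/-- The six neighbors of the origin, in cyclic order. -/
def ring6 : Fin 6 → Cell := ![(1, 0), (0, 1), (-1, 1), (-1, 0), (0, -1), (1, -1)]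

lemma ring6_injective : Function.Injective ring6 := by decide

lemma ring6_ne_zero : ∀ k, ring6 k ≠ 0 := by decide

lemma ring6_add_three : ∀ k, ring6 (k + 3) = - ring6 k := by decide

/-- Adjacency of cells. -/
def HexAdj (x y : Cell) : Prop := ∃ k, y = x + ring6 k

lemma HexAdj.symm {x y : Cell} (h : HexAdj x y) : HexAdj y x := by
  obtain ⟨k, rfl⟩ := h
  exact ⟨k + 3, by rw [ring6_add_three, add_neg_cancel_right]⟩

/-- One step inside a set of cells. -/
def HexStep (S : Set Cell) (x y : Cell) : Prop := HexAdj x y ∧ x ∈ S ∧ y ∈ S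

/-- Reachability inside a set of cells. -/
def HexReach (S : Set Cell) : Cell → Cell → Prop := Relation.ReflTransGen (HexStep S)

lemma HexReach.symm {S : Set Cell} {x y : Cell} (h : HexReach S x y) : HexReach S y x := by
  induction h with
  | refl => exact .refl
  | tail _ h ih => exact (Relation.ReflTransGen.single ⟨h.1.symm, h.2.2, h.2.1⟩).trans ih

lemma HexReach.trans {S : Set Cell} {x y z : Cell} (h : HexReach S x y) (h' : HexReach S y z) :
    HexReach S x z := Relation.ReflTransGen.trans h h'

lemma HexReach.mono {S T : Set Cell} (hST : S ⊆ T) {x y : Cell} (h : HexReach S x y) :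
    HexReach T x y := by
  induction h with
  | refl => exact .refl
  | tail _ h ih => exact ih.tail ⟨h.1, hST h.2.1, hST h.2.2⟩

lemma HexStep.reach {S : Set Cell} {x y : Cell} (h : HexStep S x y) : HexReach S x y :=
  Relation.ReflTransGen.single h

lemma HexReach.mem {S : Set Cell} {x y : Cell} (h : HexReach S x y) (hx : x ∈ S) : y ∈ S := by
  induction h with
  | refl => exact hx
  | tail _ h _ => exact h.2.2

lemma HexReach.closed {S : Set Cell} {x y : Cell} (h : HexReach S x y) {P : Cell → Prop}
    (hP : ∀ a b, HexStep S a b → P a → P b) (hx : P x) : P y := by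
  induction h with
  | refl => exact hx
  | tail _ h ih => exact hP _ _ h ih

/-- Connectedness of sets of cells. -/
def HexConn (S : Set Cell) : Prop := ∀ x ∈ S, ∀ y ∈ S, HexReach S x y

lemma HexConn.exists_adj {S T : Set Cell} (hS : HexConn S) (hT : T ⊆ S) (hne : T.Nonempty)
    (hTS : T ≠ S) : ∃ x ∈ T, ∃ y ∈ S, y ∉ T ∧ HexAdj x y := by
  by_contra! hn
  obtain ⟨x, hx⟩ := hne
  refine hTS (hT.antisymm fun y hy => ?_)
  refine (hS x (hT hx) y hy).closed (P := fun c => c ∈ T) (fun a b hab ha => ?_) hx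
  by_contra hb
  exact hn a ha b hab.2.2 hb hab.1

lemma exists_hexConn_diff_singleton {E S : Set Cell} (hE : HexConn E) (hS : HexConn S)
    (hSE : S ⊆ E) (hSne : S.Nonempty) (hfin : (E \ S).Finite)
    (hb : ∃ b ∈ E \ S, ∃ c ∉ E, HexAdj b c) :
    ∃ b ∈ E \ S, (∃ c ∉ E, HexAdj b c) ∧ HexConn (E \ {b}) := by
  obtain ⟨s, hs⟩ := hSne
  let R : Cell → Set Cell := fun b => {c | c ∈ E ∧ c ≠ b ∧ ¬ HexReach (E \ {b}) s c}
  have hRsub : ∀ b ∈ E \ S, R b ⊆ E \ S := by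
    rintro b hb c ⟨hc, hcb, hn⟩
    refine ⟨hc, fun hcS => hn ?_⟩
    have hSb : S ⊆ E \ {b} := subset_sdiff_singleton hSE hb.2
    exact (hS s hs c hcS).mono hSb
  have main : ∀ n : ℕ, ∀ b ∈ E \ S, (∃ c ∉ E, HexAdj b c) → (R b).ncard = n →
      ∃ b ∈ E \ S, (∃ c ∉ E, HexAdj b c) ∧ HexConn (E \ {b}) := by
    intro n
    induction n using Nat.strong_induction_on with
    | _ n ih =>
      intro b hb hbd hn
      have hsb : s ≠ b := fun h => hb.2 (h ▸ hs)
      by_cases hR : (R b) = ∅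
      · refine ⟨b, hb, hbd, fun x hx y hy => ?_⟩
        have : ∀ z ∈ E \ {b}, HexReach (E \ {b}) s z := fun z hz => by
          by_contra hn
          have : z ∈ R b := ⟨hz.1, hz.2, hn⟩
          rw [hR] at this
          exact this
        exact (this x hx).symm.trans (this y hy)
      · have hRfin : (R b).Finite := hfin.subset (hRsub b hb)
        by_cases hbR : ∃ b' ∈ R b, ∃ c ∉ E, HexAdj b' c
        · obtain ⟨b', hb', hbd'⟩ := hbR
          refine ih _ ?_ b' (hRsub b hb hb') hbd' rfl
          rw [← hn]
          refine ncard_lt_ncard (ssubset_of_subset_not_subset ?_ fun h => ?_) hRfin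
          · have hreach : ∀ z, HexReach (E \ {b}) s z → HexReach (E \ {b'}) s z := by
              intro z hz
              have : ∀ w, HexReach (E \ {b}) s w → w ≠ b' := by
                rintro w hw rfl
                exact hb'.2.2 hw
              refine (hz.closed (P := fun w => HexReach (E \ {b}) s w ∧ HexReach (E \ {b'}) s w)
                (fun a c hac ha => ?_) ⟨.refl, .refl⟩).2
              have hc := ha.1.trans hac.reach
              exact ⟨hc, ha.2.trans (HexStep.reach ⟨hac.1, ⟨hac.2.1.1, this a ha.1⟩,
                ⟨hac.2.2.1, this c hc⟩⟩)⟩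
            have hbr : HexReach (E \ {b'}) s b := by
              obtain ⟨x, hx, y, hy, hyn, hxy⟩ := hE.exists_adj
                (T := {c | HexReach (E \ {b}) s c}) (fun c hc => (hc.mem ⟨hSE hs, hsb⟩).1)
                ⟨s, .refl⟩ (fun h => by
                  have : b ∈ {c | HexReach (E \ {b}) s c} := by rw [h]; exact hb.1
                  exact (HexReach.mem this ⟨hSE hs, hsb⟩).2 rfl)
              have hxE := HexReach.mem hx ⟨hSE hs, hsb⟩
              have hyb : y = b := by
                by_contra hyb
                exact hyn (hx.trans (HexStep.reach ⟨hxy, hxE, hy, hyb⟩))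
              subst hyb
              refine (hreach x hx).trans (HexStep.reach ⟨hxy, ⟨hxE.1, ?_⟩, hy, ?_⟩)
              · rintro rfl; exact hb'.2.2 hx
              · exact fun h => hb'.2.1 h.symm
            rintro c ⟨hc, hcb', hcr⟩
            refine ⟨hc, ?_, fun h => hcr (hreach c h)⟩
            rintro rfl
            exact hcr hbr
          · exact (h hb').2.1 rfl
        · exfalso
          push Not at hbR
          obtain ⟨c, hc, hmax⟩ := hRfin.exists_maximalFor Prod.snd _ (nonempty_iff_ne_empty.2 hR)
          have key : ∀ k, (ring6 k).2 = 1 → c + ring6 k = b := by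
            intro k hk
            by_contra hne
            have hcE : c + ring6 k ∈ E := by
              by_contra hn
              exact hbR c hc _ hn ⟨k, rfl⟩
            have hR' : c + ring6 k ∈ R b := ⟨hcE, hne, fun hr => hc.2.2
              (hr.trans (HexStep.reach ⟨HexAdj.symm ⟨k, rfl⟩, ⟨hcE, hne⟩, hc.1, hc.2.1⟩))⟩
            have := hmax hR'
            simp [hk] at this
          have h1 := key 1 rfl
          have h2 := key 2 rfl
          exact absurd (ring6_injective (add_left_cancel (h1.trans h2.symm))) (by decide)
  obtain ⟨b, hb, hbd⟩ := hb
  exact main _ b hb hbd rfl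

/-- Indicator of a finite set of cells. -/
def hexInd (D : Finset Cell) (c : Cell) : ℤ := if c ∈ D then 1 else 0

/-- Local contribution of a cell to the Euler characteristic. -/
def hexTerm (D : Finset Cell) (c : Cell) : ℤ :=
  1 - hexInd D (c + ring6 0) - hexInd D (c + ring6 1) - hexInd D (c + ring6 2)
    + hexInd D (c + ring6 0) * hexInd D (c + ring6 1)
    + hexInd D (c + ring6 1) * hexInd D (c + ring6 2)

/-- Euler characteristic of a finite union of hexagonal cells. -/
def hexEuler (D : Finset Cell) : ℤ := ∑ c ∈ D, hexTerm D c

/-- Number of arcs formed by the neighbors of `b` in `D`. -/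
def hexArcs (D : Finset Cell) (b : Cell) : ℤ :=
  ∑ i : Fin 6, hexInd D (b + ring6 i) * (1 - hexInd D (b + ring6 (i + 1)))

lemma hexEuler_insert {D : Finset Cell} {b : Cell} (hb : b ∉ D) :
    hexEuler (insert b D) = hexEuler D + 1 - hexArcs D b := by
  have hI : ∀ c, hexInd (insert b D) c = hexInd D c + if c = b then 1 else 0 := by
    intro c
    by_cases h : c = b
    · subst h; simp [hexInd, hb]
    · simp [hexInd, h]
  have hS : ∀ (k : Fin 6) (X : Cell → ℤ), ∑ c ∈ D, (if c + ring6 k = b then 1 else 0) * X c =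
      hexInd D (b - ring6 k) * X (b - ring6 k) := by
    intro k X
    simp only [← eq_sub_iff_add_eq, ite_mul, one_mul, zero_mul, Finset.sum_ite_eq', hexInd]
  have hbb : ∀ k, hexInd (insert b D) (b + ring6 k) = hexInd D (b + ring6 k) := by
    intro k; rw [hI]; simp [ring6_ne_zero]
  have hdd : ∀ (c : Cell) (k l : Fin 6), k ≠ l →
      (if c + ring6 k = b then (1:ℤ) else 0) * (if c + ring6 l = b then 1 else 0) = 0 := by
    intro c k l hkl
    split_ifs with h1 h2
    · exact absurd (ring6_injective (add_left_cancel (h1.trans h2.symm))) hkl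
    · simp
    · simp
    · simp
  have hterm : ∀ c, hexTerm (insert b D) c = hexTerm D c
      - (if c + ring6 0 = b then 1 else 0) * 1 - (if c + ring6 1 = b then 1 else 0) * 1
      - (if c + ring6 2 = b then 1 else 0) * 1
      + (if c + ring6 0 = b then 1 else 0) * hexInd D (c + ring6 1)
      + (if c + ring6 1 = b then 1 else 0) * hexInd D (c + ring6 0)
      + (if c + ring6 1 = b then 1 else 0) * hexInd D (c + ring6 2)
      + (if c + ring6 2 = b then 1 else 0) * hexInd D (c + ring6 1) := by
    intro c
    have h1 := hdd c 0 1 (by decide)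
    have h2 := hdd c 1 2 (by decide)
    simp only [hexTerm, hI]
    linear_combination h1 + h2
  rw [hexEuler, Finset.sum_insert hb]
  simp only [hterm, Finset.sum_add_distrib, Finset.sum_sub_distrib, hS]
  have hb' : hexTerm D b = hexTerm (insert b D) b := by
    simp only [hexTerm, hbb]
  have e0 : b - ring6 0 = b + ring6 3 := by rw [show ring6 3 = -ring6 0 by decide]; abel
  have e1 : b - ring6 1 = b + ring6 4 := by rw [show ring6 4 = -ring6 1 by decide]; abel
  have e2 : b - ring6 2 = b + ring6 5 := by rw [show ring6 5 = -ring6 2 by decide]; abel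
  have f1 : b + ring6 3 + ring6 1 = b + ring6 2 := by
    rw [add_assoc]; congr 1
  have f2 : b + ring6 4 + ring6 0 = b + ring6 5 := by
    rw [add_assoc]; congr 1
  have f3 : b + ring6 4 + ring6 2 = b + ring6 3 := by
    rw [add_assoc]; congr 1
  have f4 : b + ring6 5 + ring6 1 = b + ring6 0 := by
    rw [add_assoc]; congr 1
  have hz : ∀ k, (if b + ring6 k = b then (1:ℤ) else 0) = 0 := fun k => by
    simp [ring6_ne_zero]
  simp only [hz, e0, e1, e2, f1, f2, f3, f4, hexEuler, hexArcs, Fin.sum_univ_six, hexTerm,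
    show (0:Fin 6) + 1 = 1 from rfl, show (1:Fin 6) + 1 = 2 from rfl,
    show (2:Fin 6) + 1 = 3 from rfl, show (3:Fin 6) + 1 = 4 from rfl,
    show (4:Fin 6) + 1 = 5 from rfl, show (5:Fin 6) + 1 = 0 from rfl]
  ring

/-- Sets of cells built from a single cell by adding cells whose neighbors already present form
one arc. -/
inductive HexShell : Finset Cell → Prop
  | single (c : Cell) : HexShell {c}
  | insert (D : Finset Cell) (b : Cell) (hb : b ∉ D) (hD : HexShell D) (a : Fin 6) (k : ℕ)
      (hk : 1 ≤ k) (hk' : k ≤ 5) (H : ∀ i : Fin 6, b + ring6 (a + i) ∈ D ↔ i.val < k) :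
      HexShell (insert b D)

lemma one_le_arcs_of_bool : ∀ f : Fin 6 → Bool, (∃ i, f i = true) → (∃ i, f i = false) →
    1 ≤ ∑ i : Fin 6, (if f i then (1:ℤ) else 0) * (1 - if f (i + 1) then (1:ℤ) else 0) := by
  decide +kernel

lemma arc_of_bool : ∀ f : Fin 6 → Bool,
    ∑ i : Fin 6, (if f i then (1:ℤ) else 0) * (1 - if f (i + 1) then (1:ℤ) else 0) = 1 →
    ∃ a : Fin 6, ∃ k : Fin 6, 1 ≤ k.val ∧ k.val ≤ 5 ∧ ∀ i : Fin 6, f (a + i) = true ↔ i.val < k := by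
  decide +kernel

lemma hexArcs_eq (D : Finset Cell) (b : Cell) : hexArcs D b =
    ∑ i : Fin 6, (if (fun i => decide (b + ring6 i ∈ D)) i then (1:ℤ) else 0) *
      (1 - if (fun i => decide (b + ring6 i ∈ D)) (i + 1) then (1:ℤ) else 0) := by
  simp [hexArcs, hexInd]

lemma one_le_hexArcs {D : Finset Cell} {b : Cell} (h1 : ∃ i, b + ring6 i ∈ D)
    (h2 : ∃ i, b + ring6 i ∉ D) : 1 ≤ hexArcs D b := by
  rw [hexArcs_eq]
  exact one_le_arcs_of_bool _ (by simpa using h1) (by simpa using h2)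

lemma exists_boundary_ne {D : Finset Cell} (hD : D.Nontrivial) :
    ∃ s ∈ D, ∃ b ∈ D, b ≠ s ∧ ∃ c ∉ D, HexAdj b c := by
  obtain ⟨x, hx, hext⟩ := D.exists_max_image Prod.fst hD.nonempty
  have hxb : ∃ c ∉ D, HexAdj x c := ⟨x + ring6 0, fun h => by
    have := hext _ h; simp [ring6] at this, 0, rfl⟩
  obtain ⟨y, hy, hyx⟩ := hD.exists_ne x
  exact ⟨y, hy, x, hx, hyx.symm, hxb⟩

lemma hexEuler_le_one (n : ℕ) : ∀ D : Finset Cell, D.card = n + 1 → HexConn (D : Set Cell) →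
    hexEuler D ≤ 1 ∧ (hexEuler D = 1 → HexShell D) := by
  induction n with
  | zero =>
    intro D hD _
    obtain ⟨c, rfl⟩ := Finset.card_eq_one.1 hD
    have : hexEuler {c} = 1 := by
      simp [hexEuler, hexTerm, hexInd, ring6_ne_zero]
    exact ⟨this.le, fun _ => HexShell.single c⟩
  | succ n ih =>
    intro D hD hc
    have hnt : D.Nontrivial := Finset.one_lt_card_iff_nontrivial.1 (by omega)
    obtain ⟨s, hs, b, hb, hbs, hbd⟩ := exists_boundary_ne hnt
    obtain ⟨b, hb, ⟨c, hcn, hbc⟩, hconn⟩ := exists_hexConn_diff_singleton hc (S := {s})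
      (by rintro x rfl y rfl; exact .refl) (by simpa using hs) (singleton_nonempty s)
      (D.finite_toSet.subset sdiff_subset) ⟨b, ⟨hb, hbs⟩, by simpa using hbd⟩
    have hbD : b ∈ D := hb.1
    have hins : insert b (D.erase b) = D := Finset.insert_erase hbD
    have heq := hexEuler_insert (D.notMem_erase b)
    rw [hins] at heq
    obtain ⟨ih1, ih2⟩ := ih (D.erase b) (by rw [Finset.card_erase_of_mem hbD]; omega)
      (by simpa using hconn)
    have h1 : ∃ i, b + ring6 i ∈ D.erase b := by
      obtain ⟨x, rfl, y, hy, hyx, k, rfl⟩ := hc.exists_adj (T := {b}) (by simpa using hbD)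
        (singleton_nonempty b) (fun h => by
          have : s ∈ ({b} : Set Cell) := by rw [h]; exact hs
          exact hb.2 this.symm)
      exact ⟨k, Finset.mem_erase.2 ⟨hyx, hy⟩⟩
    have h2 : ∃ i, b + ring6 i ∉ D.erase b := by
      obtain ⟨k, rfl⟩ := hbc
      exact ⟨k, fun h => hcn (Finset.mem_of_mem_erase h)⟩
    have harc := one_le_hexArcs h1 h2
    refine ⟨by linarith, fun h => ?_⟩
    have h3 : hexArcs (D.erase b) b = 1 := by linarith
    rw [hexArcs_eq] at h3
    obtain ⟨a, k, hk, hk', H⟩ := arc_of_bool _ h3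
    rw [← hins]
    exact HexShell.insert _ b (D.notMem_erase b) (ih2 (by linarith)) a k hk hk'
      (by simpa only [decide_eq_true_iff] using H)

/-- The parallelogram of radius `N`. -/
def hexBox (N : ℤ) : Finset Cell := Finset.Icc (-N) N ×ˢ Finset.Icc (-N) N

lemma mem_hexBox {N : ℤ} {c : Cell} :
    c ∈ hexBox N ↔ (-N ≤ c.1 ∧ c.1 ≤ N) ∧ (-N ≤ c.2 ∧ c.2 ≤ N) := by
  simp [hexBox]

lemma hexEuler_hexBox {N : ℤ} (hN : 0 ≤ N) : hexEuler (hexBox N) = 1 := by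
  have : ∀ c ∈ hexBox N, hexTerm (hexBox N) c = if c = (N, N) then 1 else 0 := by
    rintro ⟨i, j⟩ hc
    rw [mem_hexBox] at hc
    simp only [hexTerm, hexInd, mem_hexBox, ring6, Matrix.cons_val, Prod.mk_add_mk,
      Prod.mk.injEq] at hc ⊢
    split_ifs <;> omega
  rw [hexEuler, Finset.sum_congr rfl this, Finset.sum_ite_eq', if_pos]
  simp [hexBox, hN]

lemma hexConn_of_forall_reach {S : Set Cell} (s : Cell) (h : ∀ x ∈ S, HexReach S x s) :
    HexConn S := fun x hx y hy => (h x hx).trans (h y hy).symm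

lemma hexReach_line {S : Set Cell} (f : ℤ → Cell) (hf : ∀ n, HexAdj (f n) (f (n + 1)))
    {a b : ℤ} (hab : a ≤ b) (hS : ∀ n, a ≤ n → n ≤ b → f n ∈ S) : HexReach S (f a) (f b) := by
  induction b, hab using Int.leInduction with
  | base => exact .refl
  | succ n hn ih =>
    exact (ih fun m h1 h2 => hS m h1 (by omega)).trans
      (HexStep.reach ⟨hf n, hS n hn (by omega), hS (n + 1) (by omega) le_rfl⟩)

lemma hexReach_line_of_forall {S : Set Cell} (f : ℤ → Cell)
    (hf : ∀ n, HexAdj (f n) (f (n + 1))) (hS : ∀ n, f n ∈ S) (a b : ℤ) :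
    HexReach S (f a) (f b) := by
  rcases le_total a b with h | h
  · exact hexReach_line f hf h fun n _ _ => hS n
  · exact (hexReach_line f hf h fun n _ _ => hS n).symm

lemma hexAdj_fst (j n : ℤ) : HexAdj (n, j) (n + 1, j) := ⟨0, by simp [ring6]⟩

lemma hexAdj_snd (i n : ℤ) : HexAdj (i, n) (i, n + 1) := ⟨1, by simp [ring6]⟩

lemma hexConn_hexBox (N : ℤ) : HexConn (hexBox N : Set Cell) := by
  refine hexConn_of_forall_reach (-N, -N) ?_
  rintro ⟨i, j⟩ hx
  rw [Finset.mem_coe, mem_hexBox] at hx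
  simp only at hx
  have h1 : HexReach (hexBox N : Set Cell) (-N, -N) (i, -N) :=
    hexReach_line (fun n => (n, -N)) (hexAdj_fst _) hx.1.1 fun n h1 h2 => by
      rw [Finset.mem_coe, mem_hexBox]; simp only; omega
  have h2 : HexReach (hexBox N : Set Cell) (i, -N) (i, j) :=
    hexReach_line (fun n => (i, n)) (hexAdj_snd _) hx.2.1 fun n h1 h2 => by
      rw [Finset.mem_coe, mem_hexBox]; simp only; omega
  exact (h1.trans h2).symm

lemma hexConn_compl_hexBox (N : ℤ) : HexConn ((hexBox N : Set Cell)ᶜ) := by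
  have hm : ∀ i j : ℤ, (i, j) ∈ (hexBox N : Set Cell)ᶜ ↔
      ¬((-N ≤ i ∧ i ≤ N) ∧ (-N ≤ j ∧ j ≤ N)) := fun i j => by
    rw [mem_compl_iff, Finset.mem_coe, mem_hexBox]
  have hcol : ∀ i, (i < -N ∨ N < i) → ∀ a b, HexReach ((hexBox N : Set Cell)ᶜ) (i, a) (i, b) :=
    fun i hi a b => hexReach_line_of_forall (fun n => (i, n)) (hexAdj_snd _)
      (fun n => by rw [hm]; omega) a b
  have hrow : ∀ j, (j < -N ∨ N < j) → ∀ a b, HexReach ((hexBox N : Set Cell)ᶜ) (a, j) (b, j) :=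
    fun j hj a b => hexReach_line_of_forall (fun n => (n, j)) (hexAdj_fst _)
      (fun n => by rw [hm]; omega) a b
  refine hexConn_of_forall_reach (N + 1, N + 1) ?_
  rintro ⟨i, j⟩ hx
  rw [hm] at hx
  by_cases hi : i < -N ∨ N < i
  · exact (hcol i hi j (N + 1)).trans (hrow (N + 1) (by omega) i (N + 1))
  · exact (hrow j (by omega) i (N + 1)).trans (hcol (N + 1) (by omega) j (N + 1))

lemma one_le_hexEuler_aux {N : ℤ} (hN : 0 ≤ N) (n : ℕ) : ∀ D : Finset Cell,
    (hexBox N \ D).card = n → D ⊆ hexBox N → D.Nonempty → HexConn ((D : Set Cell)ᶜ) →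
    1 ≤ hexEuler D := by
  induction n with
  | zero =>
    intro D hD hsub _ _
    rw [Finset.card_eq_zero, Finset.sdiff_eq_empty_iff_subset] at hD
    rw [hsub.antisymm hD, hexEuler_hexBox hN]
  | succ n ih =>
    intro D hD hsub hne hc
    have hout : (N + 1, N + 1) ∉ hexBox N := by rw [mem_hexBox]; simp
    have hcs : (hexBox N : Set Cell)ᶜ ⊆ (D : Set Cell)ᶜ := compl_subset_compl.2 hsub
    obtain ⟨b, hb, ⟨c, hcn, hbc⟩, hconn⟩ := exists_hexConn_diff_singleton hc
      (hexConn_compl_hexBox N) hcs ⟨_, hout⟩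
      ((hexBox N).finite_toSet.subset fun x hx => by simpa using hx.2) (by
        obtain ⟨x, hx, y, hy, hyD, hxy⟩ := (hexConn_hexBox N).exists_adj (T := D) hsub hne
          (fun h => by
            rw [Finset.coe_inj] at h
            simp [h] at hD)
        exact ⟨y, ⟨hyD, by simpa using hy⟩, x, by simpa using hx, hxy.symm⟩)
    have hbD : b ∉ D := hb.1
    have hbN : b ∈ hexBox N := by simpa using hb.2
    have h1 : ∃ i, b + ring6 i ∈ D := by
      obtain ⟨k, rfl⟩ := hbc
      exact ⟨k, by simpa using hcn⟩
    have h2 : ∃ i, b + ring6 i ∉ D := by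
      obtain ⟨x, rfl, y, hy, hyx, k, rfl⟩ := hc.exists_adj (T := {b}) (by simpa using hbD)
        (singleton_nonempty b) (fun h => by
          have : (N + 1, N + 1) ∈ ({b} : Set Cell) := by rw [h]; exact fun h' => hout (hsub h')
          exact hout ((mem_singleton_iff.1 this) ▸ hbN))
      exact ⟨k, hy⟩
    have harc := one_le_hexArcs h1 h2
    have := ih (insert b D) (by
        rw [Finset.sdiff_insert, Finset.card_erase_of_mem (by simp [hbD, hbN])]; omega)
      (Finset.insert_subset hbN hsub) (Finset.insert_nonempty _ _) (by
        convert hconn using 1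
        ext x; simp; tauto)
    rw [hexEuler_insert hbD] at this
    linarith

/-- A finite connected set of cells with connected complement can be built cell by cell. -/
lemma hexShell_of_hexConn {D : Finset Cell} (hne : D.Nonempty) (hD : HexConn (D : Set Cell))
    (hD' : HexConn ((D : Set Cell)ᶜ)) : HexShell D := by
  obtain ⟨N, hN, hsub⟩ : ∃ N : ℤ, 0 ≤ N ∧ D ⊆ hexBox N := by
    refine ⟨∑ c ∈ D, (|c.1| + |c.2|), by positivity, fun c hc => ?_⟩
    have := Finset.single_le_sum (f := fun c : Cell => |c.1| + |c.2|) (fun _ _ => by positivity) hc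
    have h1 := abs_nonneg c.1
    have h2 := abs_nonneg c.2
    rw [mem_hexBox, ← abs_le, ← abs_le]
    constructor <;> linarith
  have h1 := one_le_hexEuler_aux hN _ D rfl hsub hne hD'
  obtain ⟨h2, h3⟩ := hexEuler_le_one (D.card - 1) D
    (by have := hne.card_pos; omega) hD
  exact h3 (le_antisymm h2 h1)

/-- Displacement of the kite move. -/
def kiteM (p : Plane) : ℝ :=
  max 0 (min (1 - |p.1 - p.2| - 2 * (p.1 + p.2 - 1)) (1 - |p.1 - p.2| + (p.1 + p.2 - 1) / 2))

lemma kiteM_eq (p : Plane) : kiteM p = 0 ∧ (1 - |p.1 - p.2| - 2 * (p.1 + p.2 - 1) ≤ 0 ∨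
      1 - |p.1 - p.2| + (p.1 + p.2 - 1) / 2 ≤ 0) ∨
    0 ≤ p.1 + p.2 - 1 ∧ 0 < 1 - |p.1 - p.2| - 2 * (p.1 + p.2 - 1) ∧
      kiteM p = 1 - |p.1 - p.2| - 2 * (p.1 + p.2 - 1) ∨
    p.1 + p.2 - 1 < 0 ∧ 0 < 1 - |p.1 - p.2| + (p.1 + p.2 - 1) / 2 ∧
      kiteM p = 1 - |p.1 - p.2| + (p.1 + p.2 - 1) / 2 := by
  rw [kiteM]
  generalize |p.1 - p.2| = d
  rcases le_total 0 (min (1 - d - 2 * (p.1 + p.2 - 1)) (1 - d + (p.1 + p.2 - 1) / 2))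
    with h | h
  · rw [max_eq_right h]
    rcases h.eq_or_lt with h0 | h0
    · exact Or.inl ⟨h0.symm, min_le_iff.1 h0.symm.le⟩
    · rw [lt_min_iff] at h0
      rcases lt_or_ge (p.1 + p.2 - 1) 0 with hs | hs
      · exact Or.inr (Or.inr ⟨hs, h0.2, min_eq_right (by linarith)⟩)
      · exact Or.inr (Or.inl ⟨hs, h0.1, min_eq_left (by linarith)⟩)
  · rw [max_eq_left h]
    exact Or.inl ⟨rfl, min_le_iff.1 h⟩

lemma exists_kite : ∃ κ : Plane ≃ₜ Plane, ∀ p, κ p = (p.1 - kiteM p / 2, p.2 - kiteM p / 2) := by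
  let Λ : Plane ≃ₜ Plane :=
    { toFun := fun p => (p.1 - p.2, p.1 + p.2 - 1)
      invFun := fun q => ((q.2 + 1 + q.1) / 2, (q.2 + 1 - q.1) / 2)
      left_inv := fun p => by ext <;> simp
      right_inv := fun p => by ext <;> dsimp only <;> ring
      continuous_toFun := by fun_prop
      continuous_invFun := by fun_prop }
  have hΛ : ∀ p, Λ p = (p.1 - p.2, p.1 + p.2 - 1) := fun p => rfl
  have hΛ' : ∀ q, Λ.symm q = ((q.2 + 1 + q.1) / 2, (q.2 + 1 - q.1) / 2) := fun p => rfl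
  let μ : Plane → ℝ := fun q => max 0 (min (1 - |q.1| - 2 * q.2) (1 - |q.1| + q.2 / 2))
  obtain ⟨h, hh⟩ := exists_shear_homeo (fun q => q.2 - μ q) (by fun_prop)
    (by
      intro x a b hab
      simp only [μ]
      have e := abs_nonneg x
      generalize |x| = d at *
      rcases max_cases 0 (min (1 - d - 2 * a) (1 - d + a / 2)) with h1 | h1 <;>
      rcases max_cases 0 (min (1 - d - 2 * b) (1 - d + b / 2)) with h2 | h2 <;>
      rcases min_cases (1 - d - 2 * a) (1 - d + a / 2) with h3 | h3 <;>
      rcases min_cases (1 - d - 2 * b) (1 - d + b / 2) with h4 | h4 <;>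
      rw [h1.1, h2.1] <;> linarith)
    (C := 1) (by
      intro p
      simp only [μ]
      have e := abs_nonneg p.1
      generalize |p.1| = d at *
      rw [abs_le]
      rcases max_cases 0 (min (1 - d - 2 * p.2) (1 - d + p.2 / 2)) with h1 | h1 <;>
      rcases min_cases (1 - d - 2 * p.2) (1 - d + p.2 / 2) with h3 | h3 <;>
      rw [h1.1] <;> constructor <;> linarith)
  refine ⟨(Λ.trans h).trans Λ.symm, fun p => ?_⟩
  have hm : μ (p.1 - p.2, p.1 + p.2 - 1) = kiteM p := rfl
  simp only [Homeomorph.trans_apply, hΛ, hh, hΛ', hm]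
  ext <;> ring

/-- The triangle with vertices `(0,0)`, `(1,0)`, `(0,1)`. -/
def tri0 : Set Plane := {p | 0 ≤ p.1 ∧ 0 ≤ p.2 ∧ p.1 + p.2 ≤ 1}

/-- The hexagon around a point. -/
def hexAt (c : Plane) : Set Plane :=
  {p | |p.1 - c.1| ≤ 1 ∧ |p.2 - c.2| ≤ 1 ∧ |p.1 + p.2 - c.1 - c.2| ≤ 1}

/-- The open hexagon around a point. -/
def ohexAt (c : Plane) : Set Plane :=
  {p | |p.1 - c.1| < 1 ∧ |p.2 - c.2| < 1 ∧ |p.1 + p.2 - c.1 - c.2| < 1}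

/-- A point with integer coordinates. -/
def zpt (c : ℤ × ℤ) : Plane := (c.1, c.2)

lemma image_eq_of_iff {f : Plane ≃ₜ Plane} {A B : Set Plane} (h : ∀ p, f p ∈ B ↔ p ∈ A) :
    f '' A = B := by
  ext1 q
  obtain ⟨p, rfl⟩ := f.surjective q
  rw [f.injective.mem_set_image, h]

lemma symm_image_eq_of_iff {f : Plane ≃ₜ Plane} {A B : Set Plane} (h : ∀ p, f p ∈ A ↔ p ∈ B) :
    f.symm '' A = B := by
  rw [f.image_symm]
  ext1 p
  exact h p

lemma kite_image {κ : Plane ≃ₜ Plane}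
    (hκ : ∀ p, κ p = (p.1 - kiteM p / 2, p.2 - kiteM p / 2)) {B : Set Plane}
    (h1 : ∀ p : Plane, p.1 ≤ 1 → p.2 ≤ 1 → 1 ≤ p.1 + p.2 → p ∈ B) (h2 : Disjoint (ohexAt 0) B) :
    κ '' B = B ∪ tri0 := by
  refine image_eq_of_iff fun p => ?_
  have h2' : ∀ p : Plane, |p.1| < 1 → |p.2| < 1 → |p.1 + p.2| < 1 → p ∉ B := fun p a b c =>
    disjoint_left.1 h2 (by simpa [ohexAt] using ⟨a, b, c⟩)
  rcases kiteM_eq p with ⟨hm, h⟩ | ⟨hs, h0, hm⟩ | ⟨hs, h0, hm⟩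
  · have : κ p = p := by rw [hκ, hm]; ext <;> simp
    rw [this, mem_union, or_iff_left_iff_imp]
    rintro ⟨hx, hy, hxy⟩
    rcases abs_cases (p.1 - p.2) with ⟨e, e'⟩ | ⟨e, e'⟩ <;> rw [e] at h <;> rcases h with h | h <;>
      exact h1 p (by linarith) (by linarith) (by linarith)
  · have hp : p ∈ B := by
      rcases abs_cases (p.1 - p.2) with ⟨e, e'⟩ | ⟨e, e'⟩ <;> rw [e] at h0 <;>
      exact h1 p (by linarith) (by linarith) (by linarith)
    refine iff_of_true ?_ hp
    rw [hκ]
    rcases le_total (p.1 + p.2 - kiteM p) 1 with h | h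
    · refine Or.inr ?_
      rcases abs_cases (p.1 - p.2) with ⟨e, e'⟩ | ⟨e, e'⟩ <;> rw [e] at h0 hm <;>
      refine ⟨?_, ?_, ?_⟩ <;> simp only <;> linarith
    · refine Or.inl (h1 _ ?_ ?_ ?_) <;>
      rcases abs_cases (p.1 - p.2) with ⟨e, e'⟩ | ⟨e, e'⟩ <;> rw [e] at h0 hm <;>
      simp only <;> linarith
  · have hp : p ∉ B := by
      rcases abs_cases (p.1 - p.2) with ⟨e, e'⟩ | ⟨e, e'⟩ <;> rw [e] at h0 <;>
      exact h2' p (by rw [abs_lt]; constructor <;> linarith) (by rw [abs_lt]; constructor <;> linarith)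
        (by rw [abs_lt]; constructor <;> linarith)
    refine iff_of_false ?_ hp
    rw [hκ]
    rintro (h | ⟨ha, hb, hc⟩)
    · revert h
      refine h2' _ ?_ ?_ ?_ <;> simp only <;> rw [abs_lt] <;>
      rcases abs_cases (p.1 - p.2) with ⟨e, e'⟩ | ⟨e, e'⟩ <;> rw [e] at h0 hm <;>
      constructor <;> linarith
    · simp only at ha hb hc
      rcases abs_cases (p.1 - p.2) with ⟨e, e'⟩ | ⟨e, e'⟩ <;> rw [e] at h0 hm <;> linarith

lemma kite_symm_image {κ : Plane ≃ₜ Plane}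
    (hκ : ∀ p, κ p = (p.1 - kiteM p / 2, p.2 - kiteM p / 2)) {B : Set Plane}
    (h1 : ∀ p ∈ hexAt 0, (p.1 ≤ 0 ∨ p.2 ≤ 0) → p ∈ B)
    (h2 : ∀ p : Plane, 0 < p.1 → 0 < p.2 → p.1 < 1 → p.2 < 1 → p ∉ B) :
    κ.symm '' B = B ∪ tri0 := by
  refine symm_image_eq_of_iff fun p => ?_
  have h1' : ∀ p : Plane, |p.1| ≤ 1 → |p.2| ≤ 1 → |p.1 + p.2| ≤ 1 → (p.1 ≤ 0 ∨ p.2 ≤ 0) → p ∈ B :=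
    fun p a b c => h1 p (by simpa [hexAt] using ⟨a, b, c⟩)
  have h3 : ∀ p : Plane, -1 ≤ p.1 + p.2 → p.1 + p.2 ≤ 1 → -1 ≤ p.1 → p.1 ≤ 1 → -1 ≤ p.2 → p.2 ≤ 1 →
      (p.1 ≤ 0 ∨ p.2 ≤ 0) → p ∈ B := fun p a b c d e f g =>
    h1' p (abs_le.2 ⟨c, d⟩) (abs_le.2 ⟨e, f⟩) (abs_le.2 ⟨a, b⟩) g
  rcases kiteM_eq p with ⟨hm, h⟩ | ⟨hs, h0, hm⟩ | ⟨hs, h0, hm⟩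
  · have : κ p = p := by rw [hκ, hm]; ext <;> simp
    rw [this, mem_union, iff_comm, or_iff_left_iff_imp]
    rintro ⟨hx, hy, hxy⟩
    refine h3 p (by linarith) (by linarith) (by linarith) (by linarith) (by linarith) (by linarith) ?_
    rcases abs_cases (p.1 - p.2) with ⟨e, e'⟩ | ⟨e, e'⟩ <;> rw [e] at h
    · right
      rcases h with h | h <;> linarith
    · left
      rcases h with h | h <;> linarith
  · rcases hs.eq_or_lt with hs | hs
    · have hp : p ∈ tri0 := by
        rcases abs_cases (p.1 - p.2) with ⟨e, e'⟩ | ⟨e, e'⟩ <;> rw [e] at h0 <;>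
        refine ⟨?_, ?_, ?_⟩ <;> linarith
      refine iff_of_true ?_ (Or.inr hp)
      rw [hκ]
      rcases abs_cases (p.1 - p.2) with ⟨e, e'⟩ | ⟨e, e'⟩ <;> rw [e] at h0 hm <;>
        [refine h3 _ ?_ ?_ ?_ ?_ ?_ ?_ (Or.inr ?_); refine h3 _ ?_ ?_ ?_ ?_ ?_ ?_ (Or.inl ?_)] <;>
        simp only <;> linarith
    · refine iff_of_false ?_ ?_
      · rw [hκ]
        rcases abs_cases (p.1 - p.2) with ⟨e, e'⟩ | ⟨e, e'⟩ <;> rw [e] at h0 hm <;>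
          refine h2 _ ?_ ?_ ?_ ?_ <;> simp only <;> linarith
      · rintro (h | ⟨ha, hb, hc⟩)
        · revert h
          rcases abs_cases (p.1 - p.2) with ⟨e, e'⟩ | ⟨e, e'⟩ <;> rw [e] at h0 hm <;>
          refine h2 _ ?_ ?_ ?_ ?_ <;> linarith
        · linarith
  · refine iff_of_true ?_ ?_
    · rw [hκ]
      rcases abs_cases (p.1 - p.2) with ⟨e, e'⟩ | ⟨e, e'⟩ <;> rw [e] at h0 hm <;>
        [refine h3 _ ?_ ?_ ?_ ?_ ?_ ?_ (Or.inr ?_); refine h3 _ ?_ ?_ ?_ ?_ ?_ ?_ (Or.inl ?_)] <;>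
        simp only <;> linarith
    · by_cases ht : 0 ≤ p.1 ∧ 0 ≤ p.2
      · exact Or.inr ⟨ht.1, ht.2, by linarith⟩
      · refine Or.inl ?_
        have hor : p.1 ≤ 0 ∨ p.2 ≤ 0 := by
          by_contra! hn; exact ht ⟨hn.1.le, hn.2.le⟩
        rcases abs_cases (p.1 - p.2) with ⟨e, e'⟩ | ⟨e, e'⟩ <;> rw [e] at h0 hm <;>
        exact h3 p (by linarith) (by linarith) (by linarith) (by linarith) (by linarith)
          (by linarith) hor

lemma kite_eventually {κ : Plane ≃ₜ Plane}
    (hκ : ∀ p, κ p = (p.1 - kiteM p / 2, p.2 - kiteM p / 2)) {c : ℤ × ℤ} (h0 : c ≠ (0, 0))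
    (h1 : c ≠ (1, 0)) (h2 : c ≠ (0, 1)) : ∀ᶠ p in 𝓝 (zpt c), κ p = p := by
  have key : 1 - |(c.1 : ℝ) - c.2| - 2 * (c.1 + c.2 - 1) < 0 ∨
      1 - |(c.1 : ℝ) - c.2| + (c.1 + c.2 - 1) / 2 < 0 := by
    by_contra! hn
    have e1 : 0 ≤ 1 - |c.1 - c.2| - 2 * (c.1 + c.2 - 1) := by exact_mod_cast hn.1
    have e2 : (0:ℝ) ≤ 2 * (1 - |(c.1 : ℝ) - c.2|) + (c.1 + c.2 - 1) := by linarith [hn.2]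
    have e2 : 0 ≤ 2 * (1 - |c.1 - c.2|) + (c.1 + c.2 - 1) := by exact_mod_cast e2
    obtain ⟨x, y⟩ := c
    simp only [ne_eq, Prod.mk.injEq] at *
    rcases abs_cases (x - y) with e | e <;> omega
  have hc1 : Continuous fun p : Plane => 1 - |p.1 - p.2| - 2 * (p.1 + p.2 - 1) := by fun_prop
  have hc2 : Continuous fun p : Plane => 1 - |p.1 - p.2| + (p.1 + p.2 - 1) / 2 := by fun_prop
  have : ∀ᶠ p : Plane in 𝓝 (zpt c), 1 - |p.1 - p.2| - 2 * (p.1 + p.2 - 1) < 0 ∨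
      1 - |p.1 - p.2| + (p.1 + p.2 - 1) / 2 < 0 := by
    rcases key with h | h
    · exact (hc1.continuousAt.eventually_lt continuousAt_const h).mono fun _ => Or.inl
    · exact (hc2.continuousAt.eventually_lt continuousAt_const h).mono fun _ => Or.inr
  filter_upwards [this] with p hp
  have : kiteM p = 0 := by
    rw [kiteM, max_eq_left]
    rw [min_le_iff]
    exact hp.imp le_of_lt le_of_lt
  rw [hκ, this]
  ext <;> simp

/-- A set to which the standard triangle can be added by a homeomorphism fixing a neighborhood of
every integer point that is not a vertex of the triangle. -/
def AddTri (A : Set Plane) : Prop :=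
  ∃ h : Plane ≃ₜ Plane, h '' A = A ∪ tri0 ∧ ∀ c : ℤ × ℤ, c ≠ (0, 0) → c ≠ (1, 0) → c ≠ (0, 1) →
    ∀ᶠ p in 𝓝 (zpt c), h p = p

lemma addTri_of_edge {B : Set Plane}
    (h1 : ∀ p : Plane, p.1 ≤ 1 → p.2 ≤ 1 → 1 ≤ p.1 + p.2 → p ∈ B) (h2 : Disjoint (ohexAt 0) B) :
    AddTri B := by
  obtain ⟨κ, hκ⟩ := exists_kite
  exact ⟨κ, kite_image hκ h1 h2, fun c => kite_eventually hκ⟩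

lemma addTri_of_edges {B : Set Plane}
    (h1 : ∀ p ∈ hexAt 0, (p.1 ≤ 0 ∨ p.2 ≤ 0) → p ∈ B)
    (h2 : ∀ p : Plane, 0 < p.1 → 0 < p.2 → p.1 < 1 → p.2 < 1 → p ∉ B) :
    AddTri B := by
  obtain ⟨κ, hκ⟩ := exists_kite
  refine ⟨κ.symm, kite_symm_image hκ h1 h2, fun c h h' h'' => ?_⟩
  filter_upwards [kite_eventually hκ h h' h''] with p hp
  rw [Homeomorph.symm_apply_eq, hp]

/-- The affine rotation of order three of the standard triangle. -/
def triRot : Plane ≃ₜ Plane where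
  toFun := fun p => (1 - p.1 - p.2, p.1)
  invFun := fun q => (q.2, 1 - q.1 - q.2)
  left_inv := fun p => by ext <;> dsimp only <;> ring
  right_inv := fun p => by ext <;> dsimp only <;> ring
  continuous_toFun := by fun_prop
  continuous_invFun := by fun_prop

lemma triRot_apply (p : Plane) : triRot p = (1 - p.1 - p.2, p.1) := rfl

lemma eventually_conj {φ h : Plane ≃ₜ Plane} {x : Plane} (hx : ∀ᶠ p in 𝓝 x, h p = p) :
    ∀ᶠ p in 𝓝 (φ x), (φ.symm.trans h).trans φ p = p := by
  have : Tendsto φ.symm (𝓝 (φ x)) (𝓝 x) := by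
    have := φ.symm.continuous.tendsto (φ x)
    rwa [φ.symm_apply_apply] at this
  filter_upwards [this.eventually hx] with p hp
  simp only [Homeomorph.trans_apply, hp, φ.apply_symm_apply]

lemma image_conj {φ h : Plane ≃ₜ Plane} (A : Set Plane) :
    (φ.symm.trans h).trans φ '' A = φ '' (h '' (φ ⁻¹' A)) := by
  rw [← φ.image_symm, image_image, image_image]
  rfl

lemma AddTri.rot {A : Set Plane} (h : AddTri (triRot ⁻¹' A)) : AddTri A := by
  obtain ⟨h, hA, hc⟩ := h
  refine ⟨(triRot.symm.trans h).trans triRot, ?_, ?_⟩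
  · rw [image_conj, hA, image_union, triRot.image_preimage]
    congr 1
    refine image_eq_of_iff fun p => ?_
    simp only [tri0, mem_ofPred_eq, triRot_apply]
    constructor <;> rintro ⟨a, b, c⟩ <;> refine ⟨?_, ?_, ?_⟩ <;> linarith
  · rintro ⟨x, y⟩ h0 h1 h2
    have : zpt (x, y) = triRot (zpt (y, 1 - x - y)) := by
      simp only [zpt, triRot_apply]; ext <;> push_cast <;> ring
    rw [this]
    refine eventually_conj (hc _ ?_ ?_ ?_) <;>
    · simp only [ne_eq, Prod.mk.injEq] at *
      omega

lemma addTri_of_edge' {A : Set Plane}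
    (h1 : ∀ p : Plane, p.1 ≤ 1 → p.2 ≤ 0 → 0 ≤ p.1 + p.2 → p ∈ A)
    (h2 : Disjoint (ohexAt (0, 1)) A) : AddTri A := by
  refine AddTri.rot (AddTri.rot (addTri_of_edge (fun p a b c => ?_) ?_))
  · simp only [mem_preimage, triRot_apply]
    refine h1 _ ?_ ?_ ?_ <;> simp only <;> linarith
  · rw [disjoint_left] at h2 ⊢
    intro p hp hA
    refine h2 ?_ hA
    simp only [ohexAt, mem_ofPred_eq, Prod.fst_zero, Prod.snd_zero, sub_zero, abs_lt,
      triRot_apply] at hp ⊢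
    obtain ⟨⟨_, _⟩, ⟨_, _⟩, _, _⟩ := hp
    refine ⟨⟨?_, ?_⟩, ⟨?_, ?_⟩, ?_, ?_⟩ <;> linarith

lemma addTri_of_edges' {A : Set Plane}
    (h1 : ∀ p ∈ hexAt (1, 0), (p.2 ≤ 0 ∨ 1 ≤ p.1 + p.2) → p ∈ A)
    (h2 : ∀ p : Plane, 0 < p.2 → 0 < p.1 + p.2 → p.2 < 1 → p.1 + p.2 < 1 → p ∉ A) :
    AddTri A := by
  refine AddTri.rot (addTri_of_edges (fun p hp h => ?_) fun p a b c d => ?_)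
  · refine h1 _ ?_ ?_
    · simp only [hexAt, mem_ofPred_eq, Prod.fst_zero, Prod.snd_zero, sub_zero, abs_le,
        triRot_apply] at hp ⊢
      obtain ⟨⟨_, _⟩, ⟨_, _⟩, _, _⟩ := hp
      refine ⟨⟨?_, ?_⟩, ⟨?_, ?_⟩, ?_, ?_⟩ <;> linarith
    · simp only [triRot_apply]
      exact h.imp (fun h => by linarith) fun h => by linarith
  · simp only [mem_preimage, triRot_apply]
    refine h2 _ ?_ ?_ ?_ ?_ <;> simp only <;> linarith

/-- The union of the hexagons with given centers. -/
def hexUnion (S : Set (ℤ × ℤ)) : Set Plane := ⋃ c ∈ S, hexAt (zpt c)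

lemma mem_hexUnion {S : Set (ℤ × ℤ)} {p : Plane} : p ∈ hexUnion S ↔ ∃ c ∈ S, p ∈ hexAt (zpt c) := by
  simp [hexUnion]

lemma mem_hexAt_zpt {c : ℤ × ℤ} {p : Plane} : p ∈ hexAt (zpt c) ↔ ((c.1:ℝ) - 1 ≤ p.1 ∧
    p.1 ≤ c.1 + 1) ∧ ((c.2:ℝ) - 1 ≤ p.2 ∧ p.2 ≤ c.2 + 1) ∧
    ((c.1:ℝ) + c.2 - 1 ≤ p.1 + p.2 ∧ p.1 + p.2 ≤ c.1 + c.2 + 1) := by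
  simp only [hexAt, zpt, mem_ofPred_eq, abs_le]
  constructor <;> rintro ⟨⟨_, _⟩, ⟨_, _⟩, _, _⟩ <;> refine ⟨⟨?_, ?_⟩, ⟨?_, ?_⟩, ?_, ?_⟩ <;> linarith

/-- The rotation of order six of the plane preserving the hexagonal tiling. -/
def hexRot : Plane ≃ₜ Plane where
  toFun := fun p => (-p.2, p.1 + p.2)
  invFun := fun q => (q.1 + q.2, -q.1)
  left_inv := fun p => by ext <;> simp
  right_inv := fun p => by ext <;> simp
  continuous_toFun := by fun_prop
  continuous_invFun := by fun_prop

lemma hexRot_apply (p : Plane) : hexRot p = (-p.2, p.1 + p.2) := rfl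

/-- The integral version of `hexRot`. -/
def hexRotZ : ℤ × ℤ ≃ ℤ × ℤ where
  toFun := fun p => (-p.2, p.1 + p.2)
  invFun := fun q => (q.1 + q.2, -q.1)
  left_inv := fun p => by ext <;> simp
  right_inv := fun p => by ext <;> simp

lemma hexRotZ_apply (p : ℤ × ℤ) : hexRotZ p = (-p.2, p.1 + p.2) := rfl

lemma hexRot_zpt (c : ℤ × ℤ) : hexRot (zpt c) = zpt (hexRotZ c) := by
  simp [hexRot_apply, hexRotZ_apply, zpt]

lemma hexRot_mem_hexAt {c : ℤ × ℤ} {p : Plane} :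
    hexRot p ∈ hexAt (zpt (hexRotZ c)) ↔ p ∈ hexAt (zpt c) := by
  simp only [mem_hexAt_zpt, hexRot_apply, hexRotZ_apply]
  push_cast
  constructor <;> rintro ⟨⟨_, _⟩, ⟨_, _⟩, _, _⟩ <;> refine ⟨⟨?_, ?_⟩, ⟨?_, ?_⟩, ?_, ?_⟩ <;> linarith

lemma preimage_hexUnion (S : Set (ℤ × ℤ)) : hexRot ⁻¹' hexUnion S = hexUnion (hexRotZ ⁻¹' S) := by
  ext1 p
  rw [mem_preimage, mem_hexUnion, mem_hexUnion]
  constructor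
  · rintro ⟨c, hc, hp⟩
    refine ⟨hexRotZ.symm c, by simpa using hc, ?_⟩
    rw [← hexRot_mem_hexAt, Equiv.apply_symm_apply]
    exact hp
  · rintro ⟨c, hc, hp⟩
    exact ⟨_, hc, hexRot_mem_hexAt.2 hp⟩

/-- The union of the last `m` triangles of the hexagon around the origin. -/
def hexFan : ℕ → Set Plane
  | 0 => ∅
  | m + 1 => hexRot ⁻¹' (hexFan m ∪ tri0)

lemma hexFan_subset {m : ℕ} (hm : m ≤ 4) {p : Plane} (hp : p ∈ hexFan m) :
    p.2 ≤ 0 ∨ p.1 + p.2 ≤ 0 := by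
  interval_cases m <;>
  simp only [hexFan, tri0, hexRot_apply, mem_preimage, mem_union, mem_ofPred_eq,
    mem_empty_iff_false, false_or, neg_add_rev] at hp
  · rcases hp with ⟨a, b, c⟩; left; linarith
  · rcases hp with ⟨a, b, c⟩ | ⟨a, b, c⟩ <;> left <;> linarith
  · rcases hp with (⟨a, b, c⟩ | ⟨a, b, c⟩) | ⟨a, b, c⟩ <;> left <;> linarith
  · rcases hp with ((⟨a, b, c⟩ | ⟨a, b, c⟩) | ⟨a, b, c⟩) | ⟨a, b, c⟩ <;>
      [right; left; left; left] <;> linarith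

lemma mem_hexFan_succ {m : ℕ} {p : Plane} (h1 : p.1 ≤ 1) (h2 : p.2 ≤ 0) (h3 : 0 ≤ p.1 + p.2) :
    p ∈ hexFan (m + 1) :=
  Or.inr ⟨by simp [hexRot_apply, h2], h3, by simpa [hexRot_apply] using h1⟩

lemma mem_hexFan_five {p : Plane} : p ∈ hexFan 5 ↔ p ∈ hexAt 0 ∧ (p.1 ≤ 0 ∨ p.2 ≤ 0) := by
  simp only [hexFan, tri0, hexRot_apply, mem_preimage, mem_union, mem_ofPred_eq,
    mem_empty_iff_false, false_or, hexAt, Prod.fst_zero, Prod.snd_zero, sub_zero, abs_le]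
  constructor
  · rintro ((((⟨a, b, c⟩ | ⟨a, b, c⟩) | ⟨a, b, c⟩) | ⟨a, b, c⟩) | ⟨a, b, c⟩) <;>
    refine ⟨⟨⟨?_, ?_⟩, ⟨?_, ?_⟩, ?_, ?_⟩, ?_⟩ <;> first | linarith | (left; linarith) | (right; linarith)
  · rintro ⟨⟨⟨_, _⟩, ⟨_, _⟩, _, _⟩, h⟩
    rcases le_total 0 p.1 with h1 | h1 <;> rcases le_total 0 p.2 with h2 | h2 <;>
    rcases le_total 0 (p.1 + p.2) with h3 | h3 <;> rcases h with h | h <;>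
    first
    | (refine Or.inr ⟨?_, ?_, ?_⟩ <;> linarith)
    | (refine Or.inl (Or.inr ⟨?_, ?_, ?_⟩) <;> linarith)
    | (refine Or.inl (Or.inl (Or.inr ⟨?_, ?_, ?_⟩)) <;> linarith)
    | (refine Or.inl (Or.inl (Or.inl (Or.inr ⟨?_, ?_, ?_⟩))) <;> linarith)
    | (refine Or.inl (Or.inl (Or.inl (Or.inl ⟨?_, ?_, ?_⟩))) <;> linarith)

lemma hexRot_mem_hexAt_zero {p : Plane} : hexRot p ∈ hexAt 0 ↔ p ∈ hexAt 0 := by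
  have : zpt 0 = 0 := by simp [zpt]
  rw [← this]
  exact hexRot_mem_hexAt (c := 0)

lemma hexFan_five_union : hexFan 5 ∪ tri0 = hexAt 0 := by
  ext1 p
  rw [mem_union, mem_hexFan_five]
  simp only [tri0, hexAt, mem_ofPred_eq, Prod.fst_zero, Prod.snd_zero, sub_zero, abs_le]
  constructor
  · rintro (h | ⟨a, b, c⟩)
    · exact h.1
    · refine ⟨⟨?_, ?_⟩, ⟨?_, ?_⟩, ?_, ?_⟩ <;> linarith
  · rintro h
    by_cases h' : p.1 ≤ 0 ∨ p.2 ≤ 0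
    · exact Or.inl ⟨h, h'⟩
    · push Not at h'
      exact Or.inr ⟨h'.1.le, h'.2.le, h.2.2.2⟩

lemma hexFan_six : hexFan 6 = hexAt 0 := by
  rw [hexFan, hexFan_five_union]
  ext1 p
  exact hexRot_mem_hexAt_zero

lemma disjoint_ohexAt_zero {S : Set (ℤ × ℤ)} (hS : ∀ c ∈ S, (3:ℤ) ∣ c.2 - c.1) (h0 : (0, 0) ∉ S)
    : Disjoint (ohexAt 0) (hexUnion S) := by
  rw [disjoint_left]
  intro p hp hpS
  obtain ⟨⟨x, y⟩, hc, hpc⟩ := mem_hexUnion.1 hpS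
  rw [mem_hexAt_zpt] at hpc
  simp only [ohexAt, mem_ofPred_eq, Prod.fst_zero, Prod.snd_zero, sub_zero, abs_lt] at hp
  obtain ⟨⟨a1, a2⟩, ⟨b1, b2⟩, c1, c2⟩ := hp
  obtain ⟨⟨d1, d2⟩, ⟨e1, e2⟩, f1, f2⟩ := hpc
  have g1 : (x:ℝ) < (2:ℤ) := by push_cast; linarith
  have g2 : ((-2:ℤ):ℝ) < x := by push_cast; linarith
  have g3 : (y:ℝ) < (2:ℤ) := by push_cast; linarith
  have g4 : ((-2:ℤ):ℝ) < y := by push_cast; linarith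
  have g5 : ((x + y : ℤ):ℝ) < (2:ℤ) := by push_cast; linarith
  have g6 : ((-2:ℤ):ℝ) < (x + y : ℤ) := by push_cast; linarith
  rw [Int.cast_lt] at g1 g2 g3 g4 g5 g6
  have := hS _ hc
  simp only at this
  have hx : x = 0 := by omega
  have hy : y = 0 := by omega
  subst hx hy
  exact h0 hc

lemma disjoint_ohexAt_vertex {S : Set (ℤ × ℤ)} (hS : ∀ c ∈ S, (3:ℤ) ∣ c.2 - c.1) (h0 : (0, 0) ∉ S)
    (h1 : (1, 1) ∉ S) (h2 : (-1, 2) ∉ S) :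
    Disjoint (ohexAt (0, 1)) (hexUnion S) := by
  rw [disjoint_left]
  intro p hp hpS
  obtain ⟨⟨x, y⟩, hc, hpc⟩ := mem_hexUnion.1 hpS
  rw [mem_hexAt_zpt] at hpc
  simp only [ohexAt, mem_ofPred_eq, abs_lt] at hp
  obtain ⟨⟨a1, a2⟩, ⟨b1, b2⟩, c1, c2⟩ := hp
  obtain ⟨⟨d1, d2⟩, ⟨e1, e2⟩, f1, f2⟩ := hpc
  have g1 : (x:ℝ) < (2:ℤ) := by push_cast; linarith
  have g2 : ((-2:ℤ):ℝ) < x := by push_cast; linarith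
  have g3 : (y:ℝ) < (3:ℤ) := by push_cast; linarith
  have g4 : ((-1:ℤ):ℝ) < y := by push_cast; linarith
  have g5 : ((x + y : ℤ):ℝ) < (3:ℤ) := by push_cast; linarith
  have g6 : ((-1:ℤ):ℝ) < (x + y : ℤ) := by push_cast; linarith
  rw [Int.cast_lt] at g1 g2 g3 g4 g5 g6
  have := hS _ hc
  simp only at this
  have : (x = 0 ∧ y = 0) ∨ (x = 1 ∧ y = 1) ∨ (x = -1 ∧ y = 2) := by omega
  rcases this with ⟨rfl, rfl⟩ | ⟨rfl, rfl⟩ | ⟨rfl, rfl⟩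
  exacts [h0 hc, h1 hc, h2 hc]

lemma notMem_hexUnion_of_square {S : Set (ℤ × ℤ)} (hS : ∀ c ∈ S, (3:ℤ) ∣ c.2 - c.1) (h0 : (0, 0) ∉ S)
    (h1 : (1, 1) ∉ S) {p : Plane} (a1 : 0 < p.1) (b1 : 0 < p.2)
    (a2 : p.1 < 1) (b2 : p.2 < 1) : p ∉ hexUnion S := by
  intro hpS
  obtain ⟨⟨x, y⟩, hc, hpc⟩ := mem_hexUnion.1 hpS
  rw [mem_hexAt_zpt] at hpc
  obtain ⟨⟨d1, d2⟩, ⟨e1, e2⟩, f1, f2⟩ := hpc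
  have g1 : (x:ℝ) < (2:ℤ) := by push_cast; linarith
  have g2 : ((-1:ℤ):ℝ) < x := by push_cast; linarith
  have g3 : (y:ℝ) < (2:ℤ) := by push_cast; linarith
  have g4 : ((-1:ℤ):ℝ) < y := by push_cast; linarith
  rw [Int.cast_lt] at g1 g2 g3 g4
  have := hS _ hc
  simp only at this
  have : (x = 0 ∧ y = 0) ∨ (x = 1 ∧ y = 1) := by omega
  rcases this with ⟨rfl, rfl⟩ | ⟨rfl, rfl⟩
  exacts [h0 hc, h1 hc]

lemma addTri_hexFan_zero {S : Set (ℤ × ℤ)} (hS : ∀ c ∈ S, (3:ℤ) ∣ c.2 - c.1) (h0 : (0, 0) ∉ S)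
    (h1 : (1, 1) ∈ S) : AddTri (hexUnion S ∪ hexFan 0) := by
  rw [hexFan, union_empty]
  refine addTri_of_edge (fun p a b c => mem_hexUnion.2 ⟨_, h1, ?_⟩) (disjoint_ohexAt_zero hS h0)
  rw [mem_hexAt_zpt]
  push_cast
  refine ⟨⟨?_, ?_⟩, ⟨?_, ?_⟩, ?_, ?_⟩ <;> linarith

lemma addTri_hexFan_arc {S : Set (ℤ × ℤ)} (hS : ∀ c ∈ S, (3:ℤ) ∣ c.2 - c.1) (h0 : (0, 0) ∉ S)
    {m : ℕ} (hm : m + 1 ≤ 4) (h1 : (1, 1) ∈ S) (h2 : (2, -1) ∈ S) :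
    AddTri (hexUnion S ∪ hexFan (m + 1)) := by
  refine addTri_of_edges' (fun p hp h => ?_) fun p a b c d => ?_
  · simp only [hexAt, mem_ofPred_eq, abs_le] at hp
    obtain ⟨⟨a1, a2⟩, ⟨b1, b2⟩, c1, c2⟩ := hp
    by_cases hy : 1 ≤ p.1 + p.2 ∧ 0 ≤ p.2
    · refine Or.inl (mem_hexUnion.2 ⟨_, h1, ?_⟩)
      rw [mem_hexAt_zpt]
      push_cast
      refine ⟨⟨?_, ?_⟩, ⟨?_, ?_⟩, ?_, ?_⟩ <;> linarith
    · have hy : p.2 ≤ 0 := by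
        rcases h with h | h
        · exact h
        · by_contra! hn; exact hy ⟨h, hn.le⟩
      rcases le_total 1 p.1 with h3 | h3
      · refine Or.inl (mem_hexUnion.2 ⟨_, h2, ?_⟩)
        rw [mem_hexAt_zpt]
        push_cast
        refine ⟨⟨?_, ?_⟩, ⟨?_, ?_⟩, ?_, ?_⟩ <;> linarith
      · exact Or.inr (mem_hexFan_succ h3 hy (by linarith))
  · rintro (h | h)
    · refine disjoint_left.1 (disjoint_ohexAt_zero hS h0) ?_ h
      simp only [ohexAt, mem_ofPred_eq, Prod.fst_zero, Prod.snd_zero, sub_zero, abs_lt]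
      refine ⟨⟨?_, ?_⟩, ⟨?_, ?_⟩, ?_, ?_⟩ <;> linarith
    · rcases hexFan_subset hm h with h | h <;> linarith

lemma addTri_hexFan_free {S : Set (ℤ × ℤ)} (hS : ∀ c ∈ S, (3:ℤ) ∣ c.2 - c.1) (h0 : (0, 0) ∉ S)
    {m : ℕ} (hm : m + 1 ≤ 4) (h1 : (1, 1) ∉ S) (h2 : (-1, 2) ∉ S) :
    AddTri (hexUnion S ∪ hexFan (m + 1)) := by
  refine addTri_of_edge' (fun p a b c => Or.inr (mem_hexFan_succ a b c)) ?_
  rw [disjoint_union_right]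
  refine ⟨disjoint_ohexAt_vertex hS h0 h1 h2, ?_⟩
  rw [disjoint_left]
  intro p hp h
  simp only [ohexAt, mem_ofPred_eq, abs_lt] at hp
  rcases hexFan_subset hm h with h | h <;> linarith [hp.2.1.1, hp.2.2.1]

lemma addTri_hexFan_five {S : Set (ℤ × ℤ)} (hS : ∀ c ∈ S, (3:ℤ) ∣ c.2 - c.1) (h0 : (0, 0) ∉ S)
    (h1 : (1, 1) ∉ S) : AddTri (hexUnion S ∪ hexFan 5) := by
  refine addTri_of_edges (fun p hp h => Or.inr (mem_hexFan_five.2 ⟨hp, h⟩)) fun p a b c d => ?_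
  rintro (h | h)
  · exact notMem_hexUnion_of_square hS h0 h1 a b c d h
  · rcases (mem_hexFan_five.1 h).2 with h | h <;> linarith

/-- Centers of the hexagons adjacent to the hexagon around the origin. -/
def hexNbr : Fin 6 → ℤ × ℤ := ![(1, 1), (-1, 2), (-2, 1), (-1, -1), (1, -2), (2, -1)]

lemma hexRotZ_hexNbr : ∀ i, hexRotZ (hexNbr i) = hexNbr (i + 1) := by decide

lemma trans_image (f g : Plane ≃ₜ Plane) (A : Set Plane) : (f.trans g) '' A = g '' (f '' A) := by
  rw [image_image]; rfl

lemma exists_fill_of_rot {S : Set (ℤ × ℤ)} {A : Set Plane} (h : ∃ h : Plane ≃ₜ Plane,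
      h '' (hexUnion (hexRotZ ⁻¹' S) ∪ hexRot ⁻¹' A) = hexUnion (hexRotZ ⁻¹' S) ∪ hexAt 0 ∧
      ∀ c ∈ hexRotZ ⁻¹' S, ∀ᶠ p in 𝓝 (zpt c), h p = p) :
    ∃ h : Plane ≃ₜ Plane, h '' (hexUnion S ∪ A) = hexUnion S ∪ hexAt 0 ∧
      ∀ c ∈ S, ∀ᶠ p in 𝓝 (zpt c), h p = p := by
  obtain ⟨h, hh, hc⟩ := h
  refine ⟨(hexRot.symm.trans h).trans hexRot, ?_, fun c hcS => ?_⟩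
  · have : hexAt 0 = hexRot ⁻¹' hexAt 0 := by
      ext1 p; exact hexRot_mem_hexAt_zero.symm
    rw [image_conj, preimage_union, preimage_hexUnion, hh, this, ← preimage_hexUnion,
      ← preimage_union, hexRot.image_preimage, ← this]
  · have : zpt c = hexRot (zpt (hexRotZ.symm c)) := by
      rw [hexRot_zpt, Equiv.apply_symm_apply]
    rw [this]
    exact eventually_conj (hc _ (by simpa using hcS))

lemma dvd_hexRotZ {S : Set (ℤ × ℤ)} (hS : ∀ c ∈ S, (3:ℤ) ∣ c.2 - c.1) :
    ∀ c ∈ hexRotZ ⁻¹' S, (3:ℤ) ∣ c.2 - c.1 := by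
  rintro ⟨x, y⟩ hc
  have := hS _ hc
  simp only [hexRotZ_apply] at this ⊢
  omega

lemma zero_notMem_hexRotZ {S : Set (ℤ × ℤ)} (h0 : (0, 0) ∉ S) : (0, 0) ∉ hexRotZ ⁻¹' S := by
  simpa [hexRotZ_apply] using h0

lemma exists_fill_aux {k : ℕ} (hk : 1 ≤ k) (hk' : k ≤ 5) (n : ℕ) : ∀ m, n + m = 6 →
    ∀ S : Set (ℤ × ℤ), (∀ c ∈ S, (3:ℤ) ∣ c.2 - c.1) → (0, 0) ∉ S →
    (∀ i : Fin 6, hexNbr i ∈ S ↔ (i.val + m) % 6 < k) →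
    ∃ h : Plane ≃ₜ Plane, h '' (hexUnion S ∪ hexFan m) = hexUnion S ∪ hexAt 0 ∧
      ∀ c ∈ S, ∀ᶠ p in 𝓝 (zpt c), h p = p := by
  induction n with
  | zero =>
    intro m hm S hS h0 H
    obtain rfl : m = 6 := by omega
    exact ⟨Homeomorph.refl _, by simp [hexFan_six], fun c _ => by simp⟩
  | succ n ih =>
    intro m hm S hS h0 H
    have h1 : (1, 1) ∈ S ↔ m % 6 < k := by simpa [hexNbr] using H 0
    have h2 : (-1, 2) ∈ S ↔ (1 + m) % 6 < k := H 1
    have h5 : (2, -1) ∈ S ↔ (5 + m) % 6 < k := H 5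
    have hadd : AddTri (hexUnion S ∪ hexFan m) := by
      rcases Nat.eq_zero_or_pos m with rfl | hm0
      · exact addTri_hexFan_zero hS h0 (h1.2 (by omega))
      · obtain ⟨m, rfl⟩ : ∃ m', m = m' + 1 := ⟨m - 1, by omega⟩
        rcases lt_or_ge (m + 1) k with hlt | hge
        · exact addTri_hexFan_arc hS h0 (by omega) (h1.2 (by omega)) (h5.2 (by omega))
        · by_cases hm5 : m + 1 = 5
          · rw [hm5]
            exact addTri_hexFan_five hS h0 (fun h => by have := h1.1 h; omega)
          · exact addTri_hexFan_free hS h0 (by omega) (fun h => by have := h1.1 h; omega)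
              (fun h => by have := h2.1 h; omega)
    obtain ⟨f, hf, hfc⟩ := hadd
    obtain ⟨g, hg, hgc⟩ := exists_fill_of_rot (A := hexFan m ∪ tri0)
      (ih (m + 1) (by omega) (hexRotZ ⁻¹' S) (dvd_hexRotZ hS) (zero_notMem_hexRotZ h0) (by
        intro i
        rw [mem_preimage, hexRotZ_hexNbr, H]
        have : (i + 1).val = (i.val + 1) % 6 := Fin.val_add i 1
        rw [this]
        omega))
    refine ⟨f.trans g, ?_, fun c hc => ?_⟩
    · rw [trans_image, hf, union_assoc, hg]
    · have hd := hS c hc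
      filter_upwards [hgc c hc, hfc c (fun h => h0 (h ▸ hc)) (by rintro rfl; revert hd; decide)
        (by rintro rfl; revert hd; decide)] with p h1 h2
      simp [h1, h2]

lemma exists_fill_zero {k : ℕ} (hk : 1 ≤ k) (hk' : k ≤ 5) (a : ℕ) :
    ∀ S : Set (ℤ × ℤ), (∀ c ∈ S, (3:ℤ) ∣ c.2 - c.1) → (0, 0) ∉ S →
    (∀ i : Fin 6, hexNbr (i + Fin.ofNat 6 a) ∈ S ↔ i.val < k) →
    ∃ h : Plane ≃ₜ Plane, h '' (hexUnion S) = hexUnion S ∪ hexAt 0 ∧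
      ∀ c ∈ S, ∀ᶠ p in 𝓝 (zpt c), h p = p := by
  induction a with
  | zero =>
    intro S hS h0 H
    have := exists_fill_aux hk hk' 6 0 rfl S hS h0 (by
      intro i
      rw [add_zero, Nat.mod_eq_of_lt i.isLt, ← H i]
      simp)
    simpa [hexFan] using this
  | succ a ih =>
    intro S hS h0 H
    have := exists_fill_of_rot (S := S) (A := ∅) (by
      simpa using ih (hexRotZ ⁻¹' S) (dvd_hexRotZ hS) (zero_notMem_hexRotZ h0) (by
        intro i
        have : Fin.ofNat 6 (a + 1) = Fin.ofNat 6 a + 1 := by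
          ext
          simp [Fin.val_add]
        rw [mem_preimage, hexRotZ_hexNbr, ← H i, this, add_assoc]))
    simpa using this

lemma add_mem_hexAt {b c : ℤ × ℤ} {p : Plane} :
    zpt b + p ∈ hexAt (zpt (b + c)) ↔ p ∈ hexAt (zpt c) := by
  rw [mem_hexAt_zpt, mem_hexAt_zpt]
  simp only [zpt, Prod.fst_add, Prod.snd_add]
  push_cast
  constructor <;> rintro ⟨⟨_, _⟩, ⟨_, _⟩, _, _⟩ <;> refine ⟨⟨?_, ?_⟩, ⟨?_, ?_⟩, ?_, ?_⟩ <;> linarith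

lemma zpt_zero : zpt 0 = 0 := by simp [zpt]

lemma zpt_add (b c : ℤ × ℤ) : zpt (b + c) = zpt b + zpt c := by simp [zpt]

lemma preimage_add_hexUnion (b : ℤ × ℤ) (S : Set (ℤ × ℤ)) :
    Homeomorph.addLeft (zpt b) ⁻¹' hexUnion S = hexUnion ((b + ·) ⁻¹' S) := by
  ext1 p
  rw [mem_preimage, mem_hexUnion, mem_hexUnion]
  constructor
  · rintro ⟨c, hc, hp⟩
    refine ⟨-b + c, by simpa using hc, ?_⟩
    rw [← add_mem_hexAt (b := b), add_neg_cancel_left]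
    exact hp
  · rintro ⟨c, hc, hp⟩
    exact ⟨_, hc, add_mem_hexAt.2 hp⟩

lemma exists_fill {k : ℕ} (hk : 1 ≤ k) (hk' : k ≤ 5) (a : Fin 6) {S : Set (ℤ × ℤ)} {b : ℤ × ℤ}
    (hS : ∀ c ∈ S, (3:ℤ) ∣ c.2 - c.1) (hb : (3:ℤ) ∣ b.2 - b.1) (hbS : b ∉ S)
    (H : ∀ i : Fin 6, b + hexNbr (a + i) ∈ S ↔ i.val < k) :
    ∃ h : Plane ≃ₜ Plane, h '' (hexUnion S) = hexUnion S ∪ hexAt (zpt b) ∧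
      ∀ c ∈ S, ∀ᶠ p in 𝓝 (zpt c), h p = p := by
  obtain ⟨h, hh, hc⟩ := exists_fill_zero hk hk' a.val ((b + ·) ⁻¹' S) (fun c hc => by
      have := hS _ hc
      simp only [Prod.fst_add, Prod.snd_add] at this
      omega) (by
      rw [mem_preimage]
      convert hbS
      exact add_zero b) (fun i => by
      rw [← H, show Fin.ofNat 6 a.val = a from Fin.ext (Nat.mod_eq_of_lt a.isLt), add_comm i, mem_preimage])
  refine ⟨((Homeomorph.addLeft (zpt b)).symm.trans h).trans (Homeomorph.addLeft (zpt b)), ?_, ?_⟩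
  · have : hexAt 0 = Homeomorph.addLeft (zpt b) ⁻¹' hexAt (zpt b) := by
      ext1 p
      have := add_mem_hexAt (b := b) (c := 0) (p := p)
      rw [add_zero, zpt_zero] at this
      exact this.symm
    rw [image_conj, preimage_add_hexUnion, hh, this, ← preimage_add_hexUnion, ← preimage_union,
      Homeomorph.image_preimage]
  · intro c hcS
    have : zpt c = Homeomorph.addLeft (zpt b) (zpt (-b + c)) := by
      change _ = zpt b + _
      rw [← zpt_add, add_neg_cancel_left]
    rw [this]
    exact eventually_conj (hc _ (by simpa using hcS))

lemma exists_add_conj {A T : Set Plane} (r : Plane ≃ₜ Plane) (c : ℤ × ℤ) (hr : r (zpt c) = 0)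
    (hT : r '' tri0 = T) (h : AddTri (r ⁻¹' A)) (h0 : c ≠ (0, 0)) (h1 : c ≠ (1, 0))
    (h2 : c ≠ (0, 1)) : ∃ h : Plane ≃ₜ Plane,
      h '' A = A ∪ T ∧ ∀ᶠ p in 𝓝 (0 : Plane), h p = p := by
  obtain ⟨h, hA, hc⟩ := h
  refine ⟨(r.symm.trans h).trans r, ?_, ?_⟩
  · rw [image_conj, hA, image_union, Homeomorph.image_preimage, hT]
  · rw [← hr]
    exact eventually_conj (hc c h0 h1 h2)

lemma exists_hexAt_to_square : ∃ h : Plane ≃ₜ Plane,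
    h '' hexAt 0 = Metric.closedBall 0 1 ∧ ∀ᶠ p in 𝓝 (0 : Plane), h p = p := by
  obtain ⟨f, hf, hf0⟩ := exists_add_conj (A := hexAt 0)
      (T := {p | p.1 ≤ 1 ∧ p.2 ≤ 1 ∧ 1 ≤ p.1 + p.2})
      (Homeomorph.subLeft (zpt (1, 1))) (1, 1) (by simp) (image_eq_of_iff fun p => (by
        simp only [tri0, zpt, Homeomorph.coe_subLeft, mem_ofPred_eq, Prod.fst_sub, Prod.snd_sub]
        push_cast
        constructor <;> rintro ⟨_, _, _⟩ <;> refine ⟨?_, ?_, ?_⟩ <;> linarith)) (by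
    refine addTri_of_edge (fun p a b c => ?_) (disjoint_left.2 fun p h h' => ?_)
    · simp only [hexAt, zpt, mem_preimage, Homeomorph.coe_subLeft, mem_ofPred_eq, abs_le,
        Prod.fst_sub, Prod.snd_sub, Prod.fst_zero, Prod.snd_zero]
      push_cast
      refine ⟨⟨?_, ?_⟩, ⟨?_, ?_⟩, ?_, ?_⟩ <;> linarith
    · simp only [hexAt, ohexAt, zpt, mem_preimage, Homeomorph.coe_subLeft, mem_ofPred_eq, abs_le,
        Prod.fst_sub, Prod.snd_sub, Prod.fst_zero, Prod.snd_zero, abs_lt] at h h'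
      push_cast at h'
      linarith [h.2.2.2, h'.2.2.2]) (by decide) (by decide) (by decide)
  obtain ⟨g, hg, hg0⟩ := exists_add_conj
      (A := hexAt 0 ∪ {p | p.1 ≤ 1 ∧ p.2 ≤ 1 ∧ 1 ≤ p.1 + p.2})
      (T := {p | -1 ≤ p.1 ∧ -1 ≤ p.2 ∧ p.1 + p.2 ≤ -1})
      (Homeomorph.addLeft (zpt (-1, -1))) (1, 1) (by simp [zpt]) (image_eq_of_iff fun p => (by
        simp only [tri0, zpt, Homeomorph.coe_addLeft, mem_ofPred_eq, Prod.fst_add, Prod.snd_add]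
        push_cast
        constructor <;> rintro ⟨_, _, _⟩ <;> refine ⟨?_, ?_, ?_⟩ <;> linarith)) (by
    refine addTri_of_edge (fun p a b c => Or.inl ?_) (disjoint_left.2 fun p h h' => ?_)
    · simp only [hexAt, zpt, Homeomorph.coe_addLeft, mem_ofPred_eq, abs_le,
        Prod.fst_add, Prod.snd_add, Prod.fst_zero, Prod.snd_zero]
      push_cast
      refine ⟨⟨?_, ?_⟩, ⟨?_, ?_⟩, ?_, ?_⟩ <;> linarith
    · simp only [hexAt, ohexAt, zpt, mem_preimage, Homeomorph.coe_addLeft, mem_ofPred_eq,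
        abs_le, mem_union, Prod.fst_add, Prod.snd_add, Prod.fst_zero, Prod.snd_zero, abs_lt] at h h'
      push_cast at h'
      rcases h' with h' | h'
      · linarith [h.2.2.1, h'.2.2.1]
      · linarith [h.2.2.1, h'.2.2]) (by decide) (by decide) (by decide)
  refine ⟨f.trans g, ?_, ?_⟩
  · rw [trans_image, hf, hg]
    ext1 p
    rw [mem_closedBall_zero_iff, Prod.norm_def, max_le_iff, Real.norm_eq_abs, Real.norm_eq_abs]
    simp only [hexAt, mem_ofPred_eq, abs_le, mem_union, Prod.fst_zero, Prod.snd_zero]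
    constructor
    · rintro ((⟨⟨_, _⟩, ⟨_, _⟩, _, _⟩ | ⟨_, _, _⟩) | ⟨_, _, _⟩) <;>
      refine ⟨⟨?_, ?_⟩, ?_, ?_⟩ <;> linarith
    · rintro ⟨⟨_, _⟩, _, _⟩
      rcases le_total (p.1 + p.2) 1 with h | h
      · rcases le_total (-1) (p.1 + p.2) with h' | h'
        · refine Or.inl (Or.inl ⟨⟨?_, ?_⟩, ⟨?_, ?_⟩, ?_, ?_⟩) <;> linarith
        · refine Or.inr ⟨?_, ?_, ?_⟩ <;> linarith
      · refine Or.inl (Or.inr ⟨?_, ?_, ?_⟩) <;> linarith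
  · filter_upwards [hf0, hg0] with p h1 h2
    simp [h1, h2]

/-- The center of a cell. -/
def cellCtr (c : Cell) : ℤ × ℤ := (c.1 - c.2, c.1 + 2 * c.2)

lemma cellCtr_injective : Function.Injective cellCtr := by
  rintro ⟨a, b⟩ ⟨c, d⟩ h
  simp only [cellCtr, Prod.mk.injEq] at h ⊢
  omega

lemma cellCtr_add (b c : Cell) : cellCtr (b + c) = cellCtr b + cellCtr c := by
  simp only [cellCtr, Prod.fst_add, Prod.snd_add, Prod.mk_add_mk, Prod.mk.injEq]
  constructor <;> ring

lemma cellCtr_ring6 : ∀ i, cellCtr (ring6 i) = hexNbr i := by decide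

lemma dvd_cellCtr (c : Cell) : (3:ℤ) ∣ (cellCtr c).2 - (cellCtr c).1 :=
  ⟨c.2, by simp only [cellCtr]; ring⟩

/-- The closed hexagon of a cell. -/
def cellHex (c : Cell) : Set Plane := hexAt (zpt (cellCtr c))

/-- The union of a set of cells. -/
def cellUnion (D : Set Cell) : Set Plane := ⋃ c ∈ D, cellHex c

lemma cellUnion_eq (D : Set Cell) : cellUnion D = hexUnion (cellCtr '' D) := by
  rw [cellUnion, hexUnion, biUnion_image]; rfl

lemma lh_of_eventually_id {h : Plane → Plane} {c : Plane} (H : ∀ᶠ p in 𝓝 c, h p = p) : LH h c :=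
  (lh_id c).of_eventuallyEq (by filter_upwards [H] with p hp; exact hp.symm)

lemma HexShell.exists_param {D : Finset Cell} (hD : HexShell D) : ∃ g : Plane ≃ₜ Plane, LH g 0 ∧
    g '' Metric.closedBall 0 1 = cellUnion D ∧ ∃ c ∈ D, g 0 = zpt (cellCtr c) := by
  induction hD with
  | single c =>
    obtain ⟨h, hh, h0⟩ := exists_hexAt_to_square
    have e0 : h 0 = 0 := h0.self_of_nhds
    have e1 : LH h.symm 0 := by
      have := (lh_of_eventually_id h0).symm
      rwa [e0] at this
    have e2 : h.symm 0 = 0 := by rw [Homeomorph.symm_apply_eq, e0]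
    refine ⟨h.symm.trans (Homeomorph.addLeft (zpt (cellCtr c))), ?_, ?_, c, by simp, by simp [e2]⟩
    · refine LH.comp (k := fun x => zpt (cellCtr c) + x) ?_ e1
      exact ⟨1, one_pos, 1, one_pos, fun x _ => by simp [add_assoc]⟩
    · rw [trans_image, ← hh, Homeomorph.image_symm,
        preimage_image_eq _ h.injective]
      simp only [cellUnion, Finset.coe_singleton, biUnion_singleton, cellHex]
      refine image_eq_of_iff fun p => ?_
      have := add_mem_hexAt (b := cellCtr c) (c := 0) (p := p)
      rwa [add_zero, zpt_zero] at this
  | insert D b hb hD a k hk hk' H ih =>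
    obtain ⟨g, hg, hgD, c, hc, hgc⟩ := ih
    obtain ⟨h, hh, hhc⟩ := exists_fill hk hk' a (S := cellCtr '' D) (b := cellCtr b)
      (by rintro _ ⟨x, -, rfl⟩; exact dvd_cellCtr x) (dvd_cellCtr b)
      (by rw [cellCtr_injective.mem_set_image]; exact hb) (fun i => by
        rw [← cellCtr_ring6, ← cellCtr_add, cellCtr_injective.mem_set_image]; exact H i)
    have hid := hhc _ (mem_image_of_mem _ hc)
    refine ⟨g.trans h, ?_, ?_, c, Finset.mem_insert_of_mem hc, ?_⟩
    · refine LH.comp (k := h) (h := g) (show LH h (g 0) from ?_) hg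
      rw [hgc]
      exact lh_of_eventually_id hid
    · rw [trans_image, hgD, cellUnion_eq, hh, ← cellUnion_eq, cellUnion,
        cellUnion, Finset.coe_insert, biUnion_insert, union_comm]
      rfl
    · rw [Homeomorph.trans_apply, hgc, hid.self_of_nhds]

lemma HexShell.tame {D : Finset Cell} (hD : HexShell D) : Tame (cellUnion D) := by
  obtain ⟨g, hg, hgD, -⟩ := hD.exists_param
  exact ⟨g, hg, hgD⟩

lemma norm_sub_le_of_mem_cellHex {c : Cell} {p : Plane} (hp : p ∈ cellHex c) :
    ‖p - zpt (cellCtr c)‖ ≤ 1 := by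
  rw [Prod.norm_def, max_le_iff]
  exact ⟨hp.1, hp.2.1⟩

lemma exists_mem_cellHex (p : Plane) : ∃ c, p ∈ cellHex c := by
  have key : ∀ d : ℤ × ℤ, (3:ℤ) ∣ d.2 - d.1 → p ∈ hexAt (zpt d) → ∃ c, p ∈ cellHex c := by
    rintro ⟨m, n⟩ ⟨k, hk⟩ hp
    refine ⟨(m + k, k), ?_⟩
    have : cellCtr (m + k, k) = (m, n) := by
      simp only [cellCtr, Prod.mk.injEq] at hk ⊢
      constructor <;> linarith
    rwa [cellHex, this]
  obtain ⟨x, y⟩ := p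
  have a1 := Int.floor_le x
  have a2 := Int.lt_floor_add_one x
  have b1 := Int.floor_le y
  have b2 := Int.lt_floor_add_one y
  generalize ⌊x⌋ = a at a1 a2
  generalize ⌊y⌋ = b at b1 b2
  have main : ∀ i j : ℤ, (3:ℤ) ∣ (b + j) - (a + i) →
      (((a:ℝ) + i - 1 ≤ x ∧ x ≤ a + i + 1) ∧ ((b:ℝ) + j - 1 ≤ y ∧ y ≤ b + j + 1) ∧
      ((a:ℝ) + i + b + j - 1 ≤ x + y ∧ x + y ≤ a + i + b + j + 1)) →
      ∃ c, (x, y) ∈ cellHex c := by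
    intro i j hd h
    refine key (a + i, b + j) hd ?_
    rw [mem_hexAt_zpt]
    push_cast
    obtain ⟨⟨_, _⟩, ⟨_, _⟩, _, _⟩ := h
    refine ⟨⟨?_, ?_⟩, ⟨?_, ?_⟩, ?_, ?_⟩ <;> linarith
  have hr : (b - a) % 3 = 0 ∨ (b - a) % 3 = 1 ∨ (b - a) % 3 = 2 := by omega
  rcases le_total (x + y) (a + b + 1) with h | h
  · rcases hr with hr | hr | hr
    · refine main 0 0 (by omega) ⟨⟨?_, ?_⟩, ⟨?_, ?_⟩, ?_, ?_⟩ <;> push_cast <;> linarith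
    · refine main 1 0 (by omega) ⟨⟨?_, ?_⟩, ⟨?_, ?_⟩, ?_, ?_⟩ <;> push_cast <;> linarith
    · refine main 0 1 (by omega) ⟨⟨?_, ?_⟩, ⟨?_, ?_⟩, ?_, ?_⟩ <;> push_cast <;> linarith
  · rcases hr with hr | hr | hr
    · refine main 1 1 (by omega) ⟨⟨?_, ?_⟩, ⟨?_, ?_⟩, ?_, ?_⟩ <;> push_cast <;> linarith
    · refine main 1 0 (by omega) ⟨⟨?_, ?_⟩, ⟨?_, ?_⟩, ?_, ?_⟩ <;> push_cast <;> linarith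
    · refine main 0 1 (by omega) ⟨⟨?_, ?_⟩, ⟨?_, ?_⟩, ?_, ?_⟩ <;> push_cast <;> linarith

lemma eq_or_hexAdj_of_mem_cellHex {c d : Cell} {p : Plane} (hc : p ∈ cellHex c)
    (hd : p ∈ cellHex d) : d = c ∨ HexAdj c d := by
  obtain ⟨i, rfl⟩ : ∃ i, d = c + i := ⟨d - c, by abel⟩
  rw [cellHex, mem_hexAt_zpt] at hc hd
  rw [cellCtr_add] at hd
  obtain ⟨i, j⟩ := i
  simp only [cellCtr, Prod.fst_add, Prod.snd_add] at hc hd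
  push_cast at hc hd
  obtain ⟨⟨h1, h2⟩, ⟨h3, h4⟩, h5, h6⟩ := hc
  obtain ⟨⟨k1, k2⟩, ⟨k3, k4⟩, k5, k6⟩ := hd
  have e1 : i - j ≤ 2 := by have : ((i:ℝ) - j) ≤ 2 := by linarith
                            exact_mod_cast this
  have e2 : -2 ≤ i - j := by have : -2 ≤ ((i:ℝ) - j) := by linarith
                             exact_mod_cast this
  have e3 : i + 2 * j ≤ 2 := by have : ((i:ℝ) + 2 * j) ≤ 2 := by linarith
                                exact_mod_cast this
  have e4 : -2 ≤ i + 2 * j := by have : -2 ≤ ((i:ℝ) + 2 * j) := by linarith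
                                 exact_mod_cast this
  have e5 : 2 * i + j ≤ 2 := by have : (2 * (i:ℝ) + j) ≤ 2 := by linarith
                                exact_mod_cast this
  have e6 : -2 ≤ 2 * i + j := by have : -2 ≤ (2 * (i:ℝ) + j) := by linarith
                                 exact_mod_cast this
  have hi : i = -1 ∨ i = 0 ∨ i = 1 := by omega
  have hj : j = -1 ∨ j = 0 ∨ j = 1 := by omega
  have hz : ((i, j) : Cell) = 0 ∨ ∃ k, ((i, j) : Cell) = ring6 k := by
    rcases hi with rfl | rfl | rfl <;> rcases hj with rfl | rfl | rfl <;>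
    first
      | omega
      | decide
  rcases hz with h | ⟨k, hk⟩
  · left; rw [h, add_zero]
  · right; exact ⟨k, by rw [hk]⟩

lemma finite_cellHex_meets {A : Set Plane} (hA : Bornology.IsBounded A) :
    {c | (cellHex c ∩ A).Nonempty}.Finite := by
  obtain ⟨R, hR⟩ := hA.exists_norm_le
  obtain ⟨N, hN⟩ := exists_nat_ge (R + 1)
  refine ((Set.finite_Icc (-(N:ℤ), -(N:ℤ)) ((N:ℤ), (N:ℤ))).preimage
    cellCtr_injective.injOn).subset ?_
  rintro c ⟨p, hp, hpA⟩
  have h1 := norm_sub_le_of_mem_cellHex hp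
  have h2 := hR p hpA
  have h3 : ‖zpt (cellCtr c)‖ ≤ N := by
    have := norm_sub_norm_le (zpt (cellCtr c)) p
    rw [norm_sub_rev] at this
    linarith
  rw [Prod.norm_def, max_le_iff, Real.norm_eq_abs, Real.norm_eq_abs, abs_le, abs_le] at h3
  simp only [zpt] at h3
  obtain ⟨⟨a1, a2⟩, b1, b2⟩ := h3
  refine ⟨⟨?_, ?_⟩, ?_, ?_⟩
  · exact_mod_cast a1
  · exact_mod_cast b1
  · exact_mod_cast a2
  · exact_mod_cast b2

lemma isClosed_cellHex (c : Cell) : IsClosed (cellHex c) := by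
  have h : ∀ f : Plane → ℝ, Continuous f → IsClosed {p | |f p| ≤ 1} := fun f hf =>
    isClosed_le hf.abs continuous_const
  exact (h (fun p => p.1 - (zpt (cellCtr c)).1) (by fun_prop)).inter
    ((h (fun p => p.2 - (zpt (cellCtr c)).2) (by fun_prop)).inter
      (h (fun p => p.1 + p.2 - (zpt (cellCtr c)).1 - (zpt (cellCtr c)).2) (by fun_prop)))

lemma isClosed_cellUnion (D : Set Cell) : IsClosed (cellUnion D) := by
  rw [cellUnion, biUnion_eq_iUnion]
  refine LocallyFinite.isClosed_iUnion (fun p => ?_) fun c => isClosed_cellHex _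
  refine ⟨Metric.ball p 1, Metric.ball_mem_nhds p one_pos, ?_⟩
  exact Set.Finite.preimage (f := ((↑) : D → Cell)) Subtype.val_injective.injOn
    (finite_cellHex_meets (Metric.isBounded_ball (x := p) (r := 1)))

lemma mem_cellUnion {D : Set Cell} {p : Plane} : p ∈ cellUnion D ↔ ∃ c ∈ D, p ∈ cellHex c := by
  simp [cellUnion]

/-- The cells meeting a preconnected set form a connected set of cells. -/
lemma hexConn_of_isPreconnected {C : Set Plane} (hC : IsPreconnected C) :
    HexConn {c | (cellHex c ∩ C).Nonempty} := by
  intro c hc d hd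
  set S := {c | (cellHex c ∩ C).Nonempty} with hS
  by_contra hcd
  have hcl := isPreconnected_closed_iff.1 hC (cellUnion {x | x ∈ S ∧ HexReach S c x})
    (cellUnion {x | x ∈ S ∧ ¬ HexReach S c x}) (isClosed_cellUnion _) (isClosed_cellUnion _)
    (fun p hp => by
      obtain ⟨x, hx⟩ := exists_mem_cellHex p
      by_cases h : HexReach S c x
      · exact Or.inl (mem_cellUnion.2 ⟨x, ⟨⟨p, hx, hp⟩, h⟩, hx⟩)
      · exact Or.inr (mem_cellUnion.2 ⟨x, ⟨⟨p, hx, hp⟩, h⟩, hx⟩))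
    (by obtain ⟨p, hp, hpC⟩ := hc
        exact ⟨p, hpC, mem_cellUnion.2 ⟨c, ⟨⟨p, hp, hpC⟩, .refl⟩, hp⟩⟩)
    (by obtain ⟨p, hp, hpC⟩ := hd
        exact ⟨p, hpC, mem_cellUnion.2 ⟨d, ⟨⟨p, hp, hpC⟩, hcd⟩, hp⟩⟩)
  obtain ⟨p, -, h1, h2⟩ := hcl
  obtain ⟨x, ⟨hxS, hx⟩, hpx⟩ := mem_cellUnion.1 h1
  obtain ⟨y, ⟨hyS, hy⟩, hpy⟩ := mem_cellUnion.1 h2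
  rcases eq_or_hexAdj_of_mem_cellHex hpx hpy with rfl | h
  · exact hy hx
  · exact hy (hx.tail ⟨h, hxS, hyS⟩)

lemma hexConn_univ : HexConn (univ : Set Cell) := by
  refine hexConn_of_forall_reach (0, 0) ?_
  rintro ⟨i, j⟩ -
  exact (hexReach_line_of_forall (fun n => (i, n)) (hexAdj_snd _) (fun _ => mem_univ _) j 0).trans
    (hexReach_line_of_forall (fun n => (n, 0)) (hexAdj_fst _) (fun _ => mem_univ _) i 0)

/-- The component of a cell in a set of cells. -/
def hexComp (S : Set Cell) (b : Cell) : Set Cell := {c | HexReach S b c}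

lemma HexReach.in_comp {S : Set Cell} {b x : Cell} (h : HexReach S b x) :
    HexReach (hexComp S b) b x := by
  induction h with
  | refl => exact .refl
  | tail h1 h2 ih => exact ih.tail ⟨h2.1, h1, h1.tail h2⟩

lemma hexConn_hexComp (S : Set Cell) (b : Cell) : HexConn (hexComp S b) :=
  fun _ hx _ hy => (HexReach.in_comp hx).symm.trans (HexReach.in_comp hy)

lemma hexComp_subset {S : Set Cell} {b : Cell} (hb : b ∈ S) : hexComp S b ⊆ S :=
  fun _ hx => HexReach.mem hx hb

lemma hexComp_exists_adj {S : Set Cell} {b : Cell} (hb : b ∈ S) (hS : S ≠ univ) :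
    ∃ x ∈ hexComp S b, ∃ y ∉ S, HexAdj x y := by
  obtain ⟨x, hx, y, -, hy, hxy⟩ := hexConn_univ.exists_adj (T := hexComp S b) (subset_univ _)
    ⟨b, .refl⟩ (fun h => hS (univ_subset_iff.1 (h ▸ hexComp_subset hb)))
  exact ⟨x, hx, y, fun hyS => hy (Relation.ReflTransGen.tail hx ⟨hxy, hexComp_subset hb hx, hyS⟩),
    hxy⟩

lemma hexConn_compl_hexComp {O : Set Cell} (hO : HexConn O) (hne : O.Nonempty) {b : Cell}
    (hb : b ∉ O) : HexConn (hexComp Oᶜ b)ᶜ := by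
  have hsub : O ⊆ (hexComp Oᶜ b)ᶜ := fun x hx h => hexComp_subset (S := Oᶜ) hb h hx
  obtain ⟨s, hs⟩ := hne
  refine hexConn_of_forall_reach s fun x hx => ?_
  by_cases hxO : x ∈ O
  · exact (hO x hxO s hs).mono hsub
  · obtain ⟨y, hy, z, hz, hyz⟩ := hexComp_exists_adj (S := Oᶜ) hxO
      (fun h => by have : s ∈ Oᶜ := h ▸ mem_univ s
                   exact this hs)
    rw [notMem_compl_iff] at hz
    have hcs : hexComp Oᶜ x ⊆ (hexComp Oᶜ b)ᶜ := fun w hw hwb =>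
      hx (HexReach.trans hwb (HexReach.symm hw))
    exact ((HexReach.in_comp hy).mono hcs).trans
      ((HexStep.reach ⟨hyz, hcs hy, hsub hz⟩).trans ((hO z hz s hs).mono hsub))

/-- A finite family of disjoint tame discs, each meeting `F`, with interiors covering `F`. -/
structure IsDiscCover (F : Set Plane) (𝓔 : Set (Set Plane)) : Prop where
  finite : 𝓔.Finite
  tame : ∀ E ∈ 𝓔, Tame E
  meets : ∀ E ∈ 𝓔, (E ∩ F).Nonempty
  disj : 𝓔.PairwiseDisjoint id
  cover : F ⊆ ⋃ E ∈ 𝓔, interior E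

lemma exists_discCover_aux {F C : Set Plane} (hF : IsCompact F) (hC : IsPreconnected C)
    (hd : ∀ x ∈ F, ∀ y ∈ C, 2 < ‖x - y‖) {X : ℝ} (hX : ∀ p : Plane, X ≤ p.1 → p ∈ C) :
    ∃ 𝓔, IsDiscCover F 𝓔 ∧ ∀ E ∈ 𝓔, Disjoint E C := by
  set B : Set Cell := {c | (cellHex c ∩ F).Nonempty} with hB
  set S : Set Cell := {c | (cellHex c ∩ C).Nonempty} with hS
  have hBf : B.Finite := finite_cellHex_meets hF.isBounded
  have hSc : HexConn S := hexConn_of_isPreconnected hC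
  have hSB : S ⊆ Bᶜ := by
    rintro c ⟨p, hp, hpC⟩ ⟨q, hq, hqF⟩
    have h1 := norm_sub_le_of_mem_cellHex hp
    have h2 := norm_sub_le_of_mem_cellHex hq
    have h3 := norm_sub_le_norm_sub_add_norm_sub q (zpt (cellCtr c)) p
    rw [norm_sub_rev p] at h1
    linarith [hd q hqF p hpC]
  have hfar : ∀ i : ℤ, X ≤ i → ((i, 0) : Cell) ∈ S := fun i hi => by
    refine ⟨zpt (cellCtr (i, 0)), ?_, hX _ ?_⟩
    · simp [cellHex, hexAt]
    · simpa [zpt, cellCtr] using hi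
  have hs := hfar ⌈X⌉ (Int.le_ceil X)
  set s : Cell := (⌈X⌉, 0)
  set O := hexComp Bᶜ s with hO
  have hOB : O ⊆ Bᶜ := hexComp_subset (hSB hs)
  have hSO : S ⊆ O := fun c hc => (hSc s hs c hc).mono hSB
  have hOfin : Oᶜ.Finite := by
    obtain ⟨N, hN⟩ : ∃ N : ℤ, B ⊆ hexBox N := by
      refine ⟨∑ c ∈ hBf.toFinset, (|c.1| + |c.2|), fun c hc => ?_⟩
      have := Finset.single_le_sum (f := fun c : Cell => |c.1| + |c.2|)
        (fun _ _ => by positivity) (hBf.mem_toFinset.2 hc)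
      have h1 := abs_nonneg c.1
      have h2 := abs_nonneg c.2
      rw [Finset.mem_coe, mem_hexBox, ← abs_le, ← abs_le]
      constructor <;> linarith
    refine (hexBox N).finite_toSet.subset fun c hc => ?_
    by_contra hcN
    have h1 : ((max (N + 1) ⌈X⌉, 0) : Cell) ∈ S :=
      hfar _ ((Int.le_ceil X).trans (by exact_mod_cast le_max_right _ _))
    have h2 : ((max (N + 1) ⌈X⌉, 0) : Cell) ∈ (hexBox N : Set Cell)ᶜ := by
      rw [mem_compl_iff, Finset.mem_coe, mem_hexBox]
      simp only
      omega
    exact hc (HexReach.trans (hSO h1)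
      ((hexConn_compl_hexBox N _ h2 c hcN).mono (compl_subset_compl.2 hN)))
  have hBO : B ⊆ Oᶜ := fun b hb h => hOB h hb
  have hOu : Oᶜ ≠ univ := fun h => by
    have : s ∈ Oᶜ := h ▸ mem_univ s
    exact this (hSO hs)
  have heq : ∀ b c x y p, x ∈ hexComp Oᶜ b → y ∈ hexComp Oᶜ c → b ∈ Oᶜ → c ∈ Oᶜ →
      p ∈ cellHex x → p ∈ cellHex y → hexComp Oᶜ b = hexComp Oᶜ c := by
    intro b c x y p hx hy hb hc hpx hpy
    have hxy : HexReach Oᶜ x y := by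
      rcases eq_or_hexAdj_of_mem_cellHex hpx hpy with rfl | h
      · exact .refl
      · exact HexStep.reach ⟨h, hexComp_subset hb hx, hexComp_subset hc hy⟩
    have hbc : HexReach Oᶜ b c := (HexReach.trans hx hxy).trans (HexReach.symm hy)
    ext z
    exact ⟨fun h => hbc.symm.trans h, fun h => hbc.trans h⟩
  refine ⟨(fun b => cellUnion (hexComp Oᶜ b)) '' B, ⟨hBf.image _, ?_, ?_, ?_, ?_⟩, ?_⟩
  · rintro _ ⟨b, hb, rfl⟩
    have hfin := hOfin.subset (hexComp_subset (hBO hb))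
    have := hexShell_of_hexConn (D := hfin.toFinset) ⟨b, hfin.mem_toFinset.2 .refl⟩
      (by rw [hfin.coe_toFinset]; exact hexConn_hexComp _ _)
      (by rw [hfin.coe_toFinset]
          exact hexConn_compl_hexComp (hexConn_hexComp _ _) ⟨s, hSO hs⟩ (hBO hb))
    simpa using this.tame
  · rintro _ ⟨b, hb, rfl⟩
    obtain ⟨p, hp, hpF⟩ := hb
    exact ⟨p, mem_cellUnion.2 ⟨b, .refl, hp⟩, hpF⟩
  · rintro _ ⟨b, hb, rfl⟩ _ ⟨c, hc, rfl⟩ hne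
    refine disjoint_left.2 fun p hp hp' => hne ?_
    obtain ⟨x, hx, hpx⟩ := mem_cellUnion.1 hp
    obtain ⟨y, hy, hpy⟩ := mem_cellUnion.1 hp'
    simp only [heq b c x y p hx hy (hBO hb) (hBO hc) hpx hpy]
  · intro p hp
    obtain ⟨b, hb⟩ := exists_mem_cellHex p
    have hbB : b ∈ B := ⟨p, hb, hp⟩
    refine mem_biUnion (mem_image_of_mem _ hbB) ?_
    refine mem_interior.2 ⟨(cellUnion (hexComp Oᶜ b)ᶜ)ᶜ, fun q hq => ?_,
      (isClosed_cellUnion _).isOpen_compl, fun h => ?_⟩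
    · obtain ⟨c, hc⟩ := exists_mem_cellHex q
      refine mem_cellUnion.2 ⟨c, ?_, hc⟩
      by_contra h
      exact hq (mem_cellUnion.2 ⟨c, h, hc⟩)
    · obtain ⟨c, hc, hpc⟩ := mem_cellUnion.1 h
      have hcB : c ∈ B := ⟨p, hpc, hp⟩
      refine hc ?_
      rw [heq b c b c p .refl .refl (hBO hbB) (hBO hcB) hb hpc]
      exact Relation.ReflTransGen.refl
  · rintro _ ⟨b, hb, rfl⟩
    refine disjoint_left.2 fun p hp hpC => ?_
    obtain ⟨x, hx, hpx⟩ := mem_cellUnion.1 hp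
    exact hexComp_subset (hBO hb) hx (hSO ⟨p, hpx, hpC⟩)

lemma exists_connected_superset {O K : Set Plane} (hO : IsOpen O) (hOc : IsConnected O)
    (hK : IsCompact K) (hKO : K ⊆ O) {p : Plane} (hp : p ∈ O) :
    ∃ K', IsCompact K' ∧ IsPreconnected K' ∧ K ⊆ K' ∧ K' ⊆ O ∧ p ∈ K' := by
  refine hK.induction_on (p := fun s => ∃ K', IsCompact K' ∧ IsPreconnected K' ∧ s ⊆ K' ∧ K' ⊆ O ∧
    p ∈ K') ?_ ?_ ?_ ?_
  · exact ⟨{p}, isCompact_singleton, isPreconnected_singleton, empty_subset _, by simpa using hp,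
      rfl⟩
  · rintro s t hst ⟨K', h1, h2, h3, h4⟩
    exact ⟨K', h1, h2, hst.trans h3, h4⟩
  · rintro s t ⟨K, h1, h2, h3, h4, h5⟩ ⟨K', h1', h2', h3', h4', h5'⟩
    exact ⟨K ∪ K', h1.union h1', h2.union p h5 h5' h2', union_subset_union h3 h3',
      union_subset h4 h4', Or.inl h5⟩
  · intro x hx
    obtain ⟨γ, hγ⟩ := ((hO.isConnected_iff_isPathConnected.1 hOc).joinedIn x (hKO hx) p hp)
    obtain ⟨r, hr, hrO⟩ := Metric.nhds_basis_closedBall.mem_iff.1 (hO.mem_nhds (hKO hx))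
    refine ⟨Metric.closedBall x r, mem_nhdsWithin_of_mem_nhds (Metric.closedBall_mem_nhds x hr),
      Metric.closedBall x r ∪ range γ, (isCompact_closedBall x r).union (isCompact_range γ.continuous),
      ?_, subset_union_left, union_subset hrO (range_subset_iff.2 hγ), Or.inr ⟨1, γ.target⟩⟩
    exact (convex_closedBall x r).isPreconnected.union x (Metric.mem_closedBall_self hr.le)
      ⟨0, γ.source⟩ (isPreconnected_range γ.continuous)

lemma IsDiscCover.image {F : Set Plane} {𝓔 : Set (Set Plane)} (h : IsDiscCover F 𝓔) (f : Plane ≃ₜ Plane)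
    (hf : ∀ c, LH f c) : IsDiscCover (f '' F) ((fun E => f '' E) '' 𝓔) := by
  refine ⟨h.finite.image _, ?_, ?_, ?_, ?_⟩
  · rintro _ ⟨E, hE, rfl⟩
    obtain ⟨g, hg, hgE⟩ := h.tame E hE
    exact Tame.image hg hgE (hf _)
  · rintro _ ⟨E, hE, rfl⟩
    rw [← image_inter f.injective]
    exact (h.meets E hE).image _
  · rintro _ ⟨E, hE, rfl⟩ _ ⟨E', hE', rfl⟩ hne
    exact (disjoint_image_iff f.injective).2 (h.disj hE hE' fun e => hne (by rw [e]))
  · rintro _ ⟨p, hp, rfl⟩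
    obtain ⟨E, hE, hpE⟩ := mem_iUnion₂.1 (h.cover hp)
    refine mem_biUnion (mem_image_of_mem _ hE) ?_
    rw [← f.image_interior]
    exact mem_image_of_mem _ hpE

/-- A compact set with connected complement is covered by disjoint tame discs avoiding a given
compact subset of the complement. -/
lemma exists_discCover {F K : Set Plane} (hF : IsCompact F) (hFc : IsConnected Fᶜ)
    (hK : IsCompact K) (hKF : Disjoint K F) :
    ∃ 𝓔, IsDiscCover F 𝓔 ∧ ∀ E ∈ 𝓔, Disjoint E K := by
  obtain ⟨R, hR⟩ := hF.isBounded.exists_norm_le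
  have hXF : ∀ q : Plane, R + 1 ≤ q.1 → ∀ x ∈ F, 1 ≤ ‖x - q‖ := fun q hq x hx => by
    have h1 := (abs_le.1 ((le_max_left _ _).trans (Prod.norm_def x ▸ hR x hx))).2
    have h2 : |x.1 - q.1| ≤ ‖x - q‖ := le_max_left _ _
    rw [abs_sub_comm] at h2
    linarith [le_abs_self (q.1 - x.1)]
  have hp : ((R + 1, 0) : Plane) ∈ Fᶜ := fun h => by
    have := hXF (R + 1, 0) le_rfl _ h
    rw [sub_self, norm_zero] at this
    linarith
  obtain ⟨K', hK', hK'c, hKK', hK'F, hpK'⟩ :=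
    exists_connected_superset hF.isClosed.isOpen_compl hFc hK hKF.subset_compl_right hp
  obtain ⟨δ, hδ, hδ'⟩ : ∃ δ > 0, ∀ x ∈ F, ∀ y ∈ K', δ ≤ ‖x - y‖ := by
    obtain ⟨r, hr, h⟩ := (disjoint_left.2 fun x hx hx' => hK'F hx' hx :
      Disjoint F K').exists_thickenings hF hK'.isClosed
    refine ⟨r, hr, fun x hx y hy => ?_⟩
    by_contra hlt
    rw [not_le, ← dist_eq_norm] at hlt
    exact disjoint_left.1 h (Metric.mem_thickening_iff.2 ⟨x, hx, by simpa using hr⟩)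
      (Metric.mem_thickening_iff.2 ⟨y, hy, hlt⟩)
  set C : Set Plane := K' ∪ {q | R + 1 ≤ q.1} with hC
  have hCc : IsPreconnected C := by
    refine hK'c.union (R + 1, 0) hpK' (le_refl (R + 1)) (Convex.isPreconnected ?_)
    exact convex_halfSpace_ge (LinearMap.fst ℝ ℝ ℝ).isLinear (R + 1)
  set ε := min δ 1 with hε
  have hε0 : 0 < ε := lt_min hδ one_pos
  have hCF : ∀ x ∈ F, ∀ y ∈ C, ε ≤ ‖x - y‖ := by
    rintro x hx y (hy | hy)
    · exact (min_le_left _ _).trans (hδ' x hx y hy)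
    · exact (min_le_right _ _).trans (hXF y hy x hx)
  have hr : (0:ℝ) < 3 / ε := by positivity
  set f := homothetyHomeo 0 (3 / ε) hr with hf
  have hfa : ∀ x, f x = (3 / ε) • x := fun x => by simp [hf]
  obtain ⟨𝓔, h𝓔, h𝓔C⟩ := exists_discCover_aux (F := f '' F) (C := f '' C) (X := (3 / ε) * (R + 1))
    (hF.image f.continuous) (hCc.image _ f.continuous.continuousOn) (by
      rintro _ ⟨x, hx, rfl⟩ _ ⟨y, hy, rfl⟩
      rw [hfa, hfa, ← smul_sub, norm_smul, Real.norm_of_nonneg hr.le]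
      have := mul_le_mul_of_nonneg_left (hCF x hx y hy) hr.le
      rw [div_mul_cancel₀ _ hε0.ne'] at this
      linarith) (by
      intro p hp
      refine ⟨f.symm p, Or.inr ?_, f.apply_symm_apply p⟩
      have : p.1 = (3 / ε) * (f.symm p).1 := by
        conv_lhs => rw [← f.apply_symm_apply p, hfa]
        rfl
      rw [this] at hp
      exact le_of_mul_le_mul_left hp hr)
  have hfs : ∀ c, LH f.symm c := fun c => by
    have := (homothetyHomeo_lh 0 hr (f.symm c)).symm
    rwa [← hf, f.apply_symm_apply] at this
  refine ⟨(fun E => f.symm '' E) '' 𝓔, ?_, ?_⟩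
  · have := h𝓔.image f.symm hfs
    rwa [image_image, show (fun x => f.symm (f x)) = id from funext f.symm_apply_apply,
      image_id] at this
  · rintro _ ⟨E, hE, rfl⟩
    refine disjoint_left.2 ?_
    rintro _ ⟨x, hx, rfl⟩ hxK
    exact disjoint_left.1 (h𝓔C E hE) hx ⟨_, Or.inl (hKK' hxK), f.apply_symm_apply x⟩

/-- Existence of a continuous square root. -/
def HasSqrt {X : Type*} [TopologicalSpace X] (f : X → ℂ) : Prop :=
  ∃ s : X → ℂ, Continuous s ∧ ∀ x, s x ^ 2 = f x

/-- The parametrization of the unit sphere of the plane by angles. -/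
def circ (t : ℝ) : Metric.sphere (0 : Plane) 1 :=
  ⟨‖((Real.cos t, Real.sin t) : Plane)‖⁻¹ • (Real.cos t, Real.sin t), by
    have : ((Real.cos t, Real.sin t) : Plane) ≠ 0 := fun h => by
      have h1 := Real.cos_sq_add_sin_sq t
      rw [Prod.mk_eq_zero] at h
      simp [h.1, h.2] at h1
    rw [mem_sphere_zero_iff_norm, norm_smul, norm_inv, norm_norm,
      inv_mul_cancel₀ (norm_ne_zero_iff.2 this)]⟩

lemma cos_sin_ne_zero (t : ℝ) : ((Real.cos t, Real.sin t) : Plane) ≠ 0 := fun h => by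
  have h1 := Real.cos_sq_add_sin_sq t
  rw [Prod.mk_eq_zero] at h
  simp [h.1, h.2] at h1

lemma continuous_circ : Continuous circ := by
  have h : Continuous fun t : ℝ => ((Real.cos t, Real.sin t) : Plane) := by fun_prop
  exact ((h.norm.inv₀ fun t => norm_ne_zero_iff.2 (cos_sin_ne_zero t)).smul h).subtype_mk _

lemma circ_add_two_pi (t : ℝ) : circ (t + 2 * Real.pi) = circ t := by
  simp [circ]

lemma circ_arg (p : Metric.sphere (0 : Plane) 1) :
    circ (Complex.arg ⟨p.1.1, p.1.2⟩) = p := by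
  have hp : ‖p.1‖ = 1 := by simp
  have hp0 : p.1 ≠ 0 := by
    intro h
    rw [h, norm_zero] at hp
    exact zero_ne_one hp
  have hz : (⟨p.1.1, p.1.2⟩ : ℂ) ≠ 0 := fun h => hp0 (by
    rw [Complex.ext_iff] at h
    exact Prod.ext h.1 h.2)
  have hn : 0 < ‖(⟨p.1.1, p.1.2⟩ : ℂ)‖ := norm_pos_iff.2 hz
  have e : ((Real.cos (Complex.arg ⟨p.1.1, p.1.2⟩), Real.sin (Complex.arg ⟨p.1.1, p.1.2⟩)) : Plane) =
      ‖(⟨p.1.1, p.1.2⟩ : ℂ)‖⁻¹ • p.1 := by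
    rw [Complex.cos_arg hz, Complex.sin_arg]
    ext <;> simp [div_eq_inv_mul]
  apply Subtype.ext
  simp only [circ]
  rw [e, norm_smul, hp, norm_inv, norm_norm, mul_one, inv_inv, smul_smul, mul_inv_cancel₀ hn.ne',
    one_smul]

lemma sign_of_sq_eq {X : Type*} [TopologicalSpace X] [PreconnectedSpace X] {f g : X → ℂ}
    (hf : Continuous f) (hg : Continuous g) (hg0 : ∀ x, g x ≠ 0) (h : ∀ x, f x ^ 2 = g x ^ 2) :
    (∀ x, f x = g x) ∨ ∀ x, f x = - g x := by
  have := isPreconnected_univ.eq_or_eq_neg_of_sq_eq (S := univ) hf.continuousOn hg.continuousOn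
    (fun x _ => h x) (fun _ => hg0 _)
  exact this.imp (fun h x => h (mem_univ x)) fun h x => h (mem_univ x)

lemma exists_sqrt_lift {f : AnnulusModel → ℂ} (hf : Continuous f) (hf0 : ∀ x, f x ≠ 0) :
    ∃ h : ℝ × ℝ → ℂ, Continuous h ∧
      (∀ t r, h (t, r) ^ 2 = f (circ t, projIcc 0 1 zero_le_one r)) ∧
      ((∀ t r, h (t + 2 * Real.pi, r) = h (t, r)) ∨
        ∀ t r, h (t + 2 * Real.pi, r) = - h (t, r)) := by
  let F : C(ℝ × ℝ, ℂ) := ⟨fun x => f (circ x.1, projIcc 0 1 zero_le_one x.2),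
    hf.comp ((continuous_circ.comp continuous_fst).prodMk (continuous_projIcc.comp continuous_snd))⟩
  obtain ⟨z, hz⟩ := IsSquare.exists_sq (F (0, 0)) (IsAlgClosed.exists_pow_nat_eq (F (0,0)) two_pos |>.elim
    fun z hz => ⟨z, by rw [← hz, sq]⟩)
  obtain ⟨h, ⟨-, hh⟩, -⟩ := (isCoveringMapOn_npow (𝕜 := ℂ) 2 (by norm_num)).existsUnique_continuousMap_lifts
    F (a₀ := (0, 0)) (e₀ := z) hz.symm (fun a => hf0 _)
  have hsq : ∀ x, h x ^ 2 = F x := fun x => congrFun hh x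
  refine ⟨h, h.continuous, fun t r => hsq (t, r), ?_⟩
  have := sign_of_sq_eq (f := fun x : ℝ × ℝ => h (x.1 + 2 * Real.pi, x.2)) (g := h) (by fun_prop)
    h.continuous (fun x hx => hf0 (circ x.1, projIcc 0 1 zero_le_one x.2) (by
      have := hsq x
      rw [hx] at this
      simpa [F] using this.symm)) (fun x => by
      rw [hsq, hsq]
      simp only [F, ContinuousMap.coe_mk, circ_add_two_pi])
  exact this.imp (fun h t r => h (t, r)) fun h t r => h (t, r)

lemma hasSqrt_of_lift {f : AnnulusModel → ℂ} {h : ℝ × ℝ → ℂ} (hc : Continuous h)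
    (hf : ∀ t r, h (t, r) ^ 2 = f (circ t, projIcc 0 1 zero_le_one r))
    (hp : ∀ t r, h (t + 2 * Real.pi, r) = h (t, r)) : HasSqrt f := by
  have hper : ∀ r, Function.Periodic (fun t => h (t, r)) (2 * Real.pi) := fun r t => hp t r
  let H : Real.Angle × ℝ → ℂ := fun x => (hper x.2).lift x.1
  have hH : Continuous H := by
    have hq : IsQuotientMap (Prod.map ((↑) : ℝ → Real.Angle) (id : ℝ → ℝ)) :=
      (QuotientAddGroup.isOpenQuotientMap_mk.prodMap .id).isQuotientMap
    rw [hq.continuous_iff]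
    exact hc
  refine ⟨fun x => H ((Complex.arg ⟨x.1.1.1, x.1.1.2⟩ : ℝ), x.2.1), ?_, fun x => ?_⟩
  · refine hH.comp (Continuous.prodMk ?_ (by fun_prop))
    have h1 : Continuous fun x : AnnulusModel => (⟨x.1.1.1, x.1.1.2⟩ : ℂ) := by
      have : Continuous fun x : AnnulusModel => ((x.1.1.1 : ℂ) + x.1.1.2 * Complex.I) := by fun_prop
      convert this using 2
      apply Complex.ext <;> simp
    refine continuous_iff_continuousAt.2 fun x => ?_
    refine ContinuousAt.comp (f := fun x : AnnulusModel => (⟨x.1.1.1, x.1.1.2⟩ : ℂ))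
      (g := fun z => ((Complex.arg z : ℝ) : Real.Angle))
      (Complex.continuousAt_arg_coe_angle fun h0 => ?_) h1.continuousAt
    have hn : ‖x.1.1‖ = 1 := by simp
    rw [Complex.ext_iff] at h0
    rw [show x.1.1 = 0 from Prod.ext h0.1 h0.2, norm_zero] at hn
    exact zero_ne_one hn
  · change h (_, _) ^ 2 = _
    rw [hf, circ_arg, projIcc_val]

lemma hasSqrt_annulus {f g : AnnulusModel → ℂ} (hf : Continuous f) (hg : Continuous g)
    (hf0 : ∀ x, f x ≠ 0) (hg0 : ∀ x, g x ≠ 0) :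
    HasSqrt f ∨ HasSqrt g ∨ HasSqrt fun x => f x * g x := by
  obtain ⟨h, hc, hh, h1 | h1⟩ := exists_sqrt_lift hf hf0
  · exact Or.inl (hasSqrt_of_lift hc hh h1)
  obtain ⟨k, kc, hk, k1 | k1⟩ := exists_sqrt_lift hg hg0
  · exact Or.inr (Or.inl (hasSqrt_of_lift kc hk k1))
  refine Or.inr (Or.inr (hasSqrt_of_lift (hc.mul kc) (fun t r => ?_) fun t r => ?_))
  · simp only [Pi.mul_apply]
    rw [mul_pow, hh, hk]
  · simp only [Pi.mul_apply]
    rw [h1, k1, neg_mul_neg]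

lemma not_sqrt_circle {s v : ℝ → ℂ} (hs : Continuous s) (hv : Continuous v) (hv0 : ∀ t, v t ≠ 0)
    (hs1 : s (2 * Real.pi) = s 0) (hv1 : v (2 * Real.pi) = v 0)
    (h : ∀ t : ℝ, s t ^ 2 = Complex.exp (t * Complex.I) * v t ^ 2) : False := by
  have := sign_of_sq_eq (f := s) (g := fun t => Complex.exp (t / 2 * Complex.I) * v t) hs
    (by fun_prop) (fun t => mul_ne_zero (Complex.exp_ne_zero _) (hv0 t)) (fun t => by
      rw [h, mul_pow, ← Complex.exp_nat_mul]
      congr 2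
      push_cast
      ring)
  have e : Complex.exp (((2 * Real.pi : ℝ) : ℂ) / 2 * Complex.I) = -1 := by
    rw [← Complex.exp_pi_mul_I]
    congr 1
    push_cast
    ring
  rcases this with this | this
  · have h0 := this 0
    have h1 := this (2 * Real.pi)
    rw [hs1, hv1, e, h0] at h1
    simp only [Complex.ofReal_zero, zero_div, zero_mul, Complex.exp_zero, one_mul, neg_mul] at h1
    exact hv0 0 (self_eq_neg.1 h1)
  · have h0 := this 0
    have h1 := this (2 * Real.pi)
    rw [hs1, hv1, e, h0] at h1
    simp only [Complex.ofReal_zero, zero_div, zero_mul, Complex.exp_zero, one_mul, neg_mul,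
      neg_neg] at h1
    exact hv0 0 (self_eq_neg.1 h1.symm)

/-- The circle of radius `3/2` around one of the holes of the model pair of pants. -/
lemma mem_pantsModel_circle {ε : ℝ} (hε : ε = 1 ∨ ε = -1) (t : ℝ) :
    ((2 * ε + 3 / 2 * Real.cos t, 3 / 2 * Real.sin t) : Plane) ∈ PantsModel := by
  have hcs := Real.cos_sq_add_sin_sq t
  have hc := abs_le.1 (Real.abs_cos_le_one t)
  have hs := abs_le.1 (Real.abs_sin_le_one t)
  have hmax : (1:ℝ) ≤ max |3 / 2 * Real.cos t| |3 / 2 * Real.sin t| := by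
    by_contra hlt
    rw [not_le, max_lt_iff] at hlt
    have h1 := sq_lt_one_iff_abs_lt_one _ |>.2 hlt.1
    have h2 := sq_lt_one_iff_abs_lt_one _ |>.2 hlt.2
    nlinarith
  have hbig : (1:ℝ) ≤ max |4 + 3 / 2 * Real.cos t| |3 / 2 * Real.sin t| := by
    refine le_max_of_le_left ?_
    rw [le_abs]; left; linarith [hc.1]
  have hbig' : (1:ℝ) ≤ max |-4 + 3 / 2 * Real.cos t| |3 / 2 * Real.sin t| := by
    refine le_max_of_le_left ?_
    rw [le_abs]; right; linarith [hc.2]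
  simp only [PantsModel, Set.mem_sdiff, mem_union, Metric.mem_closedBall, Metric.mem_ball, not_or,
    not_lt, dist_eq_norm, Prod.norm_def, Prod.fst_sub, Prod.snd_sub, Real.norm_eq_abs, sub_zero]
  rcases hε with rfl | rfl
  · refine ⟨max_le (abs_le.2 ⟨?_, ?_⟩) (abs_le.2 ⟨?_, ?_⟩), ?_, ?_⟩ <;> try linarith
    · rwa [show 2 * 1 + 3 / 2 * Real.cos t - 2 = 3 / 2 * Real.cos t by ring]
    · rwa [show 2 * 1 + 3 / 2 * Real.cos t - -2 = 4 + 3 / 2 * Real.cos t by ring]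
  · refine ⟨max_le (abs_le.2 ⟨?_, ?_⟩) (abs_le.2 ⟨?_, ?_⟩), ?_, ?_⟩ <;> try linarith
    · rwa [show 2 * -1 + 3 / 2 * Real.cos t - 2 = -4 + 3 / 2 * Real.cos t by ring]
    · rwa [show 2 * -1 + 3 / 2 * Real.cos t - -2 = 3 / 2 * Real.cos t by ring]

/-- A pair of pants is not an annulus. -/
lemma IsPairOfPants.not_isAnnulus {A : Set Plane} (hA : IsPairOfPants A) : ¬ IsAnnulus A := by
  rintro ⟨e⟩
  obtain ⟨e'⟩ := hA
  let k : AnnulusModel ≃ₜ PantsModel := e.symm.trans e'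
  let f : ℝ → PantsModel → ℂ := fun ε x => ((x.1.1 - 2 * ε : ℝ) : ℂ) + (x.1.2 : ℝ) * Complex.I
  have hf : ∀ ε, Continuous (f ε) := fun ε => by fun_prop
  have hf0 : ∀ ε : ℝ, (ε = 1 ∨ ε = -1) → ∀ x, f ε x ≠ 0 := by
    intro ε hε x hx
    have h1 := congrArg Complex.re hx
    have h2 := congrArg Complex.im hx
    simp [f] at h1 h2
    have hx2 := x.2
    simp only [PantsModel, Set.mem_sdiff, mem_union, not_or] at hx2
    rcases hε with rfl | rfl
    · refine hx2.2.1 ?_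
      rw [show x.1 = (2, 0) from Prod.ext (by simp only; linarith) h2]
      exact Metric.mem_ball_self one_pos
    · refine hx2.2.2 ?_
      rw [show x.1 = (-2, 0) from Prod.ext (by simp only; linarith) h2]
      exact Metric.mem_ball_self one_pos
  let γ : ∀ ε : ℝ, (ε = 1 ∨ ε = -1) → ℝ → PantsModel := fun ε hε t => ⟨_, mem_pantsModel_circle hε t⟩
  have hγ : ∀ ε hε, Continuous (γ ε hε) := fun ε hε => Continuous.subtype_mk (by fun_prop) _
  have hγ1 : ∀ ε hε, γ ε hε (2 * Real.pi) = γ ε hε 0 := fun ε hε => by simp [γ]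
  have hfγ : ∀ ε hε t, f ε (γ ε hε t) = Complex.exp (t * Complex.I) * (3 / 2) := by
    intro ε hε t
    rw [Complex.exp_mul_I, ← Complex.ofReal_cos, ← Complex.ofReal_sin]
    simp only [f, γ]
    push_cast
    ring
  have h3 : ∃ w : ℂ, w ^ 2 = 3 / 2 := IsAlgClosed.exists_pow_nat_eq _ two_pos
  obtain ⟨w, hw⟩ := h3
  have hw0 : w ≠ 0 := by rintro rfl; norm_num at hw
  have hno : ∀ ε : ℝ, (ε = 1 ∨ ε = -1) → ¬ HasSqrt (f ε ∘ k) := by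
    rintro ε hε ⟨s, hs, hsf⟩
    refine not_sqrt_circle (s := fun t => s (k.symm (γ ε hε t))) (v := fun _ => w)
      (hs.comp (k.symm.continuous.comp (hγ ε hε))) continuous_const (fun _ => hw0)
      (by simp only [hγ1]) rfl fun t => ?_
    simp only [hsf, Function.comp_apply, k.apply_symm_apply, hfγ, hw]
  rcases hasSqrt_annulus (f := f 1 ∘ k) (g := f (-1) ∘ k) ((hf _).comp k.continuous)
    ((hf _).comp k.continuous) (fun x => hf0 _ (Or.inl rfl) _) (fun x => hf0 _ (Or.inr rfl) _)
    with h | h | ⟨s, hs, hsf⟩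
  · exact hno 1 (Or.inl rfl) h
  · exact hno (-1) (Or.inr rfl) h
  · have hre : ∀ t : ℝ, 0 < (4 + Complex.exp (t * Complex.I) * (3 / 2)).re := fun t => by
      have : (Complex.exp (t * Complex.I) * (3 / 2)).re = Real.cos t * (3 / 2) := by
        rw [show (3 / 2 : ℂ) = ((3 / 2 : ℝ) : ℂ) by push_cast; rfl, Complex.re_mul_ofReal,
          Complex.exp_ofReal_mul_I_re]
      rw [Complex.add_re, this]
      have := Real.neg_one_le_cos t
      norm_num
      linarith
    let v : ℝ → ℂ := fun t => w * (4 + Complex.exp (t * Complex.I) * (3 / 2)) ^ (1 / 2 : ℂ)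
    have hne : ∀ t : ℝ, (4 + Complex.exp (t * Complex.I) * (3 / 2)) ≠ 0 := fun t h => by
      have := hre t
      rw [h] at this
      exact lt_irrefl _ this
    refine not_sqrt_circle (s := fun t => s (k.symm (γ 1 (Or.inl rfl) t))) (v := v)
      (hs.comp (k.symm.continuous.comp (hγ 1 (Or.inl rfl)))) ?_ (fun t => mul_ne_zero hw0 ?_)
      (by simp only [hγ1 1 (Or.inl rfl)]) ?_ fun t => ?_
    · refine continuous_const.mul (Continuous.cpow (by fun_prop) continuous_const fun t => ?_)
      exact Or.inl (hre t)
    · rw [Complex.cpow_ne_zero_iff]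
      exact Or.inl (hne t)
    · simp only [v]
      congr 4
      push_cast
      rw [Complex.exp_two_pi_mul_I]
      simp
    · have e2 : f (-1) (γ 1 (Or.inl rfl) t) = 4 + Complex.exp (t * Complex.I) * (3 / 2) := by
        rw [← hfγ 1 (Or.inl rfl) t]
        simp only [f]
        push_cast
        ring
      simp only [hsf, Function.comp_apply, k.apply_symm_apply, hfγ, e2, v, mul_pow, hw]
      rw [← Complex.cpow_nat_mul]
      norm_num
      ring

/-- A tame disc can be shrunk without uncovering a given compact subset of its interior. -/
lemma Tame.exists_shrink {E K : Set Plane} (hE : Tame E) (hK : IsCompact K)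
    (hKE : K ⊆ interior E) : ∃ E', Tame E' ∧ K ⊆ interior E' ∧ E' ⊆ interior E := by
  obtain ⟨g, hg, rfl⟩ := hE
  rw [image_closedBall_interior] at hKE
  have hK' : IsCompact (g ⁻¹' K) := g.isCompact_preimage.2 hK
  have hKb : g ⁻¹' K ⊆ Metric.ball 0 1 := fun x hx => by
    obtain ⟨y, hy, hyx⟩ := hKE hx
    rwa [← g.injective hyx]
  obtain ⟨r, hr0, hr1, hr⟩ : ∃ r : ℝ, 0 < r ∧ r < 1 ∧ g ⁻¹' K ⊆ Metric.ball 0 r := by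
    rcases (g ⁻¹' K).eq_empty_or_nonempty with h | h
    · exact ⟨1 / 2, by norm_num, by norm_num, by simp [h]⟩
    · obtain ⟨z, hz, hmax⟩ := hK'.exists_isMaxOn h continuous_norm.continuousOn
      have hz1 : ‖z‖ < 1 := by simpa using hKb hz
      obtain ⟨r, h1, h2⟩ := exists_between hz1
      exact ⟨r, (norm_nonneg _).trans_lt h1, h2, fun x hx => by
        simpa using (hmax hx : ‖x‖ ≤ ‖z‖).trans_lt h1⟩
  have him : ∀ A : Set Plane, ((homothetyHomeo 0 r hr0).trans g) '' A =
      g '' (homothetyHomeo 0 r hr0 '' A) := trans_image _ _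
  refine ⟨_, ⟨(homothetyHomeo 0 r hr0).trans g, ?_, rfl⟩, ?_, ?_⟩
  · refine LH.comp (h := homothetyHomeo 0 r hr0) (k := g) ?_ (homothetyHomeo_lh 0 hr0 0)
    simpa using hg
  · rw [image_closedBall_interior, him, homothetyHomeo_ball]
    intro x hx
    refine ⟨g.symm x, ?_, g.apply_symm_apply x⟩
    simpa using hr (show g.symm x ∈ g ⁻¹' K by simpa using hx)
  · rw [image_closedBall_interior, him, homothetyHomeo_closedBall]
    refine image_mono fun x hx => ?_
    simp only [Metric.mem_closedBall] at hx
    exact hx.trans_lt hr1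

/-- Every disc of `𝓖` lies in the interior of a disc of `𝓔`. -/
def Refines (𝓖 𝓔 : Set (Set Plane)) : Prop := ∀ G ∈ 𝓖, ∃ E ∈ 𝓔, G ⊆ interior E

/-- A refinement of disc covers which increases the number of discs by exactly one. -/
structure IsSimpleStep (F : Set Plane) (𝓔 𝓖 : Set (Set Plane)) : Prop where
  left : IsDiscCover F 𝓔
  right : IsDiscCover F 𝓖
  refines : Refines 𝓖 𝓔
  ncard : 𝓖.ncard = 𝓔.ncard + 1

namespace IsDiscCover

lemma eq_of_mem {F : Set Plane} {𝓔 : Set (Set Plane)} (h : IsDiscCover F 𝓔) {E E' : Set Plane}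
    (hE : E ∈ 𝓔) (hE' : E' ∈ 𝓔) {x : Plane} (hx : x ∈ E) (hx' : x ∈ E') : E = E' := by
  by_contra hne
  exact disjoint_left.1 (h.disj hE hE' hne) hx hx'

lemma exists_child {F : Set Plane} {𝓔 𝓖 : Set (Set Plane)} (h : IsDiscCover F 𝓔)
    (h' : IsDiscCover F 𝓖) (hr : Refines 𝓖 𝓔) {E : Set Plane} (hE : E ∈ 𝓔) :
    ∃ G ∈ 𝓖, G ⊆ interior E := by
  obtain ⟨x, hxE, hxF⟩ := h.meets E hE
  obtain ⟨G, hG, hxG⟩ := mem_iUnion₂.1 (h'.cover hxF)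
  obtain ⟨E', hE', hGE⟩ := hr G hG
  have := h.eq_of_mem hE hE' hxE (interior_subset (hGE (interior_subset hxG)))
  exact ⟨G, hG, this ▸ hGE⟩

lemma exists_interpolation {F : Set Plane} {𝓔 𝓖 : Set (Set Plane)} (h : IsDiscCover F 𝓔)
    (h' : IsDiscCover F 𝓖) (hr : Refines 𝓖 𝓔) (hc : 𝓔.ncard < 𝓖.ncard) :
    ∃ 𝓔', IsSimpleStep F 𝓔 𝓔' ∧ Refines 𝓖 𝓔' := by
  classical
  choose! c hcE hcs using hr
  obtain ⟨G₁, hG₁, G₂, hG₂, hne, heq⟩ :=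
    exists_ne_map_eq_of_ncard_lt_of_maps_to hc (f := c) hcE h.finite
  have hne' : ∀ G ∈ 𝓖, G.Nonempty := fun G hG => (h'.meets G hG).mono inter_subset_left
  set E := c G₁ with hEdef
  have hE : E ∈ 𝓔 := hcE _ hG₁
  have hfin : (𝓖 ∩ {G | c G = E ∧ G ≠ G₁}).Finite := h'.finite.inter_of_left _
  obtain ⟨D', D'', tD', tD'', hD', hD'', hdD, hG₁D, hsD⟩ :=
    (h.tame E hE).exists_split (hfin.toFinset) ⟨G₂, by simp [hG₂, heq.symm, hne.symm]⟩ id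
      (fun i hi => h'.tame i (hfin.mem_toFinset.1 hi).1)
      (fun i hi => by
        have := hfin.mem_toFinset.1 hi
        have h2 := hcs i this.1
        rw [this.2.1] at h2
        exact h2)
      (fun i hi j hj hij => h'.disj (hfin.mem_toFinset.1 hi).1 (hfin.mem_toFinset.1 hj).1 hij)
      (h'.tame _ hG₁) (hcs _ hG₁)
      (fun i hi => h'.disj hG₁ (hfin.mem_toFinset.1 hi).1 (hfin.mem_toFinset.1 hi).2.2.symm)
  have hsh : ∀ E' ∈ 𝓔, ∃ S, Tame S ∧ (∀ G ∈ 𝓖, c G = E' → G ⊆ interior S) ∧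
      S ⊆ interior E' := by
    intro E' hE'
    have hfin' : (𝓖 ∩ {G | c G = E'}).Finite := h'.finite.inter_of_left _
    obtain ⟨S, tS, h1, h2⟩ := (h.tame E' hE').exists_shrink
      (hfin'.isCompact_biUnion (f := id) fun G hG => (h'.tame G hG.1).isCompact)
      (iUnion₂_subset fun G hG => by
        have := hcs G hG.1
        rw [hG.2] at this
        exact this)
    exact ⟨S, tS, fun G hG hGE => (subset_biUnion_of_mem (u := id) (show G ∈ 𝓖 ∩ {G | c G = E'}
      from ⟨hG, hGE⟩)).trans h1, h2⟩
  choose! S tS hS hSE using hsh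
  have hchild : ∀ E' ∈ 𝓔, ∃ G ∈ 𝓖, c G = E' := by
    intro E' hE'
    obtain ⟨G, hG, hGE⟩ := h.exists_child h' (fun G hG => ⟨c G, hcE G hG, hcs G hG⟩) hE'
    obtain ⟨x, hx⟩ := hne' G hG
    exact ⟨G, hG, h.eq_of_mem (hcE G hG) hE' (interior_subset (hcs G hG hx))
      (interior_subset (hGE hx))⟩
  have hSne : ∀ E' ∈ 𝓔, (S E' ∩ F).Nonempty := by
    intro E' hE'
    obtain ⟨G, hG, hGE⟩ := hchild E' hE'
    exact (h'.meets G hG).mono (inter_subset_inter_left _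
      ((hS E' hE' G hG hGE).trans interior_subset))
  have hG₂D : G₂ ⊆ interior D'' := hsD G₂ (by simp [hG₂, heq.symm, hne.symm])
  have hD'ne : (D' ∩ F).Nonempty := (h'.meets G₁ hG₁).mono
    (inter_subset_inter_left _ (hG₁D.trans interior_subset))
  have hD''ne : (D'' ∩ F).Nonempty := (h'.meets G₂ hG₂).mono
    (inter_subset_inter_left _ (hG₂D.trans interior_subset))
  have hDS : ∀ D, D ⊆ interior E → ∀ E' ∈ 𝓔 \ {E}, Disjoint D (S E') := fun D hD E' hE' =>
    (h.disj hE hE'.1 fun h => hE'.2 h.symm).mono (hD.trans interior_subset)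
      ((hSE E' hE'.1).trans interior_subset)
  have hDnot : ∀ D, D ⊆ interior E → D.Nonempty → D ∉ S '' (𝓔 \ {E}) := by
    rintro D hD hDne ⟨E', hE', rfl⟩
    exact hDne.ne_empty (disjoint_self.1 (hDS _ hD E' hE'))
  have hSd : ∀ E₁ ∈ 𝓔, ∀ E₂ ∈ 𝓔, E₁ ≠ E₂ → Disjoint (S E₁) (S E₂) := fun E₁ h₁ E₂ h₂ hn =>
    (h.disj h₁ h₂ hn).mono ((hSE E₁ h₁).trans interior_subset) ((hSE E₂ h₂).trans interior_subset)
  have hSi : InjOn S (𝓔 \ {E}) := by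
    intro E₁ h₁ E₂ h₂ he
    by_contra hn
    have := hSd E₁ h₁.1 E₂ h₂.1 hn
    rw [he] at this
    exact ((hSne E₂ h₂.1).mono inter_subset_left).ne_empty (disjoint_self.1 this)
  have hfS : (S '' (𝓔 \ {E})).Finite := h.finite.sdiff.image _
  have href : Refines 𝓖 (insert D' (insert D'' (S '' (𝓔 \ {E})))) := by
    intro G hG
    by_cases hGE : c G = E
    · by_cases hG1 : G = G₁
      · exact ⟨D', mem_insert _ _, hG1 ▸ hG₁D⟩
      · exact ⟨D'', by simp, hsD G (hfin.mem_toFinset.2 ⟨hG, hGE, hG1⟩)⟩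
    · exact ⟨S (c G), mem_insert_of_mem _ (mem_insert_of_mem _
        ⟨c G, ⟨hcE G hG, hGE⟩, rfl⟩), hS _ (hcE G hG) G hG rfl⟩
  have hD'n : D' ∉ insert D'' (S '' (𝓔 \ {E})) := by
    rw [mem_insert_iff, not_or]
    refine ⟨fun he => ?_, hDnot D' hD' (hD'ne.mono inter_subset_left)⟩
    rw [he] at hdD
    exact (hD''ne.mono inter_subset_left).ne_empty (disjoint_self.1 hdD)
  refine ⟨insert D' (insert D'' (S '' (𝓔 \ {E}))), ⟨h, ⟨(hfS.insert _).insert _, ?_, ?_, ?_, ?_⟩,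
    ?_, ?_⟩, href⟩
  · rintro _ (rfl | rfl | ⟨E', hE', rfl⟩)
    exacts [tD', tD'', tS E' hE'.1]
  · rintro _ (rfl | rfl | ⟨E', hE', rfl⟩)
    exacts [hD'ne, hD''ne, hSne E' hE'.1]
  · have hsym : Std.Symm (Function.onFun Disjoint (id : Set Plane → Set Plane)) :=
      ⟨fun a b hab => Disjoint.symm hab⟩
    refine (PairwiseDisjoint.insert (PairwiseDisjoint.insert ?_ ?_) ?_)
    · rintro _ ⟨E₁, h₁, rfl⟩ _ ⟨E₂, h₂, rfl⟩ hn
      exact hSd E₁ h₁.1 E₂ h₂.1 fun he => hn (he ▸ rfl)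
    · rintro _ ⟨E₁, h₁, rfl⟩ -
      exact hDS D'' hD'' E₁ h₁
    · rintro _ (rfl | ⟨E₁, h₁, rfl⟩) -
      · exact hdD
      · exact hDS D' hD' E₁ h₁
  · intro x hx
    obtain ⟨G, hG, hxG⟩ := mem_iUnion₂.1 (h'.cover hx)
    obtain ⟨E', hE', hGE⟩ := href G hG
    exact mem_iUnion₂.2 ⟨E', hE', hGE (interior_subset hxG)⟩
  · rintro _ (rfl | rfl | ⟨E', hE', rfl⟩)
    exacts [⟨E, hE, hD'⟩, ⟨E, hE, hD''⟩, ⟨E', hE'.1, hSE E' hE'.1⟩]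
  · rw [ncard_insert_of_notMem hD'n (hfS.insert _), ncard_insert_of_notMem
      (hDnot D'' hD'' (hD''ne.mono inter_subset_left)) hfS, hSi.ncard_image,
      ncard_sdiff_singleton_of_mem hE]
    have : 0 < 𝓔.ncard := (ncard_pos h.finite).2 ⟨E, hE⟩
    omega

lemma transGen_of_refines {F : Set Plane} {𝓖 : Set (Set Plane)} (h' : IsDiscCover F 𝓖) (n : ℕ) :
    ∀ {𝓔 : Set (Set Plane)}, IsDiscCover F 𝓔 → Refines 𝓖 𝓔 → 𝓖.ncard = 𝓔.ncard + 1 + n →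
      Relation.TransGen (IsSimpleStep F) 𝓔 𝓖 := by
  induction n with
  | zero => exact fun h hr hc => .single ⟨h, h', hr, hc⟩
  | succ n ih =>
    intro 𝓔 h hr hc
    obtain ⟨𝓔', hs, hr'⟩ := h.exists_interpolation h' hr (by omega)
    exact .head hs (ih hs.right hr' (by rw [hs.ncard]; omega))

lemma frontier_disjoint {F : Set Plane} {𝓔 : Set (Set Plane)} (h : IsDiscCover F 𝓔)
    {E : Set Plane} (hE : E ∈ 𝓔) : Disjoint (frontier E) F := by
  refine disjoint_left.2 fun x hx hxF => ?_
  obtain ⟨E', hE', hxE'⟩ := mem_iUnion₂.1 (h.cover hxF)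
  have := h.eq_of_mem hE hE' ((h.tame E hE).isClosed.frontier_subset hx) (interior_subset hxE')
  subst this
  exact hx.2 hxE'

lemma refines_of_disjoint {F : Set Plane} {𝓔 𝓖 : Set (Set Plane)} (h : IsDiscCover F 𝓔)
    (h' : IsDiscCover F 𝓖) (hd : ∀ G ∈ 𝓖, Disjoint G (⋃ E ∈ 𝓔, frontier E)) : Refines 𝓖 𝓔 := by
  intro G hG
  obtain ⟨x, hxG, hxF⟩ := h'.meets G hG
  obtain ⟨E, hE, hxE⟩ := mem_iUnion₂.1 (h.cover hxF)
  refine ⟨E, hE, ((h'.tame G hG).isConnected.isPreconnected).subset_left_of_subset_union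
    isOpen_interior (h.tame E hE).isClosed.isOpen_compl
    (disjoint_left.2 fun y hy hy' => hy' (interior_subset hy)) (fun y hy => ?_) ⟨x, hxG, hxE⟩⟩
  by_contra hn
  rw [mem_union, not_or, notMem_compl_iff] at hn
  exact disjoint_left.1 (hd G hG) hy (mem_iUnion₂.2 ⟨E, hE, subset_closure hn.2, hn.1⟩)

end IsDiscCover

/-- If every state can be improved to satisfy each of a sequence of persistent requirements, then
some infinite run satisfies all of them. -/
lemma exists_run {α : Type*} {R : α → α → Prop} {Q : ℕ → α → Prop}
    (hmono : ∀ k a b, R a b → Q k a → Q k b)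
    (hstep : ∀ k a, ∃ b, Relation.TransGen R a b ∧ Q k b) (a₀ : α) :
    ∃ f : ℕ → α, f 0 = a₀ ∧ (∀ n, R (f n) (f (n + 1))) ∧ ∀ k, ∃ n, Q k (f n) := by
  classical
  let T : ℕ → ℕ → α → Prop := fun k n =>
    Nat.rec (Q k) (fun _ P a => ∃ b, R a b ∧ P b) n
  have hT : ∀ k a, ∃ n, T k n a := by
    intro k a
    obtain ⟨b, hab, hb⟩ := hstep k a
    induction hab using Relation.TransGen.head_induction_on with
    | single h => exact ⟨1, b, h, hb⟩
    | head h _ ih =>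
      obtain ⟨n, hn⟩ := ih
      exact ⟨n + 1, _, h, hn⟩
  let d : ℕ → α → ℕ := fun k a => @Nat.find (fun n => T k n a) (Classical.decPred _) (hT k a)
  have hd : ∀ k a, ¬ Q k a → ∃ b, R a b ∧ d k b < d k a := by
    intro k a hQ
    have hs : T k (d k a) a :=
      @Nat.find_spec (fun n => T k n a) (Classical.decPred _) (hT k a)
    rcases hda : d k a with _ | m
    · rw [hda] at hs
      exact absurd hs hQ
    · rw [hda] at hs
      obtain ⟨b, hb, hbT⟩ := hs
      exact ⟨b, hb, Nat.lt_succ_of_le (@Nat.find_min' (fun n => T k n b) (Classical.decPred _) (hT k b) _ hbT)⟩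
  have hnext : ∀ a, ∃ b, R a b ∧
      ∀ k, (∀ j < k, Q j a) → ¬ Q k a → d k b < d k a := by
    intro a
    by_cases hex : ∃ k, ¬ Q k a
    · obtain ⟨b, hb, hlt⟩ := hd _ a (Nat.find_spec hex)
      refine ⟨b, hb, fun k hk hQ => ?_⟩
      have : Nat.find hex = k := (Nat.find_eq_iff hex).2 ⟨hQ, fun j hj => not_not.2 (hk j hj)⟩
      rwa [this] at hlt
    · obtain ⟨b, hab, -⟩ := hstep 0 a
      obtain ⟨c, hc, -⟩ := Relation.TransGen.head'_iff.1 hab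
      exact ⟨c, hc, fun k _ hQ => absurd ⟨k, hQ⟩ hex⟩
  choose nx hR hdec using hnext
  refine ⟨fun n => nx^[n] a₀, rfl, fun n => ?_, ?_⟩
  · change R (nx^[n] a₀) (nx^[n + 1] a₀)
    rw [Function.iterate_succ_apply']
    exact hR _
  have hup : ∀ k n m, Q k (nx^[n] a₀) → Q k (nx^[n + m] a₀) := by
    intro k n m hn
    induction m with
    | zero => exact hn
    | succ m ih =>
      rw [← add_assoc, Function.iterate_succ_apply']
      exact hmono _ _ _ (hR _) ih
  intro k
  induction k using Nat.strong_induction_on with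
  | _ k ih =>
    choose! N hN using ih
    let M := (Finset.range k).sup N
    have hM : ∀ m, ∀ j < k, Q j (nx^[M + m] a₀) := by
      intro m j hj
      have : N j ≤ M := Finset.le_sup (f := N) (Finset.mem_range.2 hj)
      have := hup j (N j) (M - N j + m) (hN j hj)
      rwa [show N j + (M - N j + m) = M + m by omega] at this
    have key : ∀ e m, d k (nx^[M + m] a₀) ≤ e → ∃ n, Q k (nx^[n] a₀) := by
      intro e
      induction e with
      | zero =>
        intro m hm
        by_contra hno
        obtain ⟨b, -, hb⟩ := hd k (nx^[M + m] a₀) fun hq => hno ⟨_, hq⟩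
        omega
      | succ e ihe =>
        intro m hm
        by_contra hno
        have := hdec _ k (hM m) fun hq => hno ⟨_, hq⟩
        rw [← Function.iterate_succ_apply' nx] at this
        exact hno (ihe (m + 1) (by rw [← add_assoc]; exact Nat.le_of_lt_succ (this.trans_le hm)))
    exact key _ 0 le_rfl

/-- A sequence of simple refinements whose discs avoid every member of a given sequence of
compact sets from some index on. -/
lemma exists_simple_sequence {F : Set Plane} (hF : IsCompact F) (hFc : IsConnected Fᶜ)
    {K : ℕ → Set Plane} (hK : ∀ k, IsCompact (K k)) (hKF : ∀ k, Disjoint (K k) F)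
    (hunb : ∀ m : ℕ, ∃ L, IsCompact L ∧ Disjoint L F ∧
      ∀ 𝓔, IsDiscCover F 𝓔 → (∀ E ∈ 𝓔, Disjoint E L) → m < 𝓔.ncard)
    {𝓔₀ : Set (Set Plane)} (h₀ : IsDiscCover F 𝓔₀) :
    ∃ f : ℕ → Set (Set Plane), f 0 = 𝓔₀ ∧ (∀ n, IsSimpleStep F (f n) (f (n + 1))) ∧
      ∀ k, ∃ n, ∀ E ∈ f n, Disjoint E (K k) := by
  obtain ⟨f, hf0, hfs, hfQ⟩ := exists_run (α := {𝓔 // IsDiscCover F 𝓔})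
    (R := fun a b => IsSimpleStep F a.1 b.1) (Q := fun k a => ∀ E ∈ a.1, Disjoint E (K k))
    (fun k a b hab hQ E hE => by
      obtain ⟨E', hE', hs⟩ := hab.refines E hE
      exact (hQ E' hE').mono_left (hs.trans interior_subset))
    (fun k a => by
      obtain ⟨L, hL, hLF, hLm⟩ := hunb a.1.ncard
      obtain ⟨𝓖, h𝓖, hd⟩ := exists_discCover hF hFc
        (((hK k).union hL).union (a.2.finite.isCompact_biUnion fun E hE =>
          (a.2.tame E hE).isCompact.of_isClosed_subset isClosed_frontier
            (a.2.tame E hE).isClosed.frontier_subset))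
        (disjoint_union_left.2 ⟨disjoint_union_left.2 ⟨hKF k, hLF⟩,
          disjoint_iUnion₂_left.2 fun E hE => a.2.frontier_disjoint hE⟩)
      have hd1 : ∀ E ∈ 𝓖, Disjoint E (K k) := fun E hE =>
        (hd E hE).mono_right (subset_union_left.trans subset_union_left)
      have hc := hLm 𝓖 h𝓖 fun E hE =>
        (hd E hE).mono_right (subset_union_right.trans subset_union_left)
      have hr := a.2.refines_of_disjoint h𝓖 fun E hE => (hd E hE).mono_right subset_union_right
      have ht := h𝓖.transGen_of_refines (𝓖.ncard - a.1.ncard - 1) a.2 hr (by omega)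
      refine ⟨⟨𝓖, h𝓖⟩, ?_, hd1⟩
      have : ∀ {x y : Set (Set Plane)}, Relation.TransGen (IsSimpleStep F) x y →
          ∀ (hx : IsDiscCover F x) (hy : IsDiscCover F y),
          Relation.TransGen (fun a b : {𝓔 // IsDiscCover F 𝓔} => IsSimpleStep F a.1 b.1)
            ⟨x, hx⟩ ⟨y, hy⟩ := by
        intro x y hxy
        induction hxy with
        | single h => exact fun _ _ => .single h
        | tail _ h ih => exact fun hx hy => .tail (ih hx h.left) h
      exact this ht a.2 h𝓖) ⟨𝓔₀, h₀⟩
  exact ⟨fun n => (f n).1, congrArg Subtype.val hf0, hfs, hfQ⟩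

/-- Inversion in the unit sphere, fixing the origin. -/
def invert (x : Plane) : Plane := (‖x‖ ^ 2)⁻¹ • x

@[simp] lemma invert_zero : invert 0 = 0 := by simp [invert]

lemma norm_invert (x : Plane) : ‖invert x‖ = ‖x‖⁻¹ := by
  rcases eq_or_ne x 0 with rfl | hx
  · simp
  · have : ‖x‖ ≠ 0 := norm_ne_zero_iff.2 hx
    rw [invert, norm_smul, norm_inv, norm_pow, norm_norm]
    field_simp

@[simp] lemma invert_invert (x : Plane) : invert (invert x) = x := by
  rcases eq_or_ne x 0 with rfl | hx
  · simp
  · have : ‖x‖ ≠ 0 := norm_ne_zero_iff.2 hx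
    rw [invert, norm_invert, invert, smul_smul, inv_pow, inv_inv, mul_inv_cancel₀ (pow_ne_zero 2 this),
      one_smul]

@[simp] lemma invert_eq_zero {x : Plane} : invert x = 0 ↔ x = 0 :=
  ⟨fun h => by rw [← invert_invert x, h, invert_zero], fun h => by rw [h, invert_zero]⟩

lemma continuousOn_invert : ContinuousOn invert {0}ᶜ := by
  have h : ContinuousOn (fun x : Plane => ‖x‖ ^ 2) {0}ᶜ := by fun_prop
  exact (h.inv₀ fun x hx => pow_ne_zero 2 (norm_ne_zero_iff.2 hx)).smul continuousOn_id

lemma continuousAt_invert {x : Plane} (hx : x ≠ 0) : ContinuousAt invert x :=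
  continuousOn_invert.continuousAt (isOpen_compl_singleton.mem_nhds hx)

lemma image_invert (A : Set Plane) : invert '' A = invert ⁻¹' A :=
  congrFun (image_eq_preimage_of_inverse invert_invert invert_invert) A

lemma subset_compl_zero {A : Set Plane} (h0 : (0 : Plane) ∉ A) : A ⊆ {0}ᶜ :=
  fun x hx hx0 => h0 (by rwa [← mem_singleton_iff.1 hx0])

lemma isOpen_invert_preimage {A : Set Plane} (hA : IsOpen A) (h0 : (0 : Plane) ∉ A) :
    IsOpen (invert ⁻¹' A) := by
  have := continuousOn_invert.isOpen_inter_preimage isOpen_compl_singleton hA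
  rwa [inter_eq_self_of_subset_right] at this
  exact subset_compl_zero (by simpa using h0)

lemma isCompact_invert_preimage {A : Set Plane} (hA : IsCompact A) (h0 : (0 : Plane) ∉ A) :
    IsCompact (invert ⁻¹' A) := by
  rw [← image_invert]
  exact hA.image_of_continuousOn (continuousOn_invert.mono (subset_compl_zero h0))

lemma isPreconnected_invert_preimage {A : Set Plane} (hA : IsPreconnected A) (h0 : (0 : Plane) ∉ A) :
    IsPreconnected (invert ⁻¹' A) := by
  rw [← image_invert]
  exact hA.image _ (continuousOn_invert.mono (subset_compl_zero h0))

lemma interior_invert_preimage {A : Set Plane} (h0 : (0 : Plane) ∉ A) :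
    interior (invert ⁻¹' A) = invert ⁻¹' interior A := by
  have key : ∀ B : Set Plane, (0 : Plane) ∉ B → invert ⁻¹' interior B ⊆ interior (invert ⁻¹' B) :=
    fun B hB => interior_maximal (preimage_mono interior_subset)
      (isOpen_invert_preimage isOpen_interior fun h => hB (interior_subset h))
  refine Subset.antisymm ?_ (key A h0)
  intro x hx
  have := @key (invert ⁻¹' A) (by simpa using h0) (invert x) (by simpa using hx)
  simpa [← preimage_comp, Function.comp_def] using this

lemma frontier_invert_preimage {A : Set Plane} (hA : IsCompact A) (h0 : (0 : Plane) ∉ A) :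
    frontier (invert ⁻¹' A) = invert ⁻¹' frontier A := by
  rw [(isCompact_invert_preimage hA h0).isClosed.frontier_eq, hA.isClosed.frontier_eq,
    interior_invert_preimage h0, preimage_sdiff]

lemma isOpen_invert_compl {K : Set Plane} (hK : IsCompact K) :
    IsOpen {x | x = 0 ∨ invert x ∉ K} := by
  rw [isOpen_iff_mem_nhds]
  intro x hx
  rcases eq_or_ne x 0 with rfl | hx0
  · obtain ⟨R, hR⟩ := hK.isBounded.exists_norm_le
    refine Filter.mem_of_superset (Metric.ball_mem_nhds 0 (ε := (max R 1)⁻¹) (by positivity))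
      fun y hy => ?_
    rcases eq_or_ne y 0 with h | h
    · exact Or.inl h
    · right
      intro hyK
      have h1 := (hR _ hyK).trans (le_max_left R 1)
      rw [norm_invert] at h1
      rw [mem_ball_zero_iff] at hy
      have h2 := (inv_le_comm₀ (norm_pos_iff.2 h) (by positivity)).1 h1
      linarith
  · have h1 : invert x ∉ K := hx.resolve_left hx0
    filter_upwards [(continuousAt_invert hx0).preimage_mem_nhds (hK.isClosed.isOpen_compl.mem_nhds h1)]
      with y hy using Or.inr hy

lemma isCompact_invert_compl {U : Set Plane} (hU : IsOpen U) (h0 : (0 : Plane) ∈ U) :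
    IsCompact {x | x = 0 ∨ invert x ∉ U} := by
  refine Metric.isCompact_of_isClosed_isBounded ⟨?_⟩ ?_
  · have : {x | x = 0 ∨ invert x ∉ U}ᶜ = invert ⁻¹' (U \ {0}) := by
      ext1 x
      simp [mem_compl_iff, and_comm]
    rw [this]
    exact isOpen_invert_preimage (hU.sdiff isClosed_singleton) (by simp)
  · obtain ⟨ε, hε, hb⟩ := Metric.isOpen_iff.1 hU 0 h0
    refine (Metric.isBounded_closedBall (x := (0 : Plane)) (r := ε⁻¹)).subset fun x hx => ?_
    rw [mem_closedBall_zero_iff]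
    rcases eq_or_ne x 0 with rfl | hx0
    · simp [hε.le]
    · have h1 : ε ≤ ‖invert x‖ := by
        by_contra hlt
        exact hx.resolve_left hx0 (hb (by simpa using hlt))
      rw [norm_invert] at h1
      exact (le_inv_comm₀ hε (norm_pos_iff.2 hx0)).1 h1

/-- Inversion restricted to a set missing the origin. -/
def invertHomeo (A : Set Plane) (h0 : (0 : Plane) ∉ A) : A ≃ₜ (invert ⁻¹' A : Set Plane) where
  toFun x := ⟨invert x, by simp⟩
  invFun x := ⟨invert x, x.2⟩
  left_inv x := by simp
  right_inv x := by simp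
  continuous_toFun := (continuousOn_iff_continuous_domRestrict.1
    (continuousOn_invert.mono (subset_compl_zero h0))).subtype_mk _
  continuous_invFun := (continuousOn_iff_continuous_domRestrict.1
    (continuousOn_invert.mono (subset_compl_zero (by simpa using h0)))).subtype_mk _

lemma connectedComponentIn_biUnion {X ι : Type*} [TopologicalSpace X] {s : Set ι} (hs : s.Finite)
    {A : ι → Set X} (hc : ∀ i ∈ s, IsClosed (A i)) (hp : ∀ i ∈ s, IsPreconnected (A i))
    (hd : s.PairwiseDisjoint A) {i : ι} (hi : i ∈ s) {x : X} (hx : x ∈ A i) :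
    connectedComponentIn (⋃ j ∈ s, A j) x = A i := by
  have hxs : x ∈ ⋃ j ∈ s, A j := mem_biUnion hi hx
  refine Subset.antisymm ?_ ((hp i hi).subset_connectedComponentIn hx (subset_biUnion_of_mem hi))
  have hcl : IsClosed (⋃ j ∈ s \ {i}, A j) := hs.sdiff.isClosed_biUnion fun j hj => hc j hj.1
  have hdis : Disjoint (A i) (⋃ j ∈ s \ {i}, A j) :=
    disjoint_iUnion₂_right.2 fun j hj => hd hi hj.1 fun h => hj.2 h.symm
  have hcov : connectedComponentIn (⋃ j ∈ s, A j) x ⊆ A i ∪ ⋃ j ∈ s \ {i}, A j := by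
    refine (connectedComponentIn_subset _ _).trans (iUnion₂_subset fun j hj => ?_)
    by_cases h : j = i
    · exact h ▸ subset_union_left
    · exact (subset_biUnion_of_mem (u := A) (show j ∈ s \ {i} from ⟨hj, h⟩)).trans
        subset_union_right
  rcases isPreconnected_iff_subset_of_disjoint_closed.1 isPreconnected_connectedComponentIn
    (A i) _ (hc i hi) hcl hcov (by rw [hdis.inter_eq, inter_empty]) with h | h
  · exact h
  · exact absurd (h (mem_connectedComponentIn hxs)) (disjoint_left.1 hdis hx)

/-- The complement of the interiors of the discs, seen through inversion. -/
def outside (𝓔 : Set (Set Plane)) : Set Plane := {x | x = 0 ∨ invert x ∉ ⋃ E ∈ 𝓔, interior E}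

/-- The discs of `𝓖` lying in the interior of `E`. -/
def children (𝓖 : Set (Set Plane)) (E : Set Plane) : Set (Set Plane) := {G ∈ 𝓖 | G ⊆ interior E}

/-- The part of `E` outside the discs of `𝓖`. -/
def piece (𝓖 : Set (Set Plane)) (E : Set Plane) : Set Plane :=
  E \ ⋃ G ∈ children 𝓖 E, interior G

namespace IsDiscCover

lemma isCompact_biUnion {F : Set Plane} {𝓔 : Set (Set Plane)} (h : IsDiscCover F 𝓔) :
    IsCompact (⋃ E ∈ 𝓔, E) := h.finite.isCompact_biUnion fun E hE => (h.tame E hE).isCompact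

lemma isCompact_outside {F : Set Plane} {𝓔 : Set (Set Plane)} (h : IsDiscCover F 𝓔)
    (h0 : (0 : Plane) ∈ F) : IsCompact (outside 𝓔) :=
  isCompact_invert_compl (isOpen_biUnion fun _ _ => isOpen_interior) (h.cover h0)

lemma interior_outside {F : Set Plane} {𝓔 : Set (Set Plane)} (h : IsDiscCover F 𝓔) :
    interior (outside 𝓔) = {x | x = 0 ∨ invert x ∉ ⋃ E ∈ 𝓔, E} := by
  refine Subset.antisymm (fun x hx => ?_) (interior_maximal ?_ (isOpen_invert_compl
    h.isCompact_biUnion))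
  · refine or_iff_not_imp_left.2 fun hx0 hxE => ?_
    obtain ⟨E, hE, hxE⟩ := mem_iUnion₂.1 hxE
    have hO : IsOpen (invert ⁻¹' (interior (outside 𝓔) \ {0})) :=
      isOpen_invert_preimage (isOpen_interior.sdiff isClosed_singleton) (by simp)
    rw [← (h.tame E hE).closure_interior] at hxE
    obtain ⟨y, ⟨hy, hy0⟩, hyE⟩ := mem_closure_iff.1 hxE _ hO (by simpa using ⟨hx, hx0⟩)
    rcases interior_subset hy with h1 | h1
    · exact hy0 h1
    · rw [invert_invert] at h1
      exact h1 (mem_biUnion hE hyE)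
  · exact fun x hx => hx.imp id fun h1 h2 =>
      h1 (iUnion₂_mono (fun E _ => interior_subset) h2)

lemma zero_notMem_frontier {F : Set Plane} {𝓔 : Set (Set Plane)} (h : IsDiscCover F 𝓔)
    (h0 : (0 : Plane) ∈ F) {E : Set Plane} (hE : E ∈ 𝓔) : (0 : Plane) ∉ frontier E :=
  fun h1 => disjoint_left.1 (h.frontier_disjoint hE) h1 h0

lemma frontier_outside {F : Set Plane} {𝓔 : Set (Set Plane)} (h : IsDiscCover F 𝓔)
    (h0 : (0 : Plane) ∈ F) :
    frontier (outside 𝓔) = invert ⁻¹' ⋃ E ∈ 𝓔, frontier E := by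
  rw [(h.isCompact_outside h0).isClosed.frontier_eq, h.interior_outside]
  ext1 x
  simp only [outside, Set.mem_sdiff, mem_ofPred_eq, not_or, not_not, mem_preimage, mem_iUnion₂,
    exists_prop]
  constructor
  · rintro ⟨h1, hx0, E, hE, hxE⟩
    exact ⟨E, hE, subset_closure hxE, fun h2 => h1.resolve_left hx0 ⟨E, hE, h2⟩⟩
  · rintro ⟨E, hE, hx⟩
    have hxE := (h.tame E hE).isClosed.frontier_subset hx
    refine ⟨Or.inr ?_, ?_, E, hE, hxE⟩
    · rintro ⟨E', hE', hxE'⟩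
      have := h.eq_of_mem hE hE' hxE (interior_subset hxE')
      subst this
      exact hx.2 hxE'
    · rintro rfl
      rw [invert_zero] at hx
      exact h.zero_notMem_frontier h0 hE hx

lemma outside_subset {Sg : Set Plane} {𝓔 : Set (Set Plane)} (hz : (0 : Plane) ∈ Sg)
    (h : IsDiscCover {y | y = 0 ∨ invert y ∉ Sg} 𝓔) : outside 𝓔 ⊆ Sg := by
  rintro x (rfl | hx)
  · exact hz
  · by_contra hxS
    exact hx (h.cover (Or.inr (by rwa [invert_invert])))

end IsDiscCover

namespace IsSimpleStep

variable {F : Set Plane} {𝓔 𝓖 : Set (Set Plane)}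

lemma outside_subset_interior (h : IsSimpleStep F 𝓔 𝓖) : outside 𝓔 ⊆ interior (outside 𝓖) := by
  rw [h.right.interior_outside]
  rintro x (rfl | hx)
  · exact Or.inl rfl
  · refine Or.inr fun hx' => hx ?_
    obtain ⟨G, hG, hxG⟩ := mem_iUnion₂.1 hx'
    obtain ⟨E, hE, hGE⟩ := h.refines G hG
    exact mem_biUnion hE (hGE hxG)

lemma mem_children (h : IsSimpleStep F 𝓔 𝓖) {E G : Set Plane} (hE : E ∈ 𝓔) (hG : G ∈ 𝓖)
    {x : Plane} (hxE : x ∈ E) (hxG : x ∈ G) : G ∈ children 𝓖 E := by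
  obtain ⟨E', hE', hGE⟩ := h.refines G hG
  have := h.left.eq_of_mem hE hE' hxE (interior_subset (hGE hxG))
  subst this
  exact ⟨hG, hGE⟩

lemma finite_children (h : IsSimpleStep F 𝓔 𝓖) (E : Set Plane) : (children 𝓖 E).Finite :=
  h.right.finite.subset fun _ hG => hG.1

lemma mem_piece (h : IsSimpleStep F 𝓔 𝓖) {E : Set Plane} (hE : E ∈ 𝓔) {x : Plane} :
    x ∈ piece 𝓖 E ↔ x ∈ E ∧ x ∉ ⋃ G ∈ 𝓖, interior G := by
  refine and_congr_right fun hxE => not_congr ?_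
  simp only [mem_iUnion₂]
  exact ⟨fun ⟨G, hG, hx⟩ => ⟨G, hG.1, hx⟩,
    fun ⟨G, hG, hx⟩ => ⟨G, h.mem_children hE hG hxE (interior_subset hx), hx⟩⟩

lemma zero_notMem_piece (h : IsSimpleStep F 𝓔 𝓖) (h0 : (0 : Plane) ∈ F) {E : Set Plane}
    (hE : E ∈ 𝓔) : (0 : Plane) ∉ piece 𝓖 E := fun h1 =>
  ((h.mem_piece hE).1 h1).2 (h.right.cover h0)

lemma outside_diff (h : IsSimpleStep F 𝓔 𝓖) (h0 : (0 : Plane) ∈ F) :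
    outside 𝓖 \ interior (outside 𝓔) = ⋃ E ∈ 𝓔, invert ⁻¹' piece 𝓖 E := by
  rw [h.left.interior_outside]
  ext1 x
  simp only [outside, Set.mem_sdiff, mem_ofPred_eq, not_or, not_not, mem_iUnion₂ (s := fun E _ => invert ⁻¹' piece 𝓖 E), mem_preimage]
  constructor
  · rintro ⟨h1, hx0, h2⟩
    obtain ⟨E, hE, hxE⟩ := mem_iUnion₂.1 h2
    exact ⟨E, hE, (h.mem_piece hE).2 ⟨hxE, h1.resolve_left hx0⟩⟩
  · rintro ⟨E, hE, hx⟩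
    refine ⟨Or.inr ((h.mem_piece hE).1 hx).2, ?_, mem_biUnion hE hx.1⟩
    rintro rfl
    rw [invert_zero] at hx
    exact h.zero_notMem_piece h0 hE hx

lemma isCompact_piece (h : IsSimpleStep F 𝓔 𝓖) {E : Set Plane} (hE : E ∈ 𝓔) :
    IsCompact (piece 𝓖 E) :=
  (h.left.tame E hE).isCompact.diff (isOpen_biUnion fun _ _ => isOpen_interior)

lemma interior_piece (h : IsSimpleStep F 𝓔 𝓖) (E : Set Plane) :
    interior (piece 𝓖 E) = interior E \ ⋃ G ∈ children 𝓖 E, G := by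
  rw [piece, sdiff_eq, interior_inter, interior_compl, (h.finite_children E).closure_biUnion,
    ← sdiff_eq]
  congr 1
  exact iUnion₂_congr fun G hG => (h.right.tame G hG.1).closure_interior

lemma disjoint_children (h : IsSimpleStep F 𝓔 𝓖) {E : Set Plane} :
    (children 𝓖 E).PairwiseDisjoint id := h.right.disj.subset fun _ hG => hG.1

lemma isPreconnected_piece (h : IsSimpleStep F 𝓔 𝓖) {E : Set Plane} (hE : E ∈ 𝓔) :
    IsPreconnected (piece 𝓖 E) := by
  have h1 : IsPreconnected (interior E \ ⋃ G ∈ children 𝓖 E, G) := by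
    have := (isConnected_diff_biUnion isOpen_interior (h.left.tame E hE).isConnected_interior
      (h.finite_children E).toFinset id
      (fun G hG => h.right.tame G ((h.finite_children E).mem_toFinset.1 hG).1)
      (fun G hG => ((h.finite_children E).mem_toFinset.1 hG).2)
      (by simpa using h.disjoint_children)).2
    simpa using this.isPreconnected
  refine h1.subset_closure ?_ fun x hx => ?_
  · rw [← h.interior_piece]
    exact interior_subset
  by_cases hxG : ∃ G ∈ children 𝓖 E, x ∈ G
  · obtain ⟨G, hG, hxG⟩ := hxG
    have hO : IsOpen (interior E \ ⋃ G' ∈ children 𝓖 E \ {G}, G') :=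
      isOpen_interior.sdiff ((h.finite_children E).sdiff.isClosed_biUnion fun G' hG' =>
        (h.right.tame G' hG'.1.1).isClosed)
    have hxO : x ∈ interior E \ ⋃ G' ∈ children 𝓖 E \ {G}, G' := by
      refine ⟨hG.2 hxG, fun hx' => ?_⟩
      obtain ⟨G', hG', hxG'⟩ := mem_iUnion₂.1 hx'
      exact hG'.2 (h.right.eq_of_mem hG'.1.1 hG.1 hxG' hxG)
    have hxc : x ∈ closure Gᶜ := by
      rw [closure_compl]
      exact fun hx' => hx.2 (mem_biUnion hG hx')
    refine closure_mono ?_ (hO.inter_closure ⟨hxO, hxc⟩)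
    rintro y ⟨⟨hyE, hy⟩, hyG⟩
    refine ⟨hyE, fun hy' => ?_⟩
    obtain ⟨G', hG', hyG'⟩ := mem_iUnion₂.1 hy'
    by_cases he : G' = G
    · exact hyG (he ▸ hyG')
    · exact hy (mem_biUnion (show G' ∈ children 𝓖 E \ {G} from ⟨hG', he⟩) hyG')
  · have hcl : IsClosed (⋃ G ∈ children 𝓖 E, G) :=
      (h.finite_children E).isClosed_biUnion fun G hG => (h.right.tame G hG.1).isClosed
    have hxE := hx.1
    rw [← (h.left.tame E hE).closure_interior] at hxE
    have hxn : x ∈ (⋃ G ∈ children 𝓖 E, G)ᶜ := by simpa using hxG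
    have hm : x ∈ (⋃ G ∈ children 𝓖 E, G)ᶜ ∩ closure (interior E) := ⟨hxn, hxE⟩
    have := hcl.isOpen_compl.inter_closure hm
    rwa [inter_comm, ← sdiff_eq] at this

lemma frontier_piece (h : IsSimpleStep F 𝓔 𝓖) {E : Set Plane} (hE : E ∈ 𝓔) :
    frontier (piece 𝓖 E) = ⋃ D ∈ insert E (children 𝓖 E), frontier D := by
  rw [(h.isCompact_piece hE).isClosed.frontier_eq, h.interior_piece, biUnion_insert]
  ext1 x
  simp only [Set.mem_sdiff, mem_union, mem_iUnion₂ (s := fun D _ => frontier D)]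
  constructor
  · rintro ⟨hx, hn⟩
    by_cases hxE : x ∈ interior E
    · right
      by_contra hno
      refine hn ⟨hxE, fun h2 => hno ?_⟩
      obtain ⟨G, hG, hxG⟩ := mem_iUnion₂.1 h2
      exact ⟨G, hG, subset_closure hxG, fun h3 => hx.2 (mem_biUnion hG h3)⟩
    · exact Or.inl ⟨subset_closure hx.1, hxE⟩
  · rintro (hx | ⟨G, hG, hx⟩)
    · refine ⟨⟨(h.left.tame E hE).isClosed.frontier_subset hx, fun h2 => ?_⟩, fun h2 => hx.2 h2.1⟩
      obtain ⟨G, hG, hxG⟩ := mem_iUnion₂.1 h2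
      exact hx.2 (hG.2 (interior_subset hxG))
    · have hxG := (h.right.tame G hG.1).isClosed.frontier_subset hx
      refine ⟨⟨interior_subset (hG.2 hxG), fun h2 => ?_⟩, fun h2 => h2.2 (mem_biUnion hG hxG)⟩
      obtain ⟨G', hG', hxG'⟩ := mem_iUnion₂.1 h2
      have := h.right.eq_of_mem hG.1 hG'.1 hxG (interior_subset hxG')
      subst this
      exact hx.2 hxG'

lemma disjoint_piece (h : IsSimpleStep F 𝓔 𝓖) :
    𝓔.PairwiseDisjoint fun E => invert ⁻¹' piece 𝓖 E := fun _ hE _ hE' hne =>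
  ((h.left.disj hE hE' hne).mono (fun _ hx => hx.1) fun _ hx => hx.1).preimage invert

lemma component_eq (h : IsSimpleStep F 𝓔 𝓖) (h0 : (0 : Plane) ∈ F) {E : Set Plane} (hE : E ∈ 𝓔)
    {x : Plane} (hx : x ∈ invert ⁻¹' piece 𝓖 E) :
    connectedComponentIn (outside 𝓖 \ interior (outside 𝓔)) x = invert ⁻¹' piece 𝓖 E := by
  rw [h.outside_diff h0]
  exact connectedComponentIn_biUnion (A := fun E => invert ⁻¹' piece 𝓖 E) h.left.finite
    (fun E hE => (isCompact_invert_preimage (h.isCompact_piece hE)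
      (h.zero_notMem_piece h0 hE)).isClosed)
    (fun E hE => isPreconnected_invert_preimage (h.isPreconnected_piece hE)
      (h.zero_notMem_piece h0 hE)) h.disjoint_piece hE hx

lemma exists_component (h : IsSimpleStep F 𝓔 𝓖) (h0 : (0 : Plane) ∈ F) {x : Plane}
    (hx : x ∈ outside 𝓖 \ interior (outside 𝓔)) : ∃ E ∈ 𝓔, x ∈ invert ⁻¹' piece 𝓖 E := by
  rw [h.outside_diff h0] at hx
  simpa using hx

/-- The boundary components of a component of the difference of two consecutive stages. -/
lemma boundary_components (h : IsSimpleStep F 𝓔 𝓖) (h0 : (0 : Plane) ∈ F) {x : Plane}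
    (hx : x ∈ outside 𝓖 \ interior (outside 𝓔)) :
    (∃! D : Set Plane,
      (∃ y ∈ frontier (connectedComponentIn (outside 𝓖 \ interior (outside 𝓔)) x),
        D = connectedComponentIn
          (frontier (connectedComponentIn (outside 𝓖 \ interior (outside 𝓔)) x)) y) ∧
      D ⊆ frontier (outside 𝓔)) ∧
    ∃ y ∈ frontier (connectedComponentIn (outside 𝓖 \ interior (outside 𝓔)) x),
      connectedComponentIn
        (frontier (connectedComponentIn (outside 𝓖 \ interior (outside 𝓔)) x)) y ⊆
        frontier (outside 𝓖) := by
  obtain ⟨E, hE, hxE⟩ := h.exists_component h0 hx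
  rw [h.component_eq h0 hE hxE, h.left.frontier_outside h0, h.right.frontier_outside h0,
    frontier_invert_preimage (h.isCompact_piece hE) (h.zero_notMem_piece h0 hE),
    h.frontier_piece hE]
  have hmem : ∀ D ∈ insert E (children 𝓖 E), Tame D ∧ (0 : Plane) ∉ frontier D := by
    rintro D (rfl | hD)
    · exact ⟨h.left.tame _ hE, h.left.zero_notMem_frontier h0 hE⟩
    · exact ⟨h.right.tame _ hD.1, h.right.zero_notMem_frontier h0 hD.1⟩
  have hEG : ∀ G ∈ children 𝓖 E, Disjoint (frontier E) (frontier G) := fun G hG =>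
    disjoint_left.2 fun z hz hz' =>
      hz.2 (hG.2 ((h.right.tame G hG.1).isClosed.frontier_subset hz'))
  have hdis : (insert E (children 𝓖 E)).PairwiseDisjoint fun D => invert ⁻¹' frontier D := by
    rintro D (rfl | hD) D' (rfl | hD') hne
    · exact absurd rfl hne
    · exact (hEG D' hD').preimage _
    · exact (hEG D hD).symm.preimage _
    · exact ((h.disjoint_children hD hD' hne).mono
        (h.right.tame D hD.1).isClosed.frontier_subset
        (h.right.tame D' hD'.1).isClosed.frontier_subset).preimage _
  have hcomp : ∀ D ∈ insert E (children 𝓖 E), ∀ y ∈ invert ⁻¹' frontier D,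
      connectedComponentIn (invert ⁻¹' ⋃ D ∈ insert E (children 𝓖 E), frontier D) y =
        invert ⁻¹' frontier D := by
    intro D hD y hy
    rw [preimage_iUnion₂]
    exact connectedComponentIn_biUnion (A := fun D => invert ⁻¹' frontier D)
      ((h.finite_children E).insert E)
      (fun D hD => (isCompact_invert_preimage ((hmem D hD).1.isCompact.of_isClosed_subset
        isClosed_frontier (hmem D hD).1.isClosed.frontier_subset) (hmem D hD).2).isClosed)
      (fun D hD => isPreconnected_invert_preimage (hmem D hD).1.isConnected_frontier.isPreconnected
        (hmem D hD).2) hdis hD hy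
  have hne : ∀ D ∈ insert E (children 𝓖 E), (invert ⁻¹' frontier D).Nonempty := fun D hD => by
    obtain ⟨z, hz⟩ := (hmem D hD).1.isConnected_frontier.nonempty
    exact ⟨invert z, by simpa using hz⟩
  have hsub : ∀ D ∈ insert E (children 𝓖 E), invert ⁻¹' frontier D ⊆
      invert ⁻¹' ⋃ D ∈ insert E (children 𝓖 E), frontier D := fun D hD =>
    preimage_mono (subset_biUnion_of_mem (u := frontier) hD)
  refine ⟨⟨invert ⁻¹' frontier E, ⟨?_, preimage_mono (subset_biUnion_of_mem (u := frontier) hE)⟩,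
    ?_⟩, ?_⟩
  · obtain ⟨y, hy⟩ := hne E (mem_insert _ _)
    exact ⟨y, hsub E (mem_insert _ _) hy, (hcomp E (mem_insert _ _) y hy).symm⟩
  · rintro _ ⟨⟨y, hy, rfl⟩, hD⟩
    obtain ⟨D, hDm, hyD⟩ := mem_iUnion₂.1 (show invert y ∈ _ from hy)
    rw [hcomp D hDm y hyD] at hD ⊢
    rcases hDm with rfl | hDm
    · rfl
    · exfalso
      obtain ⟨E', hE', hz⟩ := mem_iUnion₂.1 (show invert y ∈ _ from hD hyD)
      have hzE := hDm.2 ((h.right.tame D hDm.1).isClosed.frontier_subset hyD)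
      have := h.left.eq_of_mem hE hE' (interior_subset hzE)
        ((h.left.tame E' hE').isClosed.frontier_subset hz)
      subst this
      exact hz.2 hzE
  · obtain ⟨G, hG, hGE⟩ := h.left.exists_child h.right h.refines hE
    have hGm : G ∈ insert E (children 𝓖 E) := Or.inr ⟨hG, hGE⟩
    obtain ⟨y, hy⟩ := hne G hGm
    refine ⟨y, hsub G hGm hy, ?_⟩
    rw [hcomp G hGm y hy]
    exact preimage_mono (subset_biUnion_of_mem (u := frontier) hG)

lemma exists_children (h : IsSimpleStep F 𝓔 𝓖) : ∃ E ∈ 𝓔,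
    (∃ G₁ G₂, G₁ ≠ G₂ ∧ children 𝓖 E = {G₁, G₂}) ∧
      ∀ E' ∈ 𝓔, E' ≠ E → ∃ G, children 𝓖 E' = {G} := by
  have hex : ∀ E ∈ 𝓔, ∃ G ∈ 𝓖, G ⊆ interior E := fun E hE =>
    h.left.exists_child h.right h.refines hE
  choose! s hs𝓖 hsE using hex
  have hpar : ∀ G ∈ 𝓖, ∀ E ∈ 𝓔, ∀ E' ∈ 𝓔, G ⊆ interior E → G ⊆ interior E' → E = E' := by
    intro G hG E hE E' hE' h1 h2
    obtain ⟨x, hx, -⟩ := h.right.meets G hG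
    exact h.left.eq_of_mem hE hE' (interior_subset (h1 hx)) (interior_subset (h2 hx))
  have hinj : InjOn s 𝓔 := fun E hE E' hE' he =>
    hpar (s E) (hs𝓖 E hE) E hE E' hE' (hsE E hE) (he ▸ hsE E' hE')
  have hsub : s '' 𝓔 ⊆ 𝓖 := image_subset_iff.2 hs𝓖
  have hcard : (𝓖 \ s '' 𝓔).ncard = 1 := by
    rw [ncard_sdiff hsub (h.left.finite.image s), hinj.ncard_image, h.ncard]
    omega
  obtain ⟨G₀, hG₀⟩ := ncard_eq_one.1 hcard
  have hG₀m : G₀ ∈ 𝓖 \ s '' 𝓔 := hG₀ ▸ mem_singleton G₀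
  obtain ⟨E, hE, hGE⟩ := h.refines G₀ hG₀m.1
  have hch : ∀ E' ∈ 𝓔, ∀ G ∈ children 𝓖 E', G = s E' ∨ (G = G₀ ∧ E' = E) := by
    rintro E' hE' G ⟨hG, hGE'⟩
    by_cases hm : G ∈ s '' 𝓔
    · obtain ⟨E'', hE'', rfl⟩ := hm
      exact Or.inl (congrArg s (hpar _ hG _ hE'' _ hE' (hsE _ hE'') hGE'))
    · have : G = G₀ := by
        have : G ∈ 𝓖 \ s '' 𝓔 := ⟨hG, hm⟩
        rwa [hG₀] at this
      subst this
      exact Or.inr ⟨rfl, hpar _ hG _ hE' _ hE hGE' hGE⟩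
  refine ⟨E, hE, ⟨s E, G₀, fun he => hG₀m.2 ⟨E, hE, he⟩, ?_⟩, fun E' hE' hne => ⟨s E', ?_⟩⟩
  · refine Subset.antisymm (fun G hG => (hch E hE G hG).imp id fun h => h.1) ?_
    rintro G (rfl | rfl)
    exacts [⟨hs𝓖 E hE, hsE E hE⟩, ⟨hG₀m.1, hGE⟩]
  · refine Subset.antisymm (fun G hG => (hch E' hE' G hG).resolve_right fun h => hne h.2) ?_
    rintro G rfl
    exact ⟨hs𝓖 E' hE', hsE E' hE'⟩

/-- Exactly one component of the difference of two consecutive stages is not an annulus, and it is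
a pair of pants. -/
lemma component_types (h : IsSimpleStep F 𝓔 𝓖) (h0 : (0 : Plane) ∈ F) :
    (∃! C : Set Plane, (∃ x ∈ outside 𝓖 \ interior (outside 𝓔),
      C = connectedComponentIn (outside 𝓖 \ interior (outside 𝓔)) x) ∧ ¬ IsAnnulus C) ∧
    ∀ x ∈ outside 𝓖 \ interior (outside 𝓔),
      ¬ IsAnnulus (connectedComponentIn (outside 𝓖 \ interior (outside 𝓔)) x) →
      IsPairOfPants (connectedComponentIn (outside 𝓖 \ interior (outside 𝓔)) x) := by
  obtain ⟨E, hE, ⟨G₁, G₂, hne, h12⟩, hone⟩ := h.exists_children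
  have hpants : IsPairOfPants (invert ⁻¹' piece 𝓖 E) := by
    have hG₁ : G₁ ∈ children 𝓖 E := by simp [h12]
    have hG₂ : G₂ ∈ children 𝓖 E := by simp [h12]
    obtain ⟨e⟩ := isPairOfPants_diff (h.left.tame E hE) (h.right.tame _ hG₁.1)
      (h.right.tame _ hG₂.1) hG₁.2 hG₂.2 (h.disjoint_children hG₁ hG₂ hne)
    have hp : piece 𝓖 E = E \ (interior G₁ ∪ interior G₂) := by
      rw [piece, h12, biUnion_pair]
    exact ⟨(invertHomeo _ (h.zero_notMem_piece h0 hE)).symm.trans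
      ((Homeomorph.setCongr hp).trans e)⟩
  have hann : ∀ E' ∈ 𝓔, E' ≠ E → IsAnnulus (invert ⁻¹' piece 𝓖 E') := by
    intro E' hE' hn
    obtain ⟨G, hG⟩ := hone E' hE' hn
    have hGm : G ∈ children 𝓖 E' := by simp [hG]
    obtain ⟨e⟩ := isAnnulus_diff (h.left.tame E' hE') (h.right.tame _ hGm.1) hGm.2
    have hp : piece 𝓖 E' = E' \ interior G := by
      rw [piece, hG, biUnion_singleton]
    exact ⟨(invertHomeo _ (h.zero_notMem_piece h0 hE')).symm.trans
      ((Homeomorph.setCongr hp).trans e)⟩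
  have hx : ∀ x ∈ outside 𝓖 \ interior (outside 𝓔),
      ¬ IsAnnulus (connectedComponentIn (outside 𝓖 \ interior (outside 𝓔)) x) →
      connectedComponentIn (outside 𝓖 \ interior (outside 𝓔)) x = invert ⁻¹' piece 𝓖 E := by
    intro x hx hna
    obtain ⟨E', hE', hxE⟩ := h.exists_component h0 hx
    rw [h.component_eq h0 hE' hxE] at hna ⊢
    by_cases he : E' = E
    · rw [he]
    · exact absurd (hann E' hE' he) hna
  refine ⟨⟨invert ⁻¹' piece 𝓖 E, ⟨?_, hpants.not_isAnnulus⟩, ?_⟩, fun x hm hna => ?_⟩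
  · obtain ⟨z, hz⟩ := (h.left.tame E hE).isConnected_frontier.nonempty
    have hzp : z ∈ frontier (piece 𝓖 E) := by
      rw [h.frontier_piece hE]
      exact mem_biUnion (mem_insert _ _) hz
    have hzp' : invert z ∈ invert ⁻¹' piece 𝓖 E := by
      simpa using (h.isCompact_piece hE).isClosed.frontier_subset hzp
    refine ⟨invert z, ?_, (h.component_eq h0 hE hzp').symm⟩
    rw [h.outside_diff h0]
    exact mem_biUnion hE hzp'
  · rintro _ ⟨⟨x, hm, rfl⟩, hna⟩
    exact hx x hm hna
  · rw [hx x hm hna]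
    exact hpants

end IsSimpleStep

/-- The angle of a point of the plane. -/
def ang (w : Plane) : ℝ := Complex.arg ⟨w.1, w.2⟩

lemma ang_smul {r : ℝ} (hr : 0 < r) (w : Plane) : ang (r • w) = ang w := by
  rw [ang, ang, ← Complex.arg_real_mul ⟨w.1, w.2⟩ hr]
  congr 1
  apply Complex.ext <;> simp

lemma norm_smul_circ_ang {w : Plane} (hw : w ≠ 0) : ‖w‖ • (circ (ang w) : Plane) = w := by
  have hn : 0 < ‖w‖ := norm_pos_iff.2 hw
  have h1 : ‖w‖⁻¹ • w ∈ Metric.sphere (0 : Plane) 1 := by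
    rw [mem_sphere_zero_iff_norm, norm_smul, norm_inv, norm_norm, inv_mul_cancel₀ hn.ne']
  have h2 := circ_arg ⟨_, h1⟩
  change circ (ang (‖w‖⁻¹ • w)) = _ at h2
  rw [ang_smul (inv_pos.2 hn)] at h2
  rw [h2, smul_smul, mul_inv_cancel₀ hn.ne', one_smul]

lemma ang_circ {t : ℝ} (h₁ : -Real.pi < t) (h₂ : t < Real.pi) : ang (circ t) = t := by
  have : ang (Real.cos t, Real.sin t) = t := by
    have h := Complex.arg_cos_add_sin_mul_I (θ := t) ⟨h₁, h₂.le⟩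
    rw [ang]
    convert h using 2
    apply Complex.ext <;> simp [Complex.cos_ofReal_re, Complex.sin_ofReal_re]
  rw [circ, ang_smul (inv_pos.2 (norm_pos_iff.2 (cos_sin_ne_zero t))), this]

/-- The plane cut along the negative horizontal half-axis. -/
def slit : Set Plane := {w | 0 < w.1 ∨ w.2 ≠ 0}

lemma slit_ne_zero {w : Plane} (hw : w ∈ slit) : w ≠ 0 := by
  rintro rfl
  simp [slit] at hw

lemma continuousOn_ang : ContinuousOn ang slit := by
  have h1 : Continuous fun w : Plane => (⟨w.1, w.2⟩ : ℂ) := by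
    have : Continuous fun w : Plane => ((w.1 : ℂ) + w.2 * Complex.I) := by fun_prop
    convert this using 2
    apply Complex.ext <;> simp
  intro w hw
  exact (ContinuousAt.comp (f := fun w : Plane => (⟨w.1, w.2⟩ : ℂ))
    (Complex.continuousAt_arg hw) h1.continuousAt).continuousWithinAt

lemma ang_mem {w : Plane} (hw : w ∈ slit) : -Real.pi < ang w ∧ ang w < Real.pi :=
  ⟨Complex.neg_pi_lt_arg _, Complex.mem_slitPlane_iff_arg.1 hw |>.1 |> fun h =>
    lt_of_le_of_ne (Complex.arg_le_pi _) h⟩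

/-- Polar coordinates turn the outside of the unit ball into a half-plane. -/
lemma exists_polar_chart {V : Set Plane} (hV : IsOpen V) (hVs : V ⊆ slit) :
    ∃ W : Set Plane, W ⊆ HalfPlane ∧ IsOpen (Subtype.val ⁻¹' W : Set ↥HalfPlane) ∧
      Nonempty (↥(V ∩ {w | 1 ≤ ‖w‖}) ≃ₜ ↥W) := by
  have hc : Continuous fun p : Plane => (p.2 + 1) • (circ p.1 : Plane) :=
    (continuous_snd.add continuous_const).smul
      (continuous_subtype_val.comp (continuous_circ.comp continuous_fst))
  have hn : ∀ t : ℝ, ‖(circ t : Plane)‖ = 1 := fun t => mem_sphere_zero_iff_norm.1 (circ t).2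
  let W : Set Plane := {p | (-Real.pi < p.1 ∧ p.1 < Real.pi ∧ (p.2 + 1) • (circ p.1 : Plane) ∈ V) ∧
    0 ≤ p.2}
  refine ⟨W, fun p hp => hp.2, ?_, ⟨?_⟩⟩
  · have hO : IsOpen {p : Plane | -Real.pi < p.1 ∧ p.1 < Real.pi ∧
        (p.2 + 1) • (circ p.1 : Plane) ∈ V} :=
      (isOpen_lt continuous_const continuous_fst).inter
        ((isOpen_lt continuous_fst continuous_const).inter (hV.preimage hc))
    convert hO.preimage (continuous_subtype_val (p := (· ∈ HalfPlane))) using 1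
    ext1 p
    exact ⟨fun h => h.1, fun h => ⟨h, p.2⟩⟩
  · have hinv : ∀ w ∈ V, (‖w‖ - 1 + 1) • (circ (ang w) : Plane) = w := fun w hw => by
      rw [sub_add_cancel, norm_smul_circ_ang (slit_ne_zero (hVs hw))]
    refine ⟨⟨fun w => ⟨(ang w, ‖(w : Plane)‖ - 1), ⟨(ang_mem (hVs w.2.1)).1, (ang_mem (hVs w.2.1)).2,
        by rw [hinv _ w.2.1]; exact w.2.1⟩, sub_nonneg.2 w.2.2⟩,
      fun p => ⟨((p : Plane).2 + 1) • (circ (p : Plane).1 : Plane), p.2.1.2.2, ?_⟩,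
      fun w => ?_, fun p => ?_⟩, ?_, ?_⟩
    · have := p.2.2
      rw [mem_ofPred_eq, norm_smul, hn, mul_one, Real.norm_of_nonneg (by linarith)]
      linarith
    · exact Subtype.ext (hinv _ w.2.1)
    · have h0 := p.2.2
      have h1 : 0 < (p : Plane).2 + 1 := by linarith
      refine Subtype.ext (Prod.ext ?_ ?_)
      · change ang (((p : Plane).2 + 1) • (circ (p : Plane).1 : Plane)) = _
        rw [ang_smul h1, ang_circ p.2.1.1 p.2.1.2.1]
      · change ‖((p : Plane).2 + 1) • (circ (p : Plane).1 : Plane)‖ - 1 = _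
        rw [norm_smul, hn, mul_one, Real.norm_of_nonneg h1.le]
        ring
    · have : Continuous fun w : ↥(V ∩ {w | 1 ≤ ‖w‖}) => ang w :=
        continuousOn_iff_continuous_domRestrict.1
          (continuousOn_ang.mono (inter_subset_left.trans hVs))
      exact (this.prodMk (by fun_prop)).subtype_mk _
    · exact (hc.comp continuous_subtype_val).subtype_mk _

lemma exists_interior_chart {A : Set Plane} {x : Plane} (hx : x ∈ interior A) :
    ∃ U : Set Plane, x ∈ U ∧ IsOpen U ∧ ∃ W : Set Plane, W ⊆ HalfPlane ∧
      IsOpen (Subtype.val ⁻¹' W : Set ↥HalfPlane) ∧ Nonempty (↥(U ∩ A) ≃ₜ ↥W) := by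
  obtain ⟨r, hr, hb⟩ := Metric.isOpen_iff.1 isOpen_interior x hx
  have hbA : Metric.ball x r ∩ A = Metric.ball x r :=
    inter_eq_self_of_subset_left (hb.trans interior_subset)
  have him : Homeomorph.addLeft (((0, r) : Plane) - x) '' Metric.ball x r =
      Metric.ball ((0, r) : Plane) r := by
    change (fun y => ((0, r) : Plane) - x + y) '' _ = _
    rw [image_add_left, preimage_add_ball, sub_neg_eq_add, add_sub_cancel]
  refine ⟨Metric.ball x r, Metric.mem_ball_self hr, Metric.isOpen_ball,
    Metric.ball ((0, r) : Plane) r, fun p hp => ?_, Metric.isOpen_ball.preimage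
      continuous_subtype_val, ⟨?_⟩⟩
  · rw [mem_ball_iff_norm, Prod.norm_def, max_lt_iff] at hp
    have := (abs_lt.1 hp.2).1
    simp only [Prod.snd_sub] at this
    change 0 ≤ p.2
    linarith
  · exact (Homeomorph.setCongr hbA).trans
      ((Homeomorph.image (Homeomorph.addLeft (((0, r) : Plane) - x)) _).trans
        (Homeomorph.setCongr him))

lemma Tame.exists_slit_param {E : Set Plane} (hE : Tame E) {y : Plane} (hy : y ∈ frontier E) :
    ∃ g : Plane ≃ₜ Plane, g '' Metric.closedBall 0 1 = E ∧ g.symm y ∈ slit := by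
  obtain ⟨g, -, rfl⟩ := hE
  by_cases hs : g.symm y ∈ slit
  · exact ⟨g, rfl, hs⟩
  have hz : ‖g.symm y‖ = 1 := by
    rw [image_closedBall_frontier] at hy
    obtain ⟨z, hz, rfl⟩ := hy
    simpa using hz
  refine ⟨(Homeomorph.neg Plane).trans g, ?_, ?_⟩
  · rw [trans_image]
    congr 1
    change Neg.neg '' _ = _
    rw [image_neg_eq_neg, neg_closedBall, neg_zero]
  · change - g.symm y ∈ slit
    simp only [slit, mem_ofPred_eq, not_or, not_not, not_lt] at hs
    refine Or.inl ?_
    rw [Prod.norm_def, hs.2, norm_zero] at hz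
    rcases hs.1.lt_or_eq with h | h
    · simpa using h
    · rw [h] at hz
      simp at hz

lemma IsDiscCover.isCompactSurfaceWithBoundary {F : Set Plane} {𝓔 : Set (Set Plane)}
    (h : IsDiscCover F 𝓔) (h0 : (0 : Plane) ∈ F) : IsCompactSurfaceWithBoundary (outside 𝓔) := by
  refine ⟨h.isCompact_outside h0, fun x hx => ?_⟩
  by_cases hxi : x ∈ interior (outside 𝓔)
  · exact exists_interior_chart hxi
  have hxf : x ∈ frontier (outside 𝓔) := ⟨subset_closure hx, hxi⟩
  rw [h.frontier_outside h0] at hxf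
  obtain ⟨E, hE, hxE⟩ := mem_iUnion₂.1 (show invert x ∈ _ from hxf)
  obtain ⟨g, rfl, hg⟩ := (h.tame E hE).exists_slit_param hxE
  set E := g '' Metric.closedBall 0 1 with hEdef
  have hx0 : invert x ≠ 0 := fun he => h.zero_notMem_frontier h0 hE (he ▸ hxE)
  let O : Set Plane := ((⋃ E' ∈ 𝓔 \ {E}, E') ∪ {0})ᶜ
  have hO : IsOpen O := ((h.finite.sdiff.isClosed_biUnion fun E' hE' =>
    (h.tame E' hE'.1).isClosed).union isClosed_singleton).isOpen_compl
  have hxO : invert x ∈ O := by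
    rintro (hm | hm)
    · obtain ⟨E', hE', hm⟩ := mem_iUnion₂.1 hm
      exact hE'.2 (h.eq_of_mem hE'.1 hE hm ((h.tame E hE).isClosed.frontier_subset hxE))
    · exact hx0 hm
  have hslit : IsOpen slit := (isOpen_lt continuous_const continuous_fst).union
    (isOpen_ne_fun continuous_snd continuous_const)
  let V : Set Plane := slit ∩ g ⁻¹' O
  obtain ⟨W, hW, hWo, ⟨e⟩⟩ := exists_polar_chart (hslit.inter (hO.preimage g.continuous) : IsOpen V)
    inter_subset_left
  have hV0 : ∀ w ∈ V, g w ≠ 0 := fun w hw h => hw.2 (Or.inr h)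
  have h0V : (0 : Plane) ∉ g '' V := fun ⟨w, hw, h⟩ => hV0 w hw h
  have hV0' : (0 : Plane) ∉ g '' (V ∩ {w | 1 ≤ ‖w‖}) := fun ⟨w, hw, h⟩ => hV0 w hw.1 h
  have hUA : invert ⁻¹' (g '' V) ∩ outside 𝓔 = invert ⁻¹' (g '' (V ∩ {w | 1 ≤ ‖w‖})) := by
    ext1 y
    constructor
    · rintro ⟨⟨w, hw, hwy⟩, hy⟩
      refine ⟨w, ⟨hw, ?_⟩, hwy⟩
      have hy' := hy.resolve_left fun hy0 => hV0 w hw (by rw [hwy, hy0, invert_zero])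
      rw [mem_ofPred_eq]
      by_contra hlt
      refine hy' (mem_biUnion hE ?_)
      rw [hEdef, image_closedBall_interior, ← hwy]
      exact mem_image_of_mem _ (by simpa using hlt)
    · rintro ⟨w, ⟨hw, hw1⟩, hwy⟩
      refine ⟨⟨w, hw, hwy⟩, Or.inr fun hm => ?_⟩
      obtain ⟨E', hE', hm⟩ := mem_iUnion₂.1 hm
      by_cases he : E' = E
      · rw [he, hEdef, image_closedBall_interior, ← hwy] at hm
        obtain ⟨w', hw', he⟩ := hm
        rw [g.injective he, mem_ball_zero_iff] at hw'
        exact hw'.not_ge hw1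
      · rw [← hwy] at hm
        exact hw.2 (Or.inl (mem_biUnion (show E' ∈ 𝓔 \ {E} from ⟨hE', he⟩) (interior_subset hm)))
  refine ⟨invert ⁻¹' (g '' V), ⟨g.symm (invert x), ⟨hg, ?_⟩, g.apply_symm_apply _⟩,
    isOpen_invert_preimage (g.isOpenMap _ (hslit.inter (hO.preimage g.continuous))) h0V, W, hW, hWo,
    ⟨?_⟩⟩
  · rw [mem_preimage, g.apply_symm_apply]
    exact hxO
  · exact (Homeomorph.setCongr hUA).trans ((invertHomeo _ hV0').symm.trans
      ((g.image _).symm.trans e))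

lemma tendsto_invert_zero : Tendsto invert (𝓝[≠] 0) (cocompact Plane) := by
  rw [← Metric.cobounded_eq_cocompact, ← comap_norm_atTop, tendsto_comap_iff]
  have : Tendsto (fun x : Plane => ‖x‖⁻¹) (𝓝[≠] 0) atTop :=
    tendsto_inv_nhdsGT_zero.comp (tendsto_norm_nhdsNE_zero)
  exact this.congr fun x => (norm_invert x).symm

lemma tendsto_invert_cocompact : Tendsto invert (cocompact Plane) (𝓝 0) := by
  rw [tendsto_zero_iff_norm_tendsto_zero]
  exact (tendsto_inv_atTop_zero.comp tendsto_norm_cocompact_atTop).congr fun x =>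
    (norm_invert x).symm

lemma continuous_invert_conj (g : Plane ≃ₜ Plane) (g0 : g 0 = 0) :
    Continuous fun x => invert (g (invert x)) := by
  have hne : ∀ y, y ≠ 0 → g y ≠ 0 := fun y hy h => hy (g.injective (h.trans g0.symm))
  refine continuous_iff_continuousAt.2 fun x => ?_
  rcases eq_or_ne x 0 with rfl | hx
  · refine continuousAt_iff_punctured_nhds.2 ?_
    simp only [invert_zero, g0]
    exact tendsto_invert_cocompact.comp
      (g.isClosedEmbedding.tendsto_cocompact.comp tendsto_invert_zero)
  · have h1 := continuousAt_invert (hne _ (invert_eq_zero.not.2 hx))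
    exact h1.comp (f := fun x => g (invert x))
      (g.continuous.continuousAt.comp (continuousAt_invert hx))

/-- Conjugation by the inversion. -/
def invertConj (g : Plane ≃ₜ Plane) (g0 : g 0 = 0) : Plane ≃ₜ Plane where
  toFun x := invert (g (invert x))
  invFun x := invert (g.symm (invert x))
  left_inv x := by simp
  right_inv x := by simp
  continuous_toFun := continuous_invert_conj g g0
  continuous_invFun := continuous_invert_conj g.symm (g.symm_apply_eq.2 g0.symm)

lemma invertConj_image (g : Plane ≃ₜ Plane) (g0 : g 0 = 0) (A : Set Plane) :
    invertConj g g0 '' {x | x = 0 ∨ invert x ∉ A} = {x | x = 0 ∨ invert x ∉ g '' A} := by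
  have hne : ∀ y, g y = 0 ↔ y = 0 := fun y =>
    ⟨fun h => g.injective (h.trans g0.symm), fun h => h ▸ g0⟩
  have key : ∀ x, (invertConj g g0 x = 0 ∨ invert (invertConj g g0 x) ∉ g '' A) ↔
      (x = 0 ∨ invert x ∉ A) := fun x => by
    change (invert (g (invert x)) = 0 ∨ invert (invert (g (invert x))) ∉ _) ↔ _
    rw [invert_eq_zero, hne, invert_eq_zero, invert_invert, g.injective.mem_set_image]
  ext1 y
  constructor
  · rintro ⟨x, hx, rfl⟩
    exact (key x).2 hx
  · intro hy
    obtain ⟨x, rfl⟩ := (invertConj g g0).surjective y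
    exact ⟨x, (key x).1 hy, rfl⟩

lemma isAnnulus_of_image (g : Plane ≃ₜ Plane) (g0 : g 0 = 0) {A : Set Plane}
    (h : IsAnnulus {x | x = 0 ∨ invert x ∉ g '' A}) : IsAnnulus {x | x = 0 ∨ invert x ∉ A} := by
  rw [← invertConj_image g g0] at h
  have := h.image (invertConj g g0).symm
  rwa [← image_comp, Homeomorph.symm_comp_self, image_id] at this

lemma invert_preimage_square : invert ⁻¹' Metric.closedBall ((3, 0) : Plane) 1 =
    {p | 1 / 4 ≤ p.1 ∧ p.1 ≤ 1 / 2 ∧ |p.2| ≤ p.1 ^ 2} := by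
  ext1 p
  obtain ⟨x, y⟩ := p
  rw [mem_preimage, mem_closedBall_iff_norm, invert, Prod.norm_def, sup_le_iff]
  simp only [Prod.smul_mk, smul_eq_mul, Prod.fst_sub, Prod.snd_sub, sub_zero, mem_ofPred_eq,
    Real.norm_eq_abs]
  set N := ‖((x, y) : Plane)‖ with hN
  have hN' : N = max |x| |y| := rfl
  constructor
  · rintro ⟨h1, h2⟩
    have hN0 : 0 < N := by
      rw [hN, norm_pos_iff]
      rintro h
      rw [Prod.mk_eq_zero] at h
      rw [h.1] at h1
      norm_num at h1
    have hN2 : 0 < N ^ 2 := by positivity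
    rw [abs_le] at h1
    rw [abs_mul, abs_of_pos (inv_pos.2 hN2), inv_mul_le_iff₀ hN2, mul_one] at h2
    have h3 : 2 * N ^ 2 ≤ x := by
      have : 2 ≤ (N ^ 2)⁻¹ * x := by linarith [h1.1]
      rwa [le_inv_mul_iff₀ hN2, mul_comm] at this
    have h4 : x ≤ 4 * N ^ 2 := by
      have : (N ^ 2)⁻¹ * x ≤ 4 := by linarith [h1.2]
      rwa [inv_mul_le_iff₀ hN2, mul_comm] at this
    have hx0 : 0 < x := by linarith
    have hxN : x ≤ N := by rw [hN', ← abs_of_pos hx0]; simp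
    have hN3 : N ≤ 1 / 2 := by nlinarith
    have hyN : |y| < N := by nlinarith
    have : N = x := by
      rw [hN', max_def] at hyN ⊢
      split_ifs at hyN ⊢ with h
      · exact absurd hyN (lt_irrefl _)
      · exact abs_of_pos hx0
    rw [this] at h3 h4 h2 hN3
    refine ⟨by nlinarith, hN3, h2⟩
  · rintro ⟨h1, h2, h3⟩
    have hx0 : 0 < x := by linarith
    have hNx : N = x := by
      rw [hN', abs_of_pos hx0]
      exact max_eq_left (h3.trans (by nlinarith))
    rw [hNx]
    have hx2 : 0 < x ^ 2 := by positivity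
    refine ⟨?_, ?_⟩
    · have : (x ^ 2)⁻¹ * x = x⁻¹ := by field_simp
      rw [this, abs_le]
      have h5 : x⁻¹ ≤ 4 := by rw [inv_le_comm₀ hx0 (by norm_num)]; linarith
      have h6 : 2 ≤ x⁻¹ := by rw [le_inv_comm₀ (by norm_num) hx0]; linarith
      constructor <;> linarith
    · rwa [abs_mul, abs_of_pos (inv_pos.2 hx2), inv_mul_le_iff₀ hx2, mul_one]

lemma tame_invert_square : Tame (invert ⁻¹' Metric.closedBall ((3, 0) : Plane) 1) := by
  let q : ℝ → ℝ := fun y => max 0 (min (y - 1 / 32) (3 / 32)) - max 0 (min (-y - 1 / 32) (3 / 32))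
  let c : ℝ → ℝ := fun x => (max (1 / 4) (min x (1 / 2)) ^ 2 - 1 / 8) * (32 / 3)
  have hq : ∀ y y', y < y' → 0 ≤ q y' - q y ∧ q y' - q y ≤ y' - y := by
    intro y y' h
    simp only [q]
    constructor <;> grind
  have hqb : ∀ y, |q y| ≤ 1 := by
    intro y
    rw [abs_le]
    simp only [q]
    constructor <;> grind
  have hc : ∀ x, -2 / 3 ≤ c x ∧ c x ≤ 4 / 3 := by
    intro x
    have h1 : 1 / 4 ≤ max (1 / 4) (min x (1 / 2)) := le_max_left _ _
    have h2 : max (1 / 4) (min x (1 / 2)) ≤ 1 / 2 := max_le (by norm_num) (min_le_right _ _)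
    simp only [c]
    constructor <;> nlinarith
  have hmono : ∀ x, StrictMono fun y => y + c x * q y := by
    intro x y y' h
    have h1 := hq y y' h
    have h2 := hc x
    change y + c x * q y < y' + c x * q y'
    nlinarith
  obtain ⟨h, hh⟩ := exists_shear_homeo (fun p => p.2 + c p.1 * q p.2)
    (by simp only [c, q]; fun_prop) hmono (C := 4 / 3) (fun p => by
      rw [add_sub_cancel_left, abs_mul]
      have h1 : |c p.1| ≤ 4 / 3 := abs_le.2 ⟨by linarith [(hc p.1).1], (hc p.1).2⟩
      nlinarith [hqb p.2, abs_nonneg (c p.1), abs_nonneg (q p.2)])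
  have hr : (0 : ℝ) < 1 / 8 := by norm_num
  have hlh : LH h (3 / 8, 0) := by
    refine (lh_id _).of_eventuallyEq ?_
    have : {p : Plane | |p.2| < 1 / 32} ∈ 𝓝 ((3 / 8, 0) : Plane) :=
      (isOpen_lt (by fun_prop) continuous_const).mem_nhds (by simp)
    filter_upwards [this] with p hp
    have : q p.2 = 0 := by
      have := abs_lt.1 hp
      simp only [q]
      grind
    rw [hh, this, mul_zero, add_zero]
  have ht := Tame.image (g := homothetyHomeo (3 / 8, 0) (1 / 8) hr) (homothetyHomeo_lh _ hr 0)
    (homothetyHomeo_closedBall _ hr) (h := h) (by simpa using hlh)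
  convert ht using 1
  rw [invert_preimage_square]
  have key : ∀ p : Plane, (1 / 4 ≤ p.1 ∧ p.1 ≤ 1 / 2 ∧ |(h p).2| ≤ p.1 ^ 2) ↔
      p ∈ Metric.closedBall ((3 / 8, 0) : Plane) (1 / 8) := by
    intro p
    rw [mem_closedBall_iff_norm, Prod.norm_def, sup_le_iff]
    simp only [Prod.fst_sub, Prod.snd_sub, sub_zero, Real.norm_eq_abs]
    have e1 : |p.1 - 3 / 8| ≤ 1 / 8 ↔ 1 / 4 ≤ p.1 ∧ p.1 ≤ 1 / 2 := by
      rw [abs_le]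
      constructor <;> rintro ⟨_, _⟩ <;> constructor <;> linarith
    rw [e1, and_assoc]
    refine and_congr_right fun h1 => and_congr_right fun h2 => ?_
    have hcx : c p.1 = (p.1 ^ 2 - 1 / 8) * (32 / 3) := by
      simp only [c]
      rw [min_eq_left h2, max_eq_right h1]
    have hq1 : q (1 / 8) = 3 / 32 := by simp only [q]; norm_num
    have hq2 : q (-(1 / 8)) = -(3 / 32) := by simp only [q]; norm_num
    have v1 : (1 / 8 : ℝ) + c p.1 * q (1 / 8) = p.1 ^ 2 := by rw [hcx, hq1]; ring
    have v2 : (-(1 / 8) : ℝ) + c p.1 * q (-(1 / 8)) = -p.1 ^ 2 := by rw [hcx, hq2]; ring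
    rw [hh, abs_le, abs_le, ← v1]
    refine and_congr ?_ (hmono p.1).le_iff_le
    rw [v1, ← v2]
    exact (hmono p.1).le_iff_le
  ext1 y
  obtain ⟨p, rfl⟩ := h.surjective y
  rw [h.injective.mem_set_image, ← key]
  simp only [mem_ofPred_eq, hh]

lemma isAnnulus_square : IsAnnulus {x : Plane | x = 0 ∨
    invert x ∉ Metric.ball 0 1 ∪ Metric.ball ((3, 0) : Plane) 1} := by
  have h0 : (0 : Plane) ∉ Metric.closedBall ((3, 0) : Plane) 1 := by
    simp [Prod.dist_eq]
  have hsub : invert ⁻¹' Metric.closedBall ((3, 0) : Plane) 1 ⊆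
      interior (Metric.closedBall (0 : Plane) 1) := by
    rw [interior_closedBall _ one_ne_zero, invert_preimage_square]
    rintro p ⟨h1, h2, h3⟩
    rw [mem_ball_zero_iff, Prod.norm_def, sup_lt_iff, Real.norm_eq_abs, Real.norm_eq_abs,
      abs_of_nonneg (by linarith)]
    exact ⟨by linarith, h3.trans_lt (by nlinarith)⟩
  convert isAnnulus_diff (tame_closedBall 0 one_pos) tame_invert_square hsub using 1
  rw [interior_invert_preimage h0, interior_closedBall _ one_ne_zero]
  ext1 x
  rcases eq_or_ne x 0 with rfl | hx
  · simp [Prod.dist_eq]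
  have hn : 0 < ‖x‖ := norm_pos_iff.2 hx
  rw [mem_ofPred_eq, Set.mem_sdiff, mem_closedBall_zero_iff, mem_union, not_or, mem_ball_zero_iff,
    norm_invert, not_lt, one_le_inv₀ hn, mem_preimage]
  simp [hx]

lemma isAnnulus_outside_unit {E : Set Plane} (hE : Tame E)
    (hd : Disjoint E (Metric.closedBall 0 1)) :
    IsAnnulus {x : Plane | x = 0 ∨ invert x ∉ Metric.ball 0 1 ∪ interior E} := by
  obtain ⟨g, hg, rfl⟩ := hE
  have hO : IsConnected (univ \ Metric.closedBall (0 : Plane) 1) :=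
    (tame_closedBall 0 one_pos).isConnected_diff isOpen_univ isPreconnected_univ (subset_univ _)
  rw [← compl_eq_univ_sdiff] at hO
  have hsq : homothetyHomeo (3, 0) 1 one_pos '' Metric.closedBall (0 : Plane) 1 ⊆
      (Metric.closedBall (0 : Plane) 1)ᶜ := by
    rw [homothetyHomeo_closedBall]
    refine (Metric.closedBall_disjoint_closedBall ?_).subset_compl_right
    rw [dist_zero_right, Prod.norm_def]
    norm_num
  obtain ⟨h, hs, H⟩ := exists_move Metric.isClosed_closedBall.isOpen_compl hO.isPreconnected hg
    (homothetyHomeo_lh (3, 0) one_pos 0) hd.subset_compl_right hsq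
  have hfix : ∀ x ∈ Metric.closedBall (0 : Plane) 1, h x = x := fun x hx =>
    hs.apply_eq (notMem_compl_iff.2 hx)
  have e1 : h '' Metric.ball 0 1 = Metric.ball 0 1 := by
    rw [image_congr fun x hx => hfix x (Metric.ball_subset_closedBall hx)]
    exact image_id _
  have e2 : h '' interior (g '' Metric.closedBall 0 1) = Metric.ball ((3, 0) : Plane) 1 := by
    rw [image_closedBall_interior, image_image,
      image_congr fun x hx => H x (Metric.ball_subset_closedBall hx), homothetyHomeo_ball]
  refine isAnnulus_of_image h (hfix 0 (by simp)) ?_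
  rw [image_union, e1, e2]
  exact isAnnulus_square

lemma isAnnulus_outside_pair {E₁ E₂ : Set Plane} (h₁ : Tame E₁) (h₂ : Tame E₂)
    (h0 : (0 : Plane) ∈ interior E₁) (hd : Disjoint E₁ E₂) :
    IsAnnulus {x : Plane | x = 0 ∨ invert x ∉ interior E₁ ∪ interior E₂} := by
  obtain ⟨g, hg, rfl, g0⟩ := h₁.exists_param h0
  have hO : IsConnected (univ \ E₂) :=
    h₂.isConnected_diff isOpen_univ isPreconnected_univ (subset_univ _)
  rw [← compl_eq_univ_sdiff] at hO
  have h0' : (0 : Plane) ∈ E₂ᶜ := disjoint_left.1 hd (interior_subset h0)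
  obtain ⟨r, hr, hrO⟩ := Metric.nhds_basis_closedBall.mem_iff.1
    (h₂.isClosed.isOpen_compl.mem_nhds h0')
  obtain ⟨h, hs, H⟩ := exists_move h₂.isClosed.isOpen_compl hO.isPreconnected hg
    (homothetyHomeo_lh 0 hr 0) hd.subset_compl_right (by rwa [homothetyHomeo_closedBall])
  have hh0 : h 0 = 0 := by
    have := H 0 (by simp)
    rwa [g0, homothetyHomeo_apply, smul_zero, add_zero] at this
  have e2 : h '' E₂ = E₂ := by
    rw [image_congr fun x hx => hs.apply_eq (notMem_compl_iff.2 hx)]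
    exact image_id _
  let s := (homothetyHomeo 0 r hr).symm
  have hs0 : s 0 = 0 := by
    rw [Homeomorph.symm_apply_eq, homothetyHomeo_apply, smul_zero, add_zero]
  have hsE : Tame (s '' E₂) := by
    obtain ⟨k, hk, hkE⟩ := h₂
    refine Tame.image hk hkE ?_
    have := (homothetyHomeo_lh 0 hr (s (k 0))).symm
    rwa [Homeomorph.apply_symm_apply] at this
  have e1 : (h.trans s) '' (g '' Metric.closedBall 0 1) = Metric.closedBall 0 1 := by
    rw [trans_image, image_image h, image_congr H, ← image_comp,
      Homeomorph.symm_comp_self, image_id]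
  refine isAnnulus_of_image (h.trans s) (by rw [Homeomorph.trans_apply, hh0, hs0]) ?_
  rw [image_union, Homeomorph.image_interior, Homeomorph.image_interior, e1,
    interior_closedBall _ one_ne_zero, trans_image, e2]
  refine isAnnulus_outside_unit hsE ?_
  rw [← e1, trans_image, disjoint_image_iff s.injective, ← e2, disjoint_image_iff h.injective]
  exact hd.symm

lemma IsDiscCover.isAnnulus_outside {F : Set Plane} {𝓔 : Set (Set Plane)} (h : IsDiscCover F 𝓔)
    (h0 : (0 : Plane) ∈ F) (hn : 𝓔.ncard = 2) : IsAnnulus (outside 𝓔) := by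
  obtain ⟨A, B, hAB, rfl⟩ := ncard_eq_two.1 hn
  have hA := h.tame A (by simp)
  have hB := h.tame B (by simp)
  have hd : Disjoint A B := h.disj (by simp) (by simp) hAB
  rw [outside, biUnion_pair]
  have h1 := h.cover h0
  rw [biUnion_pair] at h1
  rcases h1 with h1 | h1
  · exact isAnnulus_outside_pair hA hB h1 hd
  · rw [union_comm]
    exact isAnnulus_outside_pair hB hA h1 hd.symm

lemma IsDiscCover.isPreconnected_interior_diff {F : Set Plane} {𝓔 : Set (Set Plane)}
    (h : IsDiscCover F 𝓔) (hF : IsCompact F) (hFc : IsPreconnected Fᶜ) {E : Set Plane}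
    (hE : E ∈ 𝓔) : IsPreconnected (interior E \ F) := by
  have hT := h.tame E hE
  have hsub : F ∩ E ⊆ interior E := fun x hx => by
    by_contra hxi
    exact disjoint_left.1 (h.frontier_disjoint hE) ⟨subset_closure hx.2, hxi⟩ hx.1
  obtain ⟨E', hE', hFE', hE'E⟩ := hT.exists_shrink (hF.inter_right hT.isClosed) hsub
  have hring := hE'.isConnected_diff isOpen_interior hT.isConnected_interior.isPreconnected hE'E
  have hringF : interior E \ E' ⊆ Fᶜ := fun x hx hxF =>
    hx.2 (interior_subset (hFE' ⟨hxF, interior_subset hx.1⟩))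
  have hpre : Subtype.val '' (Subtype.val ⁻¹' (interior E \ E') : Set ↥Fᶜ) = interior E \ E' := by
    rw [Subtype.image_preimage_coe, inter_eq_right.2 hringF]
  have hNB : (Subtype.val ⁻¹' E'ᶜ : Set ↥Fᶜ) \ Subtype.val ⁻¹' (interior E)ᶜ =
      Subtype.val ⁻¹' (interior E \ E') := by
    ext1 x
    simp only [Set.mem_sdiff, mem_preimage, mem_compl_iff, not_not]
    exact and_comm
  have := isPreconnected_diff_of_collar (X := ↥Fᶜ) (O := univ)
    (B := Subtype.val ⁻¹' (interior E)ᶜ) (N := Subtype.val ⁻¹' E'ᶜ)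
    (Subtype.preconnectedSpace hFc).isPreconnected_univ
    (isOpen_interior.isClosed_compl.preimage continuous_subtype_val)
    (hE'.isClosed.isOpen_compl.preimage continuous_subtype_val)
    (preimage_mono (compl_subset_compl.2 hE'E))
    (by
      rw [hNB, ← IsInducing.subtypeVal.isPreconnected_image, hpre]
      exact hring.isPreconnected)
    (subset_univ _)
    (by
      rw [hNB, ← image_nonempty, hpre]
      exact hring.nonempty)
  rw [← IsInducing.subtypeVal.isPreconnected_image, ← compl_eq_univ_sdiff, ← preimage_compl,
    compl_compl, Subtype.image_preimage_coe] at this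
  rwa [sdiff_eq, inter_comm]

/-- If the domain has `m + 1` ends, then discs avoiding a suitable compact set number more
than `m`. -/
lemma exists_compact_lt_ncard {Sg : Set Plane} (hop : IsOpen Sg) (hz : (0 : Plane) ∈ Sg)
    (hFc : IsPreconnected {y | y = 0 ∨ invert y ∉ Sg}ᶜ) {Es : ℕ → SetEnd Sg}
    (hEs : ∀ m n : ℕ, m ≠ n → ∃ K : Set Plane, IsCompact K ∧ K ⊆ Sg ∧ (Es m).sel K ≠ (Es n).sel K)
    (m : ℕ) :
    ∃ L, IsCompact L ∧ Disjoint L {y | y = 0 ∨ invert y ∉ Sg} ∧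
      ∀ 𝓔, IsDiscCover {y | y = 0 ∨ invert y ∉ Sg} 𝓔 → (∀ E ∈ 𝓔, Disjoint E L) → m < 𝓔.ncard := by
  set F : Set Plane := {y | y = 0 ∨ invert y ∉ Sg} with hF
  have hFk : IsCompact F := isCompact_invert_compl hop hz
  choose! K hK hKS hKne using hEs
  obtain ⟨ε, hε, hεS⟩ := Metric.nhds_basis_closedBall.mem_iff.1 (hop.mem_nhds hz)
  let P : Set (ℕ × ℕ) := {p | p.1 ∈ Iic m ∧ p.2 ∈ Iic m ∧ p.1 ≠ p.2}
  have hP : P.Finite := ((finite_Iic m).prod (finite_Iic m)).subset fun p hp => ⟨hp.1, hp.2.1⟩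
  let K₀ : Set Plane := (⋃ p ∈ P, K p.1 p.2) ∪ Metric.closedBall 0 ε
  have hK₀ : IsCompact K₀ :=
    (hP.isCompact_biUnion fun p hp => hK _ _ hp.2.2).union (isCompact_closedBall _ _)
  have hK₀S : K₀ ⊆ Sg := union_subset (iUnion₂_subset fun p hp => hKS _ _ hp.2.2) hεS
  have h0L : (0 : Plane) ∉ K₀ \ Metric.ball 0 ε := fun h => h.2 (Metric.mem_ball_self hε)
  refine ⟨invert ⁻¹' (K₀ \ Metric.ball 0 ε),
    isCompact_invert_preimage (hK₀.diff Metric.isOpen_ball) h0L, ?_, fun 𝓔 h hd => ?_⟩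
  · refine disjoint_left.2 fun y hy hyF => ?_
    rcases hyF with rfl | hyF
    · exact h0L (by simpa using hy)
    · exact hyF (hK₀S hy.1)
  have h0 : (0 : Plane) ∈ F := Or.inl rfl
  have hball : ∀ E ∈ 𝓔, E ⊆ Metric.ball 0 ε⁻¹ := by
    intro E hE
    refine (h.tame E hE).isConnected.isPreconnected.subset_left_of_subset_union Metric.isOpen_ball
      (v := (Metric.closedBall 0 ε⁻¹)ᶜ) Metric.isClosed_closedBall.isOpen_compl
      (disjoint_compl_right.mono_left Metric.ball_subset_closedBall) (fun y hy => ?_) ?_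
    · rw [mem_union, mem_ball_zero_iff, mem_compl_iff, mem_closedBall_zero_iff, not_le]
      refine lt_or_gt_of_ne fun hn => ?_
      have hiy : ‖invert y‖ = ε := by rw [norm_invert, hn, inv_inv]
      refine disjoint_left.1 (hd E hE) hy ⟨Or.inr ?_, ?_⟩
      · rw [mem_closedBall_zero_iff, hiy]
      · rw [mem_ball_zero_iff, hiy]
        exact lt_irrefl _
    · obtain ⟨y, hyE, hyF⟩ := h.meets E hE
      refine ⟨y, hyE, ?_⟩
      rw [mem_ball_zero_iff]
      rcases hyF with rfl | hyF
      · rw [norm_zero]; positivity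
      · by_contra hlt
        refine hyF (hεS ?_)
        rw [mem_closedBall_zero_iff, norm_invert]
        exact inv_le_of_inv_le₀ hε (not_lt.1 hlt)
  have hK₀out : K₀ ⊆ outside 𝓔 := by
    intro x hx
    refine or_iff_not_imp_left.2 fun hx0 hxE => ?_
    obtain ⟨E, hE, hxE⟩ := mem_iUnion₂.1 hxE
    have hxE := interior_subset hxE
    refine disjoint_left.1 (hd E hE) hxE ?_
    rw [mem_preimage, invert_invert]
    refine ⟨hx, fun hxε => ?_⟩
    have h1 := hball E hE hxE
    rw [mem_ball_zero_iff] at h1 hxε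
    rw [norm_invert, inv_lt_inv₀ (norm_pos_iff.2 hx0) hε] at h1
    exact lt_asymm h1 hxε
  have hout := h.isCompact_outside h0
  have houtS := h.outside_subset hz
  choose x hx hsel using fun i => (Es i).isCC (outside 𝓔) hout houtS
  have hxE : ∀ i, ∃ E ∈ 𝓔, invert (x i) ∈ interior E := by
    intro i
    have := (hx i).2
    simp only [outside, mem_ofPred_eq, not_or, not_not, mem_iUnion₂, exists_prop] at this
    exact this.2
  choose D hD hxD using hxE
  have hxF : ∀ i, invert (x i) ∉ F := by
    rintro i (hi | hi)
    · exact (hx i).2 (Or.inl (invert_eq_zero.1 hi))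
    · rw [invert_invert] at hi
      exact hi (hx i).1
  have hinj : InjOn D (Iic m) := by
    intro i hi j hj hij
    by_contra hne
    have hsub : invert ⁻¹' (interior (D i) \ F) ⊆ Sg \ outside 𝓔 := by
      intro y hy
      have hy0 : y ≠ 0 := by
        rintro rfl
        exact hy.2 (Or.inl invert_zero)
      refine ⟨?_, ?_⟩
      · by_contra hyS
        exact hy.2 (Or.inr (by rwa [invert_invert]))
      · rintro (h1 | h1)
        · exact hy0 h1
        · exact h1 (mem_biUnion (hD i) hy.1)
    have hpc := isPreconnected_invert_preimage
      (h.isPreconnected_interior_diff hFk hFc (hD i)) fun h1 => h1.2 h0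
    have hji : x j ∈ (Es i).sel (outside 𝓔) := by
      rw [hsel i]
      exact hpc.subset_connectedComponentIn ⟨hxD i, hxF i⟩ hsub
        ⟨by rw [hij]; exact hxD j, hxF j⟩
    have hjj : x j ∈ (Es j).sel (outside 𝓔) := by
      rw [hsel j]
      exact mem_connectedComponentIn (hx j)
    have hKo : K i j ⊆ outside 𝓔 := Subset.trans (subset_union_of_subset_left
      (subset_biUnion_of_mem (u := fun p : ℕ × ℕ => K p.1 p.2)
        (show (i, j) ∈ P from ⟨hi, hj, hne⟩)) _) hK₀out
    have hi' := (Es i).mono _ _ (hK i j hne) hout (hKS i j hne) houtS hKo hji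
    have hj' := (Es j).mono _ _ (hK i j hne) hout (hKS i j hne) houtS hKo hjj
    obtain ⟨a, -, ha⟩ := (Es i).isCC _ (hK i j hne) (hKS i j hne)
    obtain ⟨b, -, hb⟩ := (Es j).isCC _ (hK i j hne) (hKS i j hne)
    refine hKne i j hne ?_
    rw [ha] at hi' ⊢
    rw [hb] at hj' ⊢
    rw [connectedComponentIn_eq hi', connectedComponentIn_eq hj']
  have h1 := ncard_le_ncard (image_subset_iff.2 fun i _ => hD i : D '' Iic m ⊆ 𝓔) h.finite
  rw [hinj.ncard_image, ncard_eq_toFinset_card'] at h1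
  simpa using h1

lemma isConnected_diff_zero {Sg : Set Plane} (hop : IsOpen Sg) (hc : IsPreconnected Sg)
    (hz : (0 : Plane) ∈ Sg) : IsConnected (Sg \ {0}) := by
  obtain ⟨ε, hε, hεS⟩ := Metric.isOpen_iff.1 hop 0 hz
  have hring := isConnected_ring le_rfl hε
  rw [Metric.closedBall_zero] at hring
  exact ⟨hring.nonempty.mono (sdiff_subset_sdiff_left hεS), isPreconnected_diff_of_collar hc
    isClosed_singleton Metric.isOpen_ball (singleton_subset_iff.2 (Metric.mem_ball_self hε))
    hring.isPreconnected hεS hring.nonempty⟩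

/-- The conclusion of the theorem on simple exhaustions. -/
def HasSimpleExhaustion (Sg : Set Plane) : Prop :=
  ∃ Sn : ℕ → Set (ℝ × ℝ),
    (∀ n, IsCompactSurfaceWithBoundary (Sn n)) ∧
    (∀ n, Sn n ⊆ Sg) ∧
    (∀ n, Sn n ⊆ interior (Sn (n + 1))) ∧
    (⋃ n, Sn n) = Sg ∧
    IsAnnulus (Sn 0) ∧
    (∀ n, ∀ x ∈ Sn (n + 1) \ interior (Sn n),
      (∃! D : Set (ℝ × ℝ),
        (∃ y ∈ frontier (connectedComponentIn (Sn (n + 1) \ interior (Sn n)) x),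
          D = connectedComponentIn
            (frontier (connectedComponentIn (Sn (n + 1) \ interior (Sn n)) x)) y) ∧
        D ⊆ frontier (Sn n)) ∧
      (∃ y ∈ frontier (connectedComponentIn (Sn (n + 1) \ interior (Sn n)) x),
        connectedComponentIn
          (frontier (connectedComponentIn (Sn (n + 1) \ interior (Sn n)) x)) y ⊆
          frontier (Sn (n + 1)))) ∧
    (∀ n, (∃! C : Set (ℝ × ℝ),
        (∃ x ∈ Sn (n + 1) \ interior (Sn n),
          C = connectedComponentIn (Sn (n + 1) \ interior (Sn n)) x) ∧
        ¬ IsAnnulus C) ∧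
      (∀ x ∈ Sn (n + 1) \ interior (Sn n),
        ¬ IsAnnulus (connectedComponentIn (Sn (n + 1) \ interior (Sn n)) x) →
        IsPairOfPants (connectedComponentIn (Sn (n + 1) \ interior (Sn n)) x)))

lemma hasSimpleExhaustion_of_zero_mem {Sg : Set Plane} (hop : IsOpen Sg) (hc : IsPreconnected Sg)
    (hz : (0 : Plane) ∈ Sg)
    (hends : ∃ Es : ℕ → SetEnd Sg, ∀ m n : ℕ, m ≠ n →
      ∃ K : Set Plane, IsCompact K ∧ K ⊆ Sg ∧ (Es m).sel K ≠ (Es n).sel K) :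
    HasSimpleExhaustion Sg := by
  obtain ⟨Es, hEs⟩ := hends
  set F : Set Plane := {y | y = 0 ∨ invert y ∉ Sg} with hF
  have hFk : IsCompact F := isCompact_invert_compl hop hz
  have h0 : (0 : Plane) ∈ F := Or.inl rfl
  have hFeq : Fᶜ = invert ⁻¹' (Sg \ {0}) := by
    ext1 y
    simp only [hF, mem_compl_iff, mem_ofPred_eq, not_or, not_not, mem_preimage, Set.mem_sdiff,
      mem_singleton_iff, invert_eq_zero]
    exact and_comm
  have hpun := isConnected_diff_zero hop hc hz
  have hFc : IsConnected Fᶜ := by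
    rw [hFeq]
    refine ⟨?_, isPreconnected_invert_preimage hpun.isPreconnected (by simp)⟩
    rw [← image_invert]
    exact hpun.nonempty.image _
  have : SigmaCompactSpace ↥Fᶜ :=
    have := hFk.isClosed.isOpen_compl.locallyCompactSpace
    inferInstance
  obtain ⟨K, hK, hKF⟩ := isSigmaCompact_iff_sigmaCompactSpace.2 this
  obtain ⟨R, hR, hFR⟩ := hFk.isBounded.subset_ball_lt 0 0
  have hcov : IsDiscCover F {Metric.closedBall 0 R} :=
    ⟨finite_singleton _, fun E hE => by rw [hE]; exact tame_closedBall 0 hR,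
      fun E hE => by rw [hE]; exact ⟨0, Metric.mem_closedBall_self hR.le, h0⟩,
      pairwiseDisjoint_singleton _ _, by
        rw [biUnion_singleton, interior_closedBall _ hR.ne']
        exact hFR⟩
  obtain ⟨f, hf0, hfs, hfK⟩ := exists_simple_sequence hFk hFc hK
    (fun k => disjoint_left.2 fun y hy => (hKF ▸ mem_iUnion_of_mem k hy : y ∈ Fᶜ))
    (exists_compact_lt_ncard hop hz hFc.isPreconnected hEs) hcov
  refine ⟨fun n => outside (f (n + 1)), fun n => (hfs n).right.isCompactSurfaceWithBoundary h0,
    fun n => (hfs n).right.outside_subset hz, fun n => (hfs (n + 1)).outside_subset_interior,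
    (iUnion_subset fun n => (hfs n).right.outside_subset hz).antisymm fun x hx => ?_,
    (hfs 0).right.isAnnulus_outside h0 ?_, fun n x hx => (hfs (n + 1)).boundary_components h0 hx,
    fun n => (hfs (n + 1)).component_types h0⟩
  · rcases eq_or_ne x 0 with rfl | hx0
    · exact mem_iUnion_of_mem 0 (Or.inl rfl)
    · have hxF : invert x ∈ Fᶜ := by
        rw [hFeq, mem_preimage, invert_invert]
        exact ⟨hx, hx0⟩
      rw [← hKF] at hxF
      obtain ⟨k, hk⟩ := mem_iUnion.1 hxF
      obtain ⟨n, hn⟩ := hfK k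
      have hxn : x ∈ outside (f n) := by
        refine Or.inr fun hxE => ?_
        obtain ⟨E, hE, hxE⟩ := mem_iUnion₂.1 hxE
        exact disjoint_left.1 (hn E hE) (interior_subset hxE) hk
      exact mem_iUnion_of_mem n (interior_subset ((hfs n).outside_subset_interior hxn))
  · rw [(hfs 0).ncard, hf0, ncard_singleton]

lemma IsCompactSurfaceWithBoundary.image {A : Set Plane} (hA : IsCompactSurfaceWithBoundary A)
    (h : Plane ≃ₜ Plane) : IsCompactSurfaceWithBoundary (h '' A) := by
  refine ⟨hA.1.image h.continuous, ?_⟩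
  rintro _ ⟨x, hx, rfl⟩
  obtain ⟨U, hxU, hU, W, hW, hWo, ⟨e⟩⟩ := hA.2 x hx
  refine ⟨h '' U, mem_image_of_mem h hxU, h.isOpenMap U hU, W, hW, hWo, ⟨?_⟩⟩
  exact (Homeomorph.setCongr (image_inter h.injective).symm).trans ((h.image _).symm.trans e)

lemma isAnnulus_image_iff {A : Set Plane} (h : Plane ≃ₜ Plane) :
    IsAnnulus (h '' A) ↔ IsAnnulus A :=
  ⟨fun hA => hA.map fun e => (h.image A).trans e, fun hA => hA.image h⟩

lemma HasSimpleExhaustion.image {Sg : Set Plane} (hS : HasSimpleExhaustion Sg)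
    (h : Plane ≃ₜ Plane) : HasSimpleExhaustion (h '' Sg) := by
  obtain ⟨Sn, h1, h2, h3, h4, h5, h6, h7⟩ := hS
  have hd : ∀ n, h '' Sn (n + 1) \ interior (h '' Sn n) = h '' (Sn (n + 1) \ interior (Sn n)) :=
    fun n => by rw [image_sdiff h.injective, h.image_interior]
  have hcc : ∀ (S : Set Plane) (x : Plane), x ∈ S →
      connectedComponentIn (h '' S) (h x) = h '' connectedComponentIn S x :=
    fun S x hx => (h.image_connectedComponentIn hx).symm
  refine ⟨fun n => h '' Sn n, fun n => (h1 n).image h, fun n => image_mono (h2 n), fun n => ?_, ?_,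
    h5.image h, fun n => ?_, fun n => ?_⟩
  · rw [← h.image_interior]
    exact image_mono (h3 n)
  · rw [← image_iUnion, h4]
  · simp only [hd]
    rintro _ ⟨x, hx, rfl⟩
    obtain ⟨⟨D, ⟨⟨y, hy, rfl⟩, hyD⟩, huniq⟩, z, hz, hzf⟩ := h6 n x hx
    rw [hcc _ _ hx, ← h.image_frontier, ← h.image_frontier, ← h.image_frontier]
    refine ⟨⟨_, ⟨⟨h y, mem_image_of_mem h hy, rfl⟩, ?_⟩, ?_⟩, h z, mem_image_of_mem h hz, ?_⟩
    · rw [hcc _ _ hy]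
      exact image_mono hyD
    · rintro _ ⟨⟨_, ⟨w, hw, rfl⟩, rfl⟩, hwD⟩
      rw [hcc _ _ hw] at hwD ⊢
      rw [hcc _ _ hy]
      exact congrArg _ (huniq _ ⟨⟨w, hw, rfl⟩, (image_subset_image_iff h.injective).1 hwD⟩)
    · rw [hcc _ _ hz]
      exact image_mono hzf
  · simp only [hd]
    obtain ⟨⟨C, ⟨⟨x, hx, rfl⟩, hxC⟩, huniq⟩, hp⟩ := h7 n
    refine ⟨⟨_, ⟨⟨h x, mem_image_of_mem h hx, rfl⟩, ?_⟩, ?_⟩, ?_⟩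
    · rwa [hcc _ _ hx, isAnnulus_image_iff]
    · rintro _ ⟨⟨_, ⟨w, hw, rfl⟩, rfl⟩, hwC⟩
      rw [hcc _ _ hw, isAnnulus_image_iff] at hwC
      rw [hcc _ _ hw, hcc _ _ hx]
      exact congrArg _ (huniq _ ⟨⟨w, hw, rfl⟩, hwC⟩)
    · rintro _ ⟨w, hw, rfl⟩ hwC
      rw [hcc _ _ hw, isAnnulus_image_iff] at hwC
      rw [hcc _ _ hw]
      exact (hp w hw hwC).image h

lemma preimage_subset_of_subset_image {X Y : Type*} {f : X → Y} (hf : Function.Injective f)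
    {S : Set X} {K : Set Y} (hK : K ⊆ f '' S) : f ⁻¹' K ⊆ S := fun x hx => by
  obtain ⟨y, hy, hxy⟩ := hK hx
  rwa [← hf hxy]

/-- The image of an end under a homeomorphism. -/
def SetEnd.map {X Y : Type*} [TopologicalSpace X] [TopologicalSpace Y] {S : Set X} (e : SetEnd S)
    (h : X ≃ₜ Y) : SetEnd (h '' S) where
  sel K := h '' e.sel (h ⁻¹' K)
  isCC K hK hKS := by
    have hKS' : h ⁻¹' K ⊆ S := preimage_subset_of_subset_image h.injective hKS
    obtain ⟨x, hx, hsel⟩ := e.isCC _ (h.isCompact_preimage.2 hK) hKS'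
    have hd : h '' (S \ h ⁻¹' K) = h '' S \ K := by
      rw [image_sdiff h.injective, h.image_preimage]
    refine ⟨h x, hd ▸ mem_image_of_mem h hx, ?_⟩
    rw [hsel, h.image_connectedComponentIn hx, hd]
  noncpt K hK hKS := by
    rw [← h.image_closure, ← image_inter h.injective, h.isCompact_image]
    exact e.noncpt _ (h.isCompact_preimage.2 hK) (preimage_subset_of_subset_image h.injective hKS)
  mono K K' hK hK' hKS hKS' hKK' :=
    image_mono (e.mono _ _ (h.isCompact_preimage.2 hK) (h.isCompact_preimage.2 hK')
      (preimage_subset_of_subset_image h.injective hKS)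
      (preimage_subset_of_subset_image h.injective hKS') (preimage_mono hKK'))

/-- **Existence of simple exhaustions** (Corollary `co:simple`): every planar domain
with infinitely many ends admits a compact exhaustion `Σ₁ ⊆ Σ₂ ⊆ ⋯` by compact
subsurfaces-with-boundary such that `Σ₁` is an annulus, each component of
`Σ_{n+1} ∖ int(Σ_n)` has exactly one boundary component in `∂Σ_n` and at least one in
`∂Σ_{n+1}`, and exactly one such component is not an annulus — and it is a pair of
pants. -/
theorem simple_exhaustion_of_planar_domain_with_infinitely_many_ends
    (Sg : Set (ℝ × ℝ)) (hne : Sg.Nonempty) (hop : IsOpen Sg) (hconn : IsConnected Sg)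
    -- `Sg` has infinitely many ends: there is an infinite family of pairwise
    -- distinct ends
    (hends : ∃ Es : ℕ → SetEnd Sg, ∀ m n : ℕ, m ≠ n →
      ∃ K : Set (ℝ × ℝ), IsCompact K ∧ K ⊆ Sg ∧ (Es m).sel K ≠ (Es n).sel K) :
    ∃ Sn : ℕ → Set (ℝ × ℝ),
      (∀ n, IsCompactSurfaceWithBoundary (Sn n)) ∧
      (∀ n, Sn n ⊆ Sg) ∧
      (∀ n, Sn n ⊆ interior (Sn (n + 1))) ∧
      (⋃ n, Sn n) = Sg ∧
      -- (1) the first piece is an annulus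
      IsAnnulus (Sn 0) ∧
      -- (2) each component of `Σ_{n+1} ∖ int Σ_n` has exactly one boundary component
      -- in `∂Σ_n` and at least one boundary component in `∂Σ_{n+1}`
      (∀ n, ∀ x ∈ Sn (n + 1) \ interior (Sn n),
        (∃! D : Set (ℝ × ℝ),
          (∃ y ∈ frontier (connectedComponentIn (Sn (n + 1) \ interior (Sn n)) x),
            D = connectedComponentIn
              (frontier (connectedComponentIn (Sn (n + 1) \ interior (Sn n)) x)) y) ∧
          D ⊆ frontier (Sn n)) ∧
        (∃ y ∈ frontier (connectedComponentIn (Sn (n + 1) \ interior (Sn n)) x),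
          connectedComponentIn
            (frontier (connectedComponentIn (Sn (n + 1) \ interior (Sn n)) x)) y ⊆
            frontier (Sn (n + 1)))) ∧
      -- (3) exactly one component of `Σ_{n+1} ∖ int Σ_n` is not an annulus, and that
      -- component is a pair of pants
      (∀ n, (∃! C : Set (ℝ × ℝ),
          (∃ x ∈ Sn (n + 1) \ interior (Sn n),
            C = connectedComponentIn (Sn (n + 1) \ interior (Sn n)) x) ∧
          ¬ IsAnnulus C) ∧
        (∀ x ∈ Sn (n + 1) \ interior (Sn n),
          ¬ IsAnnulus (connectedComponentIn (Sn (n + 1) \ interior (Sn n)) x) →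
          IsPairOfPants (connectedComponentIn (Sn (n + 1) \ interior (Sn n)) x))) := by
  obtain ⟨q, hq⟩ := hne
  obtain ⟨Es, hEs⟩ := hends
  let h : Plane ≃ₜ Plane := Homeomorph.addRight (-q)
  have key : HasSimpleExhaustion (h '' Sg) := by
    refine hasSimpleExhaustion_of_zero_mem (h.isOpenMap _ hop)
      (hconn.isPreconnected.image _ h.continuous.continuousOn) ⟨q, hq, add_neg_cancel q⟩
      ⟨fun n => (Es n).map h, fun m n hmn => ?_⟩
    obtain ⟨K, hK, hKS, hne⟩ := hEs m n hmn
    refine ⟨h '' K, hK.image h.continuous, image_mono hKS, fun he => hne ?_⟩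
    change h '' (Es m).sel (h ⁻¹' (h '' K)) = h '' (Es n).sel (h ⁻¹' (h '' K)) at he
    rwa [h.injective.preimage_image, h.injective.image_injective.eq_iff] at he
  have := key.image h.symm
  rwa [← image_comp, Homeomorph.symm_comp_self, image_id] at this

end
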